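/- arXiv:math/0203165 — 5 statements merged into one kernel-verified Lean document; each statement's English description precedes it below -/
import Mathlib

section
/- Let ρ be a G_k-group structure on D8 with associated fields K, K₁ = k(√u), K₂ = k(√v) (u, v ∈ k*), and let z ∈ k and s, w ∈ k* be any elements with 1 − z²u = s²·uv and K = k(√v, √(w(1+z√u)/2), √(w(1−z√u)/2)) (such elements exist). Then ρ is realizable in GL₂(k̄) if and only if ℍ[k,−v,w] ≅ M₂(k) as k-algebras. -/
open Matrix IntermediateField DihedralGroup Quaternion

noncomputable section

/-- The absolute Galois group of `k`. -/
abbrev Gk (k : Type*) [Field k] := AlgebraicClosure k ≃ₐ[k] AlgebraicClosure k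

/-- The entrywise Galois action on `GL₂(k̄)`, as a homomorphism to automorphisms. -/
def galHom (k : Type*) [Field k] :
    Gk k →* MulAut (GL (Fin 2) (AlgebraicClosure k)) where
  toFun σ := Units.mapEquiv σ.mapMatrix.toRingEquiv.toMulEquiv
  map_one' := by
    ext M i j
    simp [AlgEquiv.mapMatrix_apply]
  map_mul' σ τ := by
    ext M i j
    simp [AlgEquiv.mapMatrix_apply]

/-- A `G_k`-group structure on a group `G` : a homomorphism `ρ : G_k → Aut(G)` whose kernel
contains `Gal(k̄/L)` for some finite Galois extension `L/k` inside `k̄`. -/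
def IsGkGroupStructure (k : Type*) [Field k] {G : Type*} [Group G]
    (ρ : Gk k →* MulAut G) : Prop :=
  ∃ L : IntermediateField k (AlgebraicClosure k),
    FiniteDimensional k L ∧ Normal k L ∧ ∀ σ : Gk k, (∀ x ∈ L, σ x = x) → ρ σ = 1

/-- A `G_k`-group structure `ρ` on `G` is realizable in `GL₂(k̄)` if there is a
Galois-stable subgroup `A ≤ GL₂(k̄)` and a group isomorphism `φ : G → A` with
`φ(ρ(σ)(g)) = σ(φ(g))` for all `σ ∈ G_k`, `g ∈ G`. -/
def IsRealizable (k : Type*) [Field k] {G : Type*} [Group G]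
    (ρ : Gk k →* MulAut G) : Prop :=
  ∃ A : Subgroup (GL (Fin 2) (AlgebraicClosure k)),
    (∀ σ : Gk k, ∀ M ∈ A, galHom k σ M ∈ A) ∧
    ∃ φ : G ≃* A, ∀ (σ : Gk k) (g : G),
      ((φ (ρ σ g) : A) : GL (Fin 2) (AlgebraicClosure k)) = galHom k σ (φ g)

/-- `w` is represented by the binary quadratic form `⟨1, v⟩`. -/
def IsRepresented {F : Type*} [Field F] (v w : F) : Prop :=
  ∃ p q : F, p ^ 2 + v * q ^ 2 = w

lemma IsRepresented.mul {F : Type*} [Field F] {v w w' : F} (h : IsRepresented v w)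
    (h' : IsRepresented v w') : IsRepresented v (w * w') := by
  obtain ⟨p, q, rfl⟩ := h
  obtain ⟨p', q', rfl⟩ := h'
  exact ⟨p * p' - v * q * q', p * q' + q * p', by ring⟩

lemma IsRepresented.mul_iff {F : Type*} [Field F] {v n w : F} (hn : n ≠ 0)
    (h : IsRepresented v n) : IsRepresented v (n * w) ↔ IsRepresented v w := by
  refine ⟨fun h' ↦ ?_, h.mul⟩
  obtain ⟨p, q, hpq⟩ := h.mul h'
  refine ⟨p / n, q / n, ?_⟩
  field_simp
  linear_combination hpq

/-- Two anticommuting `2 × 2` matrices with squares `-v` and `w` force `⟨1, v⟩` to represent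
`w`. -/
lemma isRepresented_of_anticomm {F : Type*} [Field F] (h2 : (2 : F) ≠ 0) {v w : F} (hv : v ≠ 0)
    (I J : Matrix (Fin 2) (Fin 2) F) (hI : I * I = (-v) • 1) (hJ : J * J = w • 1)
    (hIJ : I * J = -(J * I)) : IsRepresented v w := by
  have hI' : ∀ i j, (I * I) i j = ((-v) • (1 : Matrix (Fin 2) (Fin 2) F)) i j := by simp [hI]
  have hJ' : ∀ i j, (J * J) i j = (w • (1 : Matrix (Fin 2) (Fin 2) F)) i j := by simp [hJ]
  have hIJ' : ∀ i j, (I * J) i j = (-(J * I)) i j := by simp [hIJ]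
  simp only [Fin.forall_fin_two, Matrix.mul_apply, Fin.sum_univ_two, Matrix.smul_apply,
    Matrix.neg_apply, Matrix.one_apply, Fin.isValue, smul_eq_mul] at hI' hJ' hIJ'
  simp at hI' hJ' hIJ'
  obtain ⟨⟨i00, i01⟩, i10, i11⟩ := hI'
  obtain ⟨⟨j00, j01⟩, j10, j11⟩ := hJ'
  obtain ⟨⟨a00, a01⟩, a10, a11⟩ := hIJ'
  by_cases h : I 1 0 = 0
  · have hv' : v = -(I 0 0) ^ 2 := by rw [h] at i00; linear_combination i00
    have h0 : I 0 0 ≠ 0 := by rintro h0; apply hv; rw [hv', h0]; ring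
    refine ⟨(w + 1) / 2, (w - 1) / (2 * I 0 0), ?_⟩
    field_simp
    rw [hv']
    ring
  · refine ⟨-J 0 0 + J 1 0 / I 1 0 * I 0 0, -J 1 0 / I 1 0, ?_⟩
    field_simp
    linear_combination J 1 0 ^ 2 * i00 + I 1 0 ^ 2 * j00 - J 1 0 * I 1 0 * a00

lemma quaternion_split_iff {F : Type*} [Field F] (h2 : (2 : F) ≠ 0) {v w : F} (hv : v ≠ 0)
    (hw : w ≠ 0) :
    Nonempty (ℍ[F, -v, w] ≃ₐ[F] Matrix (Fin 2) (Fin 2) F) ↔ IsRepresented v w := by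
  constructor
  · rintro ⟨e⟩
    let B := (QuaternionAlgebra.Basis.self F (c₁ := -v) (c₂ := 0) (c₃ := w)).compHom e.toAlgHom
    refine isRepresented_of_anticomm h2 hv B.i B.j ?_ B.j_mul_j ?_
    · simp
    · rw [B.i_mul_j, B.j_mul_i]; simp
  · rintro ⟨p, q, hpq⟩
    let B : QuaternionAlgebra.Basis (Matrix (Fin 2) (Fin 2) F) (-v) 0 w :=
      { i := !![0, -v; 1, 0]
        j := !![p, v * q; q, -p]
        k := !![-v * q, v * p; p, v * q]
        i_mul_i := by
          ext i j; fin_cases i <;> fin_cases j <;> simp [Matrix.mul_apply, Fin.sum_univ_two]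
        j_mul_j := by
          subst hpq
          ext i j; fin_cases i <;> fin_cases j <;> simp [Matrix.mul_apply, Fin.sum_univ_two] <;>
            ring
        i_mul_j := by
          ext i j; fin_cases i <;> fin_cases j <;> simp [Matrix.mul_apply, Fin.sum_univ_two]
        j_mul_i := by
          ext i j; fin_cases i <;> fin_cases j <;> simp [Matrix.mul_apply, Fin.sum_univ_two] <;>
            ring }
    have hinj : Function.Injective B.liftHom := by
      rw [injective_iff_map_eq_zero]
      intro x hx
      have hx' : ∀ i j, (B.liftHom x) i j = 0 := by simp [hx]
      simp [Fin.forall_fin_two, B, QuaternionAlgebra.Basis.lift,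
        Matrix.algebraMap_matrix_apply] at hx'
      obtain ⟨⟨e1, e2⟩, e3, e4⟩ := hx'
      have hre : x.re = 0 := by
        have : 2 * x.re = 0 := by linear_combination e1 + e4
        simpa [h2] using this
      have hI : x.imI = 0 := by
        have : (2 * v) * x.imI = 0 := by linear_combination v * e3 - e2
        simpa [h2, hv] using this
      rw [hre] at e1
      rw [hI] at e3
      have hJ : x.imJ = 0 := by
        have : w * x.imJ = 0 := by
          linear_combination p * e1 + v * q * e3 - x.imJ * hpq
        simpa [hw] using this
      have hK : x.imK = 0 := by
        have : w * x.imK = 0 := by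
          linear_combination p * e3 - q * e1 - x.imK * hpq
        simpa [hw] using this
      ext <;> assumption
    have hrank : Module.finrank F ℍ[F, -v, w] = Module.finrank F (Matrix (Fin 2) (Fin 2) F) := by
      rw [QuaternionAlgebra.finrank_eq_four, Module.finrank_matrix]; simp
    exact ⟨AlgEquiv.ofBijective B.liftHom
      ⟨hinj, (LinearMap.injective_iff_surjective_of_finrank_eq_finrank
        (f := B.liftHom.toLinearMap) hrank).1 hinj⟩⟩

/-- The cosine of `i` quarter turns. -/
def quarterCos : ZMod 4 → ℤ := ![1, 0, -1, 0]

/-- The sine of `i` quarter turns. -/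
def quarterSin : ZMod 4 → ℤ := ![0, 1, 0, -1]

lemma quarterCos_add (i j : ZMod 4) (ψ : ℤˣ) : quarterCos (i + ((ψ : ℤ) : ZMod 4) * j) =
    quarterCos i * quarterCos j - ψ * (quarterSin i * quarterSin j) := by
  revert i j ψ; decide

lemma quarterSin_add (i j : ZMod 4) (ψ : ℤˣ) : quarterSin (i + ((ψ : ℤ) : ZMod 4) * j) =
    quarterSin i * quarterCos j + ψ * (quarterCos i * quarterSin j) := by
  revert i j ψ; decide

lemma map_r_of_map_r_one (f : MulAut (DihedralGroup 4)) {ψ : ℤ}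
    (h : f (r 1) = r (ψ : ZMod 4)) (j : ZMod 4) : f (r j) = r ((ψ : ZMod 4) * j) := by
  have : (r j : DihedralGroup 4) = r 1 ^ j.val := by simp
  rw [this, map_pow, h, r_pow]
  simp

lemma map_sr_of_map_r_one (f : MulAut (DihedralGroup 4)) {ψ : ℤ} {i : ZMod 4}
    (h : f (r 1) = r (ψ : ZMod 4)) (h' : f (sr 0) = sr i) (j : ZMod 4) :
    f (sr j) = sr (i + (ψ : ZMod 4) * j) := by
  have : (sr j : DihedralGroup 4) = sr 0 * r j := by simp
  rw [this, map_mul, map_r_of_map_r_one f h, h', sr_mul_r]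

lemma mulAut_dihedral_four (f : MulAut (DihedralGroup 4)) :
    ∃ (ψ : ℤˣ) (i : ZMod 4), f (r 1) = r (((ψ : ℤ) : ZMod 4)) ∧ f (sr 0) = sr i := by
  have h2 : f (r 1) * f (r 1) ≠ 1 := by
    rw [← map_mul]
    simp only [ne_eq, map_eq_one_iff f f.injective]
    decide
  have hc : f (r 1) * f (sr 0) ≠ f (sr 0) * f (r 1) := by
    rw [← map_mul, ← map_mul]
    simp only [ne_eq, f.injective.eq_iff]
    decide
  generalize f (r 1) = x at *
  generalize f (sr 0) = y at *
  revert x y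
  decide

/-- The action of `σ` on the elements generating `K`, in terms of signs and of the image of the
generators of `D8` under `ρ σ`. -/
structure SignData {k : Type*} [Field k] (ρ : Gk k →* MulAut (DihedralGroup 4))
    (su sv a b : AlgebraicClosure k) (σ : Gk k) (χ ψ c : ℤˣ) (i : ZMod 4) : Prop where
  map_r : ρ σ (r 1) = r ((ψ : ℤ) : ZMod 4)
  map_sr : ρ σ (sr 0) = sr i
  map_su : σ su = ((χ : ℤ) : AlgebraicClosure k) * su
  map_sv : σ sv = ((ψ : ℤ) : AlgebraicClosure k) * sv
  map_a : σ a = ((c : ℤ) : AlgebraicClosure k) * (quarterCos i * a + quarterSin i * b)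
  map_b : σ b = ((c : ℤ) : AlgebraicClosure k) * ((ψ : ℤ) : AlgebraicClosure k) *
    (-quarterSin i * a + quarterCos i * b)

lemma SignData.mul {k : Type*} [Field k] {ρ : Gk k →* MulAut (DihedralGroup 4)}
    {su sv a b : AlgebraicClosure k} {σ τ : Gk k} {χ ψ c χ' ψ' c' : ℤˣ} {i i' : ZMod 4}
    (h : SignData ρ su sv a b σ χ ψ c i) (h' : SignData ρ su sv a b τ χ' ψ' c' i') :
    SignData ρ su sv a b (σ * τ) (χ * χ') (ψ * ψ') (c * c') (i + ((ψ : ℤ) : ZMod 4) * i') where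
  map_r := by
    rw [map_mul, MulAut.mul_apply, h'.map_r, map_r_of_map_r_one (ρ σ) h.map_r]
    simp
  map_sr := by
    rw [map_mul, MulAut.mul_apply, h'.map_sr,
      map_sr_of_map_r_one (ρ σ) h.map_r h.map_sr]
  map_su := by
    rw [AlgEquiv.mul_apply, h'.map_su, map_mul, h.map_su]; simp; ring
  map_sv := by
    rw [AlgEquiv.mul_apply, h'.map_sv, map_mul, h.map_sv]; simp; ring
  map_a := by
    rw [AlgEquiv.mul_apply, h'.map_a, quarterCos_add, quarterSin_add]
    simp only [map_mul, map_add, map_intCast, h.map_a, h.map_b]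
    push_cast
    ring
  map_b := by
    have hψ : ((ψ : ℤ) : AlgebraicClosure k) * ((ψ : ℤ) : AlgebraicClosure k) = 1 := by
      rcases Int.units_eq_one_or ψ with rfl | rfl <;> simp
    rw [AlgEquiv.mul_apply, h'.map_b, quarterCos_add, quarterSin_add]
    simp only [map_mul, map_add, map_neg, map_intCast, h.map_a, h.map_b]
    push_cast
    linear_combination (c * c' * ψ' * quarterSin i' * (quarterCos i * a + quarterSin i * b)) * hψ

/-- A sign that is multiplicative in a pair of signs extends to a character. -/
lemma exists_pow_mul_pow_eq (S : ℤˣ → ℤˣ → ℤˣ → Prop)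
    (hmul : ∀ {χ ψ c χ' ψ' c'}, S χ ψ c → S χ' ψ' c' → S (χ * χ') (ψ * ψ') (c * c'))
    (hone : ∀ c, S 1 1 c → c = 1) :
    ∃ α β : ℕ, ∀ χ ψ c, S χ ψ c → c = χ ^ α * ψ ^ β := by
  have key : ∀ {χ ψ c χ' ψ' c'}, S χ ψ c → S χ' ψ' c' → χ * χ' = 1 → ψ * ψ' = 1 → c = c' := by
    intro χ ψ c χ' ψ' c' h h' hχ hψ
    have h1 := hmul h h'
    rw [hχ, hψ] at h1
    rw [← Int.units_inv_eq_self c', eq_inv_iff_mul_eq_one]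
    exact hone _ h1
  have hpow : ∀ c : ℤˣ, ∃ α : ℕ, c = (-1) ^ α := fun c ↦ by
    rcases Int.units_eq_one_or c with rfl | rfl
    exacts [⟨0, rfl⟩, ⟨1, rfl⟩]
  have hsign : ∀ x : ℤˣ, x = 1 ∨ x = -1 := Int.units_eq_one_or
  by_cases hA : ∃ c, S (-1) 1 c
  · obtain ⟨c₁, h₁⟩ := hA
    obtain ⟨α, rfl⟩ := hpow c₁
    by_cases hB : ∃ c, S 1 (-1) c
    · obtain ⟨c₂, h₂⟩ := hB
      obtain ⟨β, rfl⟩ := hpow c₂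
      refine ⟨α, β, fun χ ψ c h ↦ ?_⟩
      rcases hsign χ with rfl | rfl <;> rcases hsign ψ with rfl | rfl
      · simpa using hone c h
      · simpa using key h h₂ rfl rfl
      · simpa using key h h₁ rfl rfl
      · exact key h (hmul h₁ h₂) rfl rfl
    · refine ⟨α, 0, fun χ ψ c h ↦ ?_⟩
      rcases hsign χ with rfl | rfl <;> rcases hsign ψ with rfl | rfl
      · simpa using hone c h
      · exact absurd ⟨_, h⟩ hB
      · simpa using key h h₁ rfl rfl
      · exact absurd ⟨_, hmul h h₁⟩ hB
  · by_cases hB : ∃ c, S 1 (-1) c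
    · obtain ⟨c₂, h₂⟩ := hB
      obtain ⟨β, rfl⟩ := hpow c₂
      refine ⟨0, β, fun χ ψ c h ↦ ?_⟩
      rcases hsign χ with rfl | rfl <;> rcases hsign ψ with rfl | rfl
      · simpa using hone c h
      · simpa using key h h₂ rfl rfl
      · exact absurd ⟨_, h⟩ hA
      · exact absurd ⟨_, hmul h h₂⟩ hA
    · by_cases hC : ∃ c, S (-1) (-1) c
      · obtain ⟨c₃, h₃⟩ := hC
        obtain ⟨α, rfl⟩ := hpow c₃
        refine ⟨α, 0, fun χ ψ c h ↦ ?_⟩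
        rcases hsign χ with rfl | rfl <;> rcases hsign ψ with rfl | rfl
        · simpa using hone c h
        · exact absurd ⟨_, h⟩ hB
        · exact absurd ⟨_, h⟩ hA
        · simpa using key h h₃ rfl rfl
      · refine ⟨0, 0, fun χ ψ c h ↦ ?_⟩
        rcases hsign χ with rfl | rfl <;> rcases hsign ψ with rfl | rfl
        · simpa using hone c h
        · exact absurd ⟨_, h⟩ hB
        · exact absurd ⟨_, h⟩ hA
        · exact absurd ⟨_, h⟩ hC

lemma mulAut_apply_mul_inv_mem_iff (f : MulAut (DihedralGroup 4)) {ψ : ℤˣ} {i : ZMod 4}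
    (h : f (r 1) = r ((ψ : ℤ) : ZMod 4)) (h' : f (sr 0) = sr i) :
    (∀ g : DihedralGroup 4, f g * g⁻¹ ∈ ({1, r 2} : Set (DihedralGroup 4))) ↔ i = 0 ∨ i = 2 := by
  have h₁ := map_r_of_map_r_one f h
  have h₂ := map_sr_of_map_r_one f h h'
  constructor
  · intro H
    have := H (sr 0)
    rw [h'] at this
    revert this
    simp only [Set.mem_insert_iff, Set.mem_singleton_iff]
    clear * -
    revert i
    decide
  · intro H g
    rcases g with j | j
    · rw [h₁]
      simp only [Set.mem_insert_iff, Set.mem_singleton_iff]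
      clear * -
      revert j ψ
      decide
    · rw [h₂]
      simp only [Set.mem_insert_iff, Set.mem_singleton_iff]
      clear * - H
      revert j ψ i
      decide

lemma mulAut_eq_one_iff (f : MulAut (DihedralGroup 4)) {i : ZMod 4}
    (h : f (r 1) = r 1) (h' : f (sr 0) = sr i) : f = 1 ↔ i = 0 := by
  constructor
  · rintro rfl
    simpa using h'.symm
  · rintro rfl
    have h₀ : f (r 1) = r ((1 : ℤ) : ZMod 4) := by simpa using h
    ext g
    rcases g with j | j
    · simp [map_r_of_map_r_one f h₀]
    · simp [map_sr_of_map_r_one f h₀ h']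

lemma exists_units_smul_of_sq_eq {F : Type*} [Field F] {x y : F} (h : x ^ 2 = y ^ 2) :
    ∃ c : ℤˣ, x = ((c : ℤ) : F) * y := by
  rcases sq_eq_sq_iff_eq_or_eq_neg.1 h with h | h
  · exact ⟨1, by simpa using h⟩
  · exact ⟨-1, by simpa using h⟩

/-- The quaternion algebra obtained by twisting `M₂` by `ρ` contains the fixed element `A U + B UV`
anticommuting with `√v V`; its square differs from `w` by a value of `⟨1, v⟩`. -/
lemma exists_semilinear_pair {k : Type*} [Field k] (hchar : (2 : k) ≠ 0)
    (ρ : Gk k →* MulAut (DihedralGroup 4))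
    (u v w : k) (hu : u ≠ 0) (hv : v ≠ 0) (hw : w ≠ 0)
    (z s : k) (hs : s ≠ 0) (hid : 1 - z ^ 2 * u = s ^ 2 * (u * v))
    (su sv a b : AlgebraicClosure k)
    (hsu : su ^ 2 = algebraMap k (AlgebraicClosure k) u)
    (hsv : sv ^ 2 = algebraMap k (AlgebraicClosure k) v)
    (ha : a ^ 2 = algebraMap k (AlgebraicClosure k) w *
      (1 + algebraMap k (AlgebraicClosure k) z * su) / 2)
    (hb : b ^ 2 = algebraMap k (AlgebraicClosure k) w *
      (1 - algebraMap k (AlgebraicClosure k) z * su) / 2)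
    (hK1 : ∀ σ : Gk k,
      (∀ g : DihedralGroup 4, ρ σ g * g⁻¹ ∈ ({1, r 2} : Set (DihedralGroup 4))) ↔ σ su = su)
    (hK2 : ∀ σ : Gk k, ρ σ (r 1) = r 1 ↔ σ sv = sv)
    (hK : ∀ σ : Gk k, ρ σ = 1 ↔ (σ sv = sv ∧ σ a = a ∧ σ b = b)) :
    ∃ (A B : AlgebraicClosure k) (w' : k), w' ≠ 0 ∧ (IsRepresented v w' ↔ IsRepresented v w) ∧
      A ^ 2 + B ^ 2 = algebraMap k (AlgebraicClosure k) w' ∧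
      ∀ σ : Gk k, ∃ (ψ : ℤˣ) (i : ZMod 4), ρ σ (r 1) = r ((ψ : ℤ) : ZMod 4) ∧
        ρ σ (sr 0) = sr i ∧ σ sv = ((ψ : ℤ) : AlgebraicClosure k) * sv ∧
        σ A = quarterCos i * A + quarterSin i * B ∧
        σ B = ((ψ : ℤ) : AlgebraicClosure k) * (-quarterSin i * A + quarterCos i * B) := by
  set ι := algebraMap k (AlgebraicClosure k) with hι
  have hinj : Function.Injective ι := ι.injective
  have h2 : (2 : AlgebraicClosure k) ≠ 0 := by
    have := (map_ne_zero ι).2 hchar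
    rwa [map_ofNat] at this
  have hsu0 : su ≠ 0 := by rintro rfl; apply hu; apply hinj; rw [← hsu]; simp
  have hsv0 : sv ≠ 0 := by rintro rfl; apply hv; apply hinj; rw [← hsv]; simp
  have hid' : 1 - ι z ^ 2 * su ^ 2 = ι s ^ 2 * (su ^ 2 * sv ^ 2) := by
    rw [hsu, hsv]
    simpa using congrArg ι hid
  have hw' : ι w ≠ 0 := (map_ne_zero ι).2 hw
  have hs' : ι s ≠ 0 := (map_ne_zero ι).2 hs
  have habsq : (a * b) ^ 2 = (ι w * ι s / 2 * (su * sv)) ^ 2 := by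
    rw [mul_pow, ha, hb]
    field_simp
    linear_combination hid'
  have hab0 : a * b ≠ 0 := by
    intro h
    rw [h, zero_pow two_ne_zero, eq_comm] at habsq
    simp [hw', hs', h2, hsu0, hsv0] at habsq
  have ha0 : a ≠ 0 := left_ne_zero_of_mul hab0
  have hb0 : b ≠ 0 := right_ne_zero_of_mul hab0
  obtain ⟨m, hm⟩ := exists_units_smul_of_sq_eq habsq
  have hex : ∀ σ : Gk k, ∃ χ ψ c i, SignData ρ su sv a b σ χ ψ c i := by
    intro σ
    obtain ⟨ψ₀, i, hr, hsr⟩ := mulAut_dihedral_four (ρ σ)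
    obtain ⟨χ, hχ⟩ : ∃ χ : ℤˣ, σ su = ((χ : ℤ) : AlgebraicClosure k) * su :=
      exists_units_smul_of_sq_eq (by rw [← map_pow, hsu, σ.commutes])
    obtain ⟨ψ, hψ⟩ : ∃ ψ : ℤˣ, σ sv = ((ψ : ℤ) : AlgebraicClosure k) * sv :=
      exists_units_smul_of_sq_eq (by rw [← map_pow, hsv, σ.commutes])
    have hneg : ∀ x : AlgebraicClosure k, x ≠ 0 → -x ≠ x := fun x hx h ↦ by
      have : 2 * x = 0 := by linear_combination -h
      simp [h2, hx] at this
    have hψψ : ψ = ψ₀ := by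
      have := hK2 σ
      rw [hr, hψ] at this
      rcases Int.units_eq_one_or ψ with rfl | rfl <;>
        rcases Int.units_eq_one_or ψ₀ with rfl | rfl
      · rfl
      · exact absurd (this.2 (by simp)) (by decide)
      · exact absurd (this.1 (by simp)) (by simpa using hneg _ hsv0)
      · rfl
    subst hψψ
    have hi := hK1 σ
    rw [mulAut_apply_mul_inv_mem_iff _ hr hsr, hχ] at hi
    have hσab : σ a * σ b = χ * ψ * (a * b) := by
      rw [← map_mul, hm]
      simp only [map_mul, map_intCast, map_div₀, map_ofNat, hχ, hψ]
      rw [hι, σ.commutes, σ.commutes]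
      ring
    have hσa : σ a ^ 2 = ι w * (1 + ι z * (χ * su)) / 2 := by
      rw [← map_pow, ha]
      simp only [map_mul, map_add, map_one, map_div₀, map_ofNat, hχ]
      rw [hι, σ.commutes, σ.commutes]
    rcases Int.units_eq_one_or χ with rfl | rfl
    · have hi' : i = 0 ∨ i = 2 := hi.2 (by simp)
      obtain ⟨c, hc⟩ := exists_units_smul_of_sq_eq (x := σ a) (y := a) (by rw [hσa, ha]; simp)
      have hcb : σ b = c * (ψ * b) := by
        have hcc : (c : AlgebraicClosure k) * c = 1 := by
          rcases Int.units_eq_one_or c with rfl | rfl <;> simp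
        apply mul_left_cancel₀ ha0
        rw [hc] at hσab
        push_cast at hσab
        linear_combination (c : AlgebraicClosure k) * hσab - a * σ b * hcc
      rcases hi' with rfl | rfl
      · refine ⟨1, ψ, c, 0, hr, hsr, hχ, hψ, ?_, ?_⟩
        · rw [hc]; simp [quarterCos, quarterSin]
        · rw [hcb]; simp [quarterCos, quarterSin]; ring
      · refine ⟨1, ψ, -c, 2, hr, hsr, hχ, hψ, ?_, ?_⟩
        · rw [hc]; simp [quarterCos, quarterSin]
        · rw [hcb]; simp [quarterCos, quarterSin]; ring
    · have hi' : i = 1 ∨ i = 3 := by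
        have : ¬ (i = 0 ∨ i = 2) := fun h ↦ hneg _ hsu0 (by simpa using hi.1 h)
        clear * - this
        revert i; decide
      obtain ⟨c, hc⟩ := exists_units_smul_of_sq_eq (x := σ a) (y := b)
        (by rw [hσa, hb]; push_cast; ring)
      have hcb : σ b = -(c * (ψ * a)) := by
        have hcc : (c : AlgebraicClosure k) * c = 1 := by
          rcases Int.units_eq_one_or c with rfl | rfl <;> simp
        apply mul_left_cancel₀ hb0
        rw [hc] at hσab
        push_cast at hσab
        linear_combination (c : AlgebraicClosure k) * hσab - b * σ b * hcc
      rcases hi' with rfl | rfl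
      · refine ⟨-1, ψ, c, 1, hr, hsr, hχ, hψ, ?_, ?_⟩
        · rw [hc]; simp [quarterCos, quarterSin]
        · rw [hcb]; simp [quarterCos, quarterSin]; ring
      · refine ⟨-1, ψ, -c, 3, hr, hsr, hχ, hψ, ?_, ?_⟩
        · rw [hc]; simp [quarterCos, quarterSin]
        · rw [hcb]; simp [quarterCos, quarterSin]; ring
  obtain ⟨α, β, hαβ⟩ := exists_pow_mul_pow_eq
    (fun χ ψ c ↦ ∃ σ i, SignData ρ su sv a b σ χ ψ c i)
    (fun ⟨_, _, h⟩ ⟨_, _, h'⟩ ↦ ⟨_, _, h.mul h'⟩) (by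
      rintro c ⟨σ, i, h⟩
      have hi : i = 0 ∨ i = 2 :=
        (mulAut_apply_mul_inv_mem_iff _ h.map_r h.map_sr).1 ((hK1 σ).2 (by simp [h.map_su]))
      have hone := mulAut_eq_one_iff (ρ σ) (by simpa using h.map_r) h.map_sr
      rw [hK, h.map_sv, h.map_a, h.map_b] at hone
      rcases Int.units_eq_one_or c with rfl | rfl
      · rfl
      exfalso
      rcases hi with rfl | rfl
      · have := (hone.2 rfl).2.1
        simp [quarterCos, quarterSin] at this
        have : 2 * a = 0 := by linear_combination -this
        simp [h2, ha0] at this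
      · have : (2 : ZMod 4) = 0 := hone.1 (by simp [quarterCos, quarterSin])
        exact absurd this (by decide))
  have huRep : IsRepresented v u := ⟨z * u, s * u, by linear_combination -u * hid⟩
  have hvRep : IsRepresented v v := ⟨0, 1, by ring⟩
  have hpow : ∀ {n : k} (j : ℕ), IsRepresented v n → IsRepresented v (n ^ j) := fun j h ↦ by
    induction j with
    | zero => exact ⟨1, 0, by ring⟩
    | succ j ih => rw [pow_succ]; exact ih.mul h
  have hn : u ^ α * v ^ β ≠ 0 := mul_ne_zero (pow_ne_zero _ hu) (pow_ne_zero _ hv)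
  refine ⟨su ^ α * sv ^ β * a, su ^ α * sv ^ β * b, u ^ α * v ^ β * w, mul_ne_zero hn hw,
    ((hpow α huRep).mul (hpow β hvRep)).mul_iff hn, ?_, fun σ ↦ ?_⟩
  · have : a ^ 2 + b ^ 2 = ι w := by
      rw [ha, hb]; field_simp; ring
    simp only [map_mul, map_pow]
    rw [← hsu, ← hsv, ← this]
    ring
  · obtain ⟨χ, ψ, c, i, h⟩ := hex σ
    have hc := hαβ χ ψ c ⟨σ, i, h⟩
    have hcc : (c : AlgebraicClosure k) * c = 1 := by
      rcases Int.units_eq_one_or c with rfl | rfl <;> simp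
    have hlam : σ (su ^ α * sv ^ β) = c * (su ^ α * sv ^ β) := by
      rw [hc]
      simp only [map_mul, map_pow, h.map_su, h.map_sv]
      push_cast
      ring
    refine ⟨ψ, i, h.map_r, h.map_sr, h.map_sv, ?_, ?_⟩
    · rw [map_mul, hlam, h.map_a]
      linear_combination (su ^ α * sv ^ β * (quarterCos i * a + quarterSin i * b)) * hcc
    · rw [map_mul, hlam, h.map_b]
      linear_combination (su ^ α * sv ^ β * ψ * (-quarterSin i * a + quarterCos i * b)) * hcc

/-- Rotation by `i` quarter turns, for a given quarter turn `V`. -/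
def quarterTurn {L : Type*} [Field L] (V : Matrix (Fin 2) (Fin 2) L) (i : ZMod 4) :
    Matrix (Fin 2) (Fin 2) L :=
  (quarterCos i : L) • (1 : Matrix (Fin 2) (Fin 2) L) + (quarterSin i : L) • V

lemma quarterTurn_mul {L : Type*} [Field L] {V : Matrix (Fin 2) (Fin 2) L} (hV : V * V = -1)
    (i j : ZMod 4) : quarterTurn V i * quarterTurn V j = quarterTurn V (i + j) := by
  have hc := quarterCos_add i j 1
  have hs := quarterSin_add i j 1
  simp only [Units.val_one, Int.cast_one, one_mul] at hc hs
  simp only [quarterTurn, hc, hs, add_mul, mul_add, smul_mul_assoc, mul_smul_comm, one_mul,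
    mul_one, hV]
  push_cast
  module

lemma quarterTurn_mul_reflection {L : Type*} [Field L] {U V : Matrix (Fin 2) (Fin 2) L}
    (hVU : V * U = -(U * V)) (i : ZMod 4) :
    quarterTurn V i * U = U * quarterTurn V (-i) := by
  have hc : quarterCos (-i) = quarterCos i := by revert i; decide
  have hs : quarterSin (-i) = -quarterSin i := by revert i; decide
  simp only [quarterTurn, hc, hs, add_mul, mul_add, smul_mul_assoc, mul_smul_comm, one_mul,
    mul_one, hVU]
  push_cast
  module

/-- The representation of the dihedral group of order `8` attached to a quarter turn `V` and a
reflection `U`. -/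
def dihedralRep {L : Type*} [Field L] (U V : Matrix (Fin 2) (Fin 2) L) (hV : V * V = -1)
    (hU : U * U = 1) (hVU : V * U = -(U * V)) :
    DihedralGroup 4 →* Matrix (Fin 2) (Fin 2) L where
  toFun
    | r i => quarterTurn V i
    | sr i => U * quarterTurn V i
  map_one' := by
    rw [one_def]
    simp [quarterTurn, quarterCos, quarterSin]
  map_mul' x y := by
    rcases x with i | i <;> rcases y with j | j
    · simp only [r_mul_r, quarterTurn_mul hV]
    · simp only [r_mul_sr]
      rw [← mul_assoc, quarterTurn_mul_reflection hVU, mul_assoc, quarterTurn_mul hV]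
      congr 2
      ring
    · simp only [sr_mul_r, mul_assoc, quarterTurn_mul hV]
    · simp only [sr_mul_sr]
      rw [mul_assoc, ← mul_assoc _ U, quarterTurn_mul_reflection hVU, mul_assoc, ← mul_assoc,
        hU, one_mul, quarterTurn_mul hV]
      congr 1
      ring

lemma coe_map_r_eq_quarterTurn {L : Type*} [Field L]
    (F : DihedralGroup 4 →* GL (Fin 2) L)
    (hV : (F (r 2) : Matrix (Fin 2) (Fin 2) L) = -1) (i : ZMod 4) :
    (F (r i) : Matrix (Fin 2) (Fin 2) L) = quarterTurn (F (r 1)).val i := by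
  have h3 : F (r 3) = F (r 2) * F (r 1) := by rw [← map_mul]; rfl
  have hi : i = 0 ∨ i = 1 ∨ i = 2 ∨ i = 3 := by revert i; decide
  rcases hi with rfl | rfl | rfl | rfl
  · simp [quarterTurn, quarterCos, quarterSin]
  · simp [quarterTurn, quarterCos, quarterSin]
  · simp [quarterTurn, quarterCos, quarterSin, hV]
  · simp [quarterTurn, quarterCos, quarterSin, h3, hV]

lemma coe_map_r_two_eq_neg_one {L : Type*} [Field L] (h2 : (2 : L) ≠ 0)
    (F : DihedralGroup 4 →* GL (Fin 2) L) (hF : Function.Injective F) :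
    (F (r 2) : Matrix (Fin 2) (Fin 2) L) = -1 := by
  have hsq : (F (r 2)).val * (F (r 2)).val = 1 := by
    rw [← Units.val_mul, ← map_mul, show (r 2 * r 2 : DihedralGroup 4) = 1 from rfl, map_one,
      Units.val_one]
  have hdet : (F (r 2)).val.det = 1 := by
    have h : (r 2 : DihedralGroup 4) = sr 0 * r 1 * (sr 0)⁻¹ * (r 1)⁻¹ := by decide
    have h' : Matrix.GeneralLinearGroup.det (F (r 2)) = 1 := by
      rw [h]
      simp only [map_mul, map_inv]
      rw [mul_inv_cancel_comm, mul_inv_cancel]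
    simpa using congrArg Units.val h'
  have hne : (F (r 2)).val ≠ 1 := fun h ↦ by
    have : F (r 2) = F 1 := by rw [map_one]; exact Units.ext h
    exact absurd (hF this) (by decide)
  generalize (F (r 2)).val = Z at *
  have hadj : Z = !![Z 1 1, -Z 0 1; -Z 1 0, Z 0 0] := by
    rw [← Matrix.adjugate_fin_two, ← Matrix.mul_one Z.adjugate, ← hsq, ← mul_assoc,
      Matrix.adjugate_mul, hdet, one_smul, one_mul]
  have h00 : Z 0 0 = Z 1 1 := congrFun (congrFun hadj 0) 0
  have h01 : Z 0 1 = 0 := by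
    have h : Z 0 1 = -Z 0 1 := congrFun (congrFun hadj 0) 1
    have : 2 * Z 0 1 = 0 := by linear_combination h
    simpa [h2] using this
  have h10 : Z 1 0 = 0 := by
    have h : Z 1 0 = -Z 1 0 := congrFun (congrFun hadj 1) 0
    have : 2 * Z 1 0 = 0 := by linear_combination h
    simpa [h2] using this
  have hscalar : Z = Z 1 1 • (1 : Matrix (Fin 2) (Fin 2) L) := by
    ext i j
    fin_cases i <;> fin_cases j <;> simp [h00, h01, h10]
  have h11 : Z 1 1 = 1 ∨ Z 1 1 = -1 := by
    apply sq_eq_sq_iff_eq_or_eq_neg.1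
    rw [Matrix.det_fin_two, h00, h01] at hdet
    linear_combination hdet
  rcases h11 with h | h
  · exact absurd (by rw [hscalar, h, one_smul]) hne
  · rw [hscalar, h, neg_smul, one_smul]

lemma monoidHom_dihedral_ext {n : ℕ} [NeZero n] {M : Type*} [Monoid M] {f g : DihedralGroup n →* M}
    (h : f (r 1) = g (r 1)) (h' : f (sr 0) = g (sr 0)) : f = g := by
  have hr : ∀ j : ZMod n, f (r j) = g (r j) := fun j ↦ by
    have : (r j : DihedralGroup n) = r 1 ^ j.val := by simp
    rw [this, map_pow, map_pow, h]
  ext x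
  rcases x with j | j
  · exact hr j
  · have : (sr j : DihedralGroup n) = sr 0 * r j := by simp
    rw [this, map_mul, map_mul, h', hr]

lemma injective_of_map_r_two_ne_one {M : Type*} [Group M] (f : DihedralGroup 4 →* M)
    (h : f (r 2) ≠ 1) : Function.Injective f := by
  rw [injective_iff_map_eq_one]
  intro g hg
  by_contra hne
  have key : g = r 2 ∨ g * g = r 2 ∨ g * r 1 * g⁻¹ * (r 1)⁻¹ = r 2 := by
    clear hg
    revert g
    decide
  apply h
  rcases key with h | h | h
  · rw [← h, hg]
  · rw [← h, map_mul, hg, one_mul]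
  · rw [← h]
    simp only [map_mul, map_inv, hg, one_mul, inv_one, mul_one, mul_inv_cancel]

lemma exists_map_eq_of_fixed {k : Type*} [Field k] [PerfectField k]
    (M : Matrix (Fin 2) (Fin 2) (AlgebraicClosure k))
    (h : ∀ σ : Gk k, M.map σ = M) :
    ∃ N : Matrix (Fin 2) (Fin 2) k, N.map (algebraMap k (AlgebraicClosure k)) = M := by
  have : ∀ i j, ∃ x : k, algebraMap k (AlgebraicClosure k) x = M i j := fun i j ↦
    (InfiniteGalois.mem_range_algebraMap_iff_fixed _).2 fun σ ↦ congrFun (congrFun (h σ) i) j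
  choose N hN using this
  exact ⟨Matrix.of N, by ext i j; simp [hN]⟩

lemma coe_galHom {k : Type*} [Field k] (σ : Gk k) (M : GL (Fin 2) (AlgebraicClosure k)) :
    (galHom k σ M).val = M.val.map σ := rfl

lemma isRepresented_of_isRealizable {k : Type*} [Field k] [PerfectField k]
    (hchar : (2 : k) ≠ 0) (ρ : Gk k →* MulAut (DihedralGroup 4)) {v w' : k} (hv : v ≠ 0)
    {sv A B : AlgebraicClosure k} (hsv : sv ^ 2 = algebraMap k (AlgebraicClosure k) v)
    (hAB : A ^ 2 + B ^ 2 = algebraMap k (AlgebraicClosure k) w')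
    (h : ∀ σ : Gk k, ∃ (ψ : ℤˣ) (i : ZMod 4), ρ σ (r 1) = r ((ψ : ℤ) : ZMod 4) ∧
      ρ σ (sr 0) = sr i ∧ σ sv = ((ψ : ℤ) : AlgebraicClosure k) * sv ∧
      σ A = quarterCos i * A + quarterSin i * B ∧
      σ B = ((ψ : ℤ) : AlgebraicClosure k) * (-quarterSin i * A + quarterCos i * B))
    (hreal : IsRealizable k ρ) : IsRepresented v w' := by
  obtain ⟨G, -, φ, hφ⟩ := hreal
  have h2 : (2 : AlgebraicClosure k) ≠ 0 := by
    have := (map_ne_zero (algebraMap k (AlgebraicClosure k))).2 hchar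
    rwa [map_ofNat] at this
  let F : DihedralGroup 4 →* GL (Fin 2) (AlgebraicClosure k) := G.subtype.comp φ.toMonoidHom
  have hFinj : Function.Injective F := Subtype.val_injective.comp φ.injective
  have hFeq : ∀ (σ : Gk k) (g : DihedralGroup 4), (F g).val.map σ = (F (ρ σ g)).val := fun σ g ↦
    (congrArg Units.val (hφ σ g)).symm
  have hr2 := coe_map_r_two_eq_neg_one h2 F hFinj
  have hrot := coe_map_r_eq_quarterTurn F hr2
  set V := (F (r 1)).val with hVdef
  set U := (F (sr 0)).val with hUdef
  have hV : V * V = -1 := by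
    rw [← hr2, hVdef, ← Units.val_mul, ← map_mul]; rfl
  have hU : U * U = 1 := by
    rw [hUdef, ← Units.val_mul, ← map_mul, sr_mul_self, map_one, Units.val_one]
  have hVU : V * U = -(U * V) := by
    have : F (r 1) * F (sr 0) = F (r 2) * (F (sr 0) * F (r 1)) := by
      simp only [← map_mul]; rfl
    have := congrArg Units.val this
    simpa [hr2] using this
  have hsr : ∀ i, (F (sr i)).val = U * quarterTurn V i := fun i ↦ by
    rw [← hrot, hUdef, ← Units.val_mul, ← map_mul, sr_mul_r, zero_add]
  have hmap_smul : ∀ (σ : Gk k) (x : AlgebraicClosure k)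
      (M : Matrix (Fin 2) (Fin 2) (AlgebraicClosure k)), (x • M).map σ = σ x • M.map σ := by
    intro σ x M; ext; simp
  have hfix : ∀ σ : Gk k, (sv • V).map σ = sv • V ∧
      (A • U + B • (U * V)).map σ = A • U + B • (U * V) := by
    intro σ
    obtain ⟨ψ, i, hr, hs, hsvσ, hAσ, hBσ⟩ := h σ
    have hψ : ((ψ : ℤ) : AlgebraicClosure k) * ((ψ : ℤ) : AlgebraicClosure k) = 1 := by
      rcases Int.units_eq_one_or ψ with rfl | rfl <;> simp
    have hVσ : V.map σ = ((ψ : ℤ) : AlgebraicClosure k) • V := by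
      rw [show V.map σ = (F (ρ σ (r 1))).val from hFeq σ (r 1), hr, hrot]
      rcases Int.units_eq_one_or ψ with rfl | rfl
      · simp [quarterTurn, quarterCos, quarterSin]
      · have : ((((-1 : ℤˣ) : ℤ) : ZMod 4)) = 3 := by decide
        rw [this]
        simp [quarterTurn, quarterCos, quarterSin]
    have hUσ : U.map σ = U * quarterTurn V i := by rw [hUdef, hFeq, hs, hsr]
    have hcs : (quarterCos i : AlgebraicClosure k) ^ 2 + (quarterSin i : AlgebraicClosure k) ^ 2
        = 1 := by
      have : quarterCos i ^ 2 + quarterSin i ^ 2 = 1 := by clear * -; revert i; decide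
      simpa using congrArg (Int.cast : ℤ → AlgebraicClosure k) this
    have hUV : (U * V).map σ = U.map σ * V.map σ := Matrix.map_mul
    refine ⟨?_, ?_⟩
    · rw [hmap_smul, hVσ, hsvσ, smul_smul]
      congr 1
      linear_combination sv * hψ
    · rw [Matrix.map_add _ (map_add σ), hmap_smul, hmap_smul, hUV, hVσ, hUσ, hAσ, hBσ]
      simp only [quarterTurn, mul_add, add_mul, mul_smul_comm, smul_mul_assoc, mul_one,
        mul_assoc U, hV, mul_neg]
      linear_combination (norm := module)
        (A * hcs - quarterSin i * (-quarterSin i * A + quarterCos i * B) * hψ) • U +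
        (B * hcs + quarterCos i * (-quarterSin i * A + quarterCos i * B) * hψ) • (U * V)
  obtain ⟨I, hI⟩ := exists_map_eq_of_fixed _ fun σ ↦ (hfix σ).1
  obtain ⟨J, hJ⟩ := exists_map_eq_of_fixed _ fun σ ↦ (hfix σ).2
  have hinj : Function.Injective
      (RingHom.mapMatrix (m := Fin 2) (algebraMap k (AlgebraicClosure k))) :=
    Matrix.map_injective (algebraMap k (AlgebraicClosure k)).injective
  have hI' : RingHom.mapMatrix (algebraMap k (AlgebraicClosure k)) I = sv • V := hI
  have hJ' : RingHom.mapMatrix (algebraMap k (AlgebraicClosure k)) J = A • U + B • (U * V) := hJ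
  have hscalar : ∀ x : k, RingHom.mapMatrix (m := Fin 2) (algebraMap k (AlgebraicClosure k))
      (x • 1) = algebraMap k (AlgebraicClosure k) x • 1 := fun x ↦ by
    ext i j; fin_cases i <;> fin_cases j <;> simp
  have hUVU : U * (V * U) = -V := by rw [hVU, mul_neg, ← mul_assoc, hU, one_mul]
  have hUVUV : U * (V * (U * V)) = 1 := by
    rw [← mul_assoc V, ← mul_assoc, hUVU, neg_mul, hV, neg_neg]
  have hUUV : U * (U * V) = V := by rw [← mul_assoc, hU, one_mul]
  have hVUV : V * (U * V) = U := by rw [← mul_assoc, hVU, neg_mul, mul_assoc, hV]; simp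
  refine isRepresented_of_anticomm hchar hv I J (hinj ?_) (hinj ?_) (hinj ?_)
  · rw [map_mul, hI', hscalar, map_neg, ← hsv]
    simp only [smul_mul_assoc, mul_smul_comm, hV]
    module
  · rw [map_mul, hJ', hscalar, ← hAB]
    simp only [mul_add, add_mul, smul_mul_assoc, mul_smul_comm, mul_assoc, hU, hUVU, hUVUV, hUUV]
    module
  · rw [map_neg, map_mul, map_mul, hI', hJ']
    simp only [mul_add, add_mul, smul_mul_assoc, mul_smul_comm, mul_assoc, hVU, hVUV, hV]
    simp only [mul_neg, mul_one]
    module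

lemma isRealizable_of_isRepresented {k : Type*} [Field k]
    (hchar : (2 : k) ≠ 0) (ρ : Gk k →* MulAut (DihedralGroup 4)) {v w' : k} (hv : v ≠ 0)
    (hw' : w' ≠ 0) {sv A B : AlgebraicClosure k}
    (hsv : sv ^ 2 = algebraMap k (AlgebraicClosure k) v)
    (hAB : A ^ 2 + B ^ 2 = algebraMap k (AlgebraicClosure k) w')
    (h : ∀ σ : Gk k, ∃ (ψ : ℤˣ) (i : ZMod 4), ρ σ (r 1) = r ((ψ : ℤ) : ZMod 4) ∧
      ρ σ (sr 0) = sr i ∧ σ sv = ((ψ : ℤ) : AlgebraicClosure k) * sv ∧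
      σ A = quarterCos i * A + quarterSin i * B ∧
      σ B = ((ψ : ℤ) : AlgebraicClosure k) * (-quarterSin i * A + quarterCos i * B))
    (hrep : IsRepresented v w') : IsRealizable k ρ := by
  obtain ⟨p, q, hpq⟩ := hrep
  set ι := algebraMap k (AlgebraicClosure k) with hι
  have h2 : (2 : AlgebraicClosure k) ≠ 0 := by
    have := (map_ne_zero ι).2 hchar
    rwa [map_ofNat] at this
  have hsv0 : sv ≠ 0 := by
    rintro rfl
    exact hv (ι.injective (by rw [← hsv]; simp))
  have hw0 : ι w' ≠ 0 := (map_ne_zero ι).2 hw'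
  have hpq' : ι p ^ 2 + sv ^ 2 * ι q ^ 2 = ι w' := by
    rw [hsv, ← hpq]; simp
  let V : Matrix (Fin 2) (Fin 2) (AlgebraicClosure k) := !![0, -sv; sv⁻¹, 0]
  let U : Matrix (Fin 2) (Fin 2) (AlgebraicClosure k) := (ι w')⁻¹ •
    !![A * ι p - B * sv * ι q, A * sv ^ 2 * ι q + B * sv * ι p;
      A * ι q + B * ι p * sv⁻¹, -(A * ι p) + B * sv * ι q]
  have hV : V * V = -1 := by
    ext i j
    fin_cases i <;> fin_cases j <;> simp [V, Matrix.mul_apply, Fin.sum_univ_two, hsv0]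
  have hU : U * U = 1 := by
    have key : (A ^ 2 + B ^ 2) * (ι p ^ 2 + sv ^ 2 * ι q ^ 2) = ι w' ^ 2 := by
      rw [hAB, hpq']; ring
    ext i j
    fin_cases i <;> fin_cases j <;>
      simp [U, Matrix.mul_apply, Fin.sum_univ_two] <;> field_simp
    · linear_combination key
    · ring
    · ring
    · linear_combination key
  have hVU : V * U = -(U * V) := by
    ext i j
    fin_cases i <;> fin_cases j <;>
      simp [U, V, Matrix.mul_apply, Fin.sum_univ_two] <;> field_simp <;> ring
  let F : DihedralGroup 4 →* GL (Fin 2) (AlgebraicClosure k) :=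
    (dihedralRep U V hV hU hVU).toHomUnits
  have hFr : ∀ i, (F (r i)).val = quarterTurn V i := fun i ↦ rfl
  have hFsr : ∀ i, (F (sr i)).val = U * quarterTurn V i := fun i ↦ rfl
  have hFinj : Function.Injective F := by
    apply injective_of_map_r_two_ne_one
    intro h
    have h' : quarterTurn V 2 = 1 := congrArg Units.val h
    have h'' := congrFun (congrFun h' 0) 0
    simp [quarterTurn, quarterCos, quarterSin, V] at h''
    apply h2
    linear_combination -h''
  have hF : ∀ σ : Gk k, F.comp (ρ σ).toMonoidHom = (galHom k σ).toMonoidHom.comp F := by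
    intro σ
    obtain ⟨ψ, i, hr, hs, hsvσ, hAσ, hBσ⟩ := h σ
    apply monoidHom_dihedral_ext
    · apply Units.ext
      change (F (ρ σ (r 1))).val = (F (r 1)).val.map σ
      rw [hr, hFr, hFr]
      rcases Int.units_eq_one_or ψ with rfl | rfl
      · have hsvσ' : σ sv = sv := by simpa using hsvσ
        ext i j
        fin_cases i <;> fin_cases j <;>
          simp [quarterTurn, quarterCos, quarterSin, V, hsvσ']
      · have h3 : ((((-1 : ℤˣ) : ℤ) : ZMod 4)) = 3 := by decide
        have hsvσ' : σ sv = -sv := by simpa using hsvσ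
        rw [h3]
        ext i j
        fin_cases i <;> fin_cases j <;>
          simp [quarterTurn, quarterCos, quarterSin, V, hsvσ', inv_neg]
    · apply Units.ext
      change (F (ρ σ (sr 0))).val = (F (sr 0)).val.map σ
      rw [hs, hFsr, hFsr, show quarterTurn V 0 = 1 by simp [quarterTurn, quarterCos, quarterSin],
        mul_one]
      have hp : ∀ x, σ (ι x) = ι x := σ.commutes
      rcases Int.units_eq_one_or ψ with rfl | rfl
      · have hsvσ' : σ sv = sv := by simpa using hsvσ
        have hBσ' : σ B = -quarterSin i * A + quarterCos i * B := by simpa using hBσ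
        ext i j
        fin_cases i <;> fin_cases j <;>
          simp [U, V, quarterTurn, hsvσ', hAσ, hBσ', hp, Matrix.mul_apply, Fin.sum_univ_two] <;>
          field_simp <;> ring
      · have hsvσ' : σ sv = -sv := by simpa using hsvσ
        have hBσ' : σ B = -(-quarterSin i * A + quarterCos i * B) := by simpa using hBσ
        ext i j
        fin_cases i <;> fin_cases j <;>
          simp [U, V, quarterTurn, hsvσ', hAσ, hBσ', hp, Matrix.mul_apply, Fin.sum_univ_two,
            inv_neg] <;>
          field_simp <;> ring
  have hF' : ∀ (σ : Gk k) (g : DihedralGroup 4), F (ρ σ g) = galHom k σ (F g) := fun σ g ↦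
    DFunLike.congr_fun (hF σ) g
  refine ⟨F.range, ?_, MonoidHom.ofInjective hFinj, hF'⟩
  rintro σ _ ⟨g, rfl⟩
  exact ⟨ρ σ g, hF' σ g⟩

/-- Theorem 1 of Cardona–Quer.
A `G_k`-group structure `ρ` on `D8` (realized as `DihedralGroup 4`, `U = sr 0`, `V = r 1`),
with fields `K₁ = k(√u)`, `K₂ = k(√v)` and
`K = k(√v, √(w(1+z√u)/2), √(w(1−z√u)/2))` where `1 − z²u = s²·uv`,
is realizable in `GL₂(k̄)` if and only if `ℍ[k,−v,w] ≅ M₂(k)` as `k`-algebras.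
Field equalities between fixed fields are expressed, via the Galois correspondence, as
equalities of the corresponding subgroups of `G_k`. -/
theorem realizable_D8_iff_quaternion_split {k : Type*} [Field k] [PerfectField k]
    (hchar : (2 : k) ≠ 0)
    (ρ : Gk k →* MulAut (DihedralGroup 4)) (hρ : IsGkGroupStructure k ρ)
    (u v w : k) (hu : u ≠ 0) (hv : v ≠ 0) (hw : w ≠ 0)
    (z s : k) (hs : s ≠ 0) (hid : 1 - z ^ 2 * u = s ^ 2 * (u * v))
    (su sv a b : AlgebraicClosure k)
    (hsu : su ^ 2 = algebraMap k (AlgebraicClosure k) u)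
    (hsv : sv ^ 2 = algebraMap k (AlgebraicClosure k) v)
    (ha : a ^ 2 = algebraMap k (AlgebraicClosure k) w *
      (1 + algebraMap k (AlgebraicClosure k) z * su) / 2)
    (hb : b ^ 2 = algebraMap k (AlgebraicClosure k) w *
      (1 - algebraMap k (AlgebraicClosure k) z * su) / 2)
    -- `K₁ = k(√u)`:
    (hK1 : ∀ σ : Gk k,
      (∀ g : DihedralGroup 4, ρ σ g * g⁻¹ ∈ ({1, r 2} : Set (DihedralGroup 4))) ↔ σ su = su)
    -- `K₂ = k(√v)`:
    (hK2 : ∀ σ : Gk k, ρ σ (r 1) = r 1 ↔ σ sv = sv)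
    -- `K = k(√v, √(w(1+z√u)/2), √(w(1−z√u)/2))`:
    (hK : ∀ σ : Gk k, ρ σ = 1 ↔ (σ sv = sv ∧ σ a = a ∧ σ b = b)) :
    IsRealizable k ρ ↔ Nonempty (ℍ[k, -v, w] ≃ₐ[k] Matrix (Fin 2) (Fin 2) k) := by
  obtain ⟨A, B, w', hw', hrep, hAB, h⟩ := exists_semilinear_pair hchar ρ u v w hu hv hw z s hs
    hid su sv a b hsu hsv ha hb hK1 hK2 hK
  rw [quaternion_split_iff hchar hv hw, ← hrep]
  exact ⟨isRepresented_of_isRealizable hchar ρ hv hsv hAB h,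
    isRealizable_of_isRepresented hchar ρ hv hw' hsv hAB h⟩

end
end

section
/- Let u, v ∈ k*, z ∈ k and s ∈ k* satisfy u³ − z² = 3s²·v. Fix square roots √u, √v ∈ k̄, a root α ∈ k̄ of the polynomial X³ − (3u/4)X − z/4, and β ∈ k̄ with α² + 3β²/v = u. Then the matrices U = (1/√u)·[[α, β],[3β/v, −α]] and V = (1/2)·[[1, √v],[−3/√v, 1]] are invertible, and they generate a subgroup of GL₂(k̄) of order 12 isomorphic to the dihedral group D12 which is stable under the entrywise action of G_k. -/
open Matrix

noncomputable section

/-- If `V ^ n = 1`, powers of `V` only depend on the exponent modulo `n`. -/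
theorem zpow_cast_zmod_intCast {G : Type*} [Group G] {n : ℕ} {V : G} (hV : V ^ n = 1) (m : ℤ) :
    V ^ (((m : ZMod n)).cast : ℤ) = V ^ m := by
  refine zpow_eq_zpow_iff_modEq.2 (Int.ModEq.of_dvd
    (Int.natCast_dvd_natCast.2 (orderOf_dvd_of_pow_eq_one hV)) ?_)
  rw [← ZMod.intCast_eq_intCast_iff]
  simp

/-- The homomorphism from a dihedral group given by a pair satisfying the dihedral relations. -/
def dihedralLift {G : Type*} [Group G] {n : ℕ} {U V : G} (hU : U * U = 1) (hV : V ^ n = 1)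
    (hUV : U * V * (U * V) = 1) : DihedralGroup n →* G where
  toFun
    | .r i => V ^ (i.cast : ℤ)
    | .sr i => U * V ^ (i.cast : ℤ)
  map_one' := by
    have := zpow_cast_zmod_intCast hV 0
    rw [Int.cast_zero, zpow_zero] at this
    exact this
  map_mul' := by
    have hU' : U⁻¹ = U := inv_eq_of_mul_eq_one_left hU
    have conj : ∀ m : ℤ, V ^ m * U = U * V ^ (-m) := by
      have h1 : U * V * U⁻¹ = V⁻¹ := by
        rw [hU', ← mul_eq_one_iff_eq_inv, mul_assoc, hUV]
      intro m
      have h2 : U * V ^ (-m) * U⁻¹ = V ^ m := by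
        rw [← conj_zpow, h1, _root_.inv_zpow', neg_neg]
      rw [← h2]
      simp
    rintro (i | i) (j | j) <;> obtain ⟨i, rfl⟩ := ZMod.intCast_surjective i <;>
      obtain ⟨j, rfl⟩ := ZMod.intCast_surjective j
    · simp only [DihedralGroup.r_mul_r, ← Int.cast_add, zpow_cast_zmod_intCast hV, _root_.zpow_add]
    · simp only [DihedralGroup.r_mul_sr, ← Int.cast_sub, zpow_cast_zmod_intCast hV]
      rw [← mul_assoc, conj, mul_assoc, ← _root_.zpow_add, neg_add_eq_sub]
    · simp only [DihedralGroup.sr_mul_r, ← Int.cast_add, zpow_cast_zmod_intCast hV, _root_.zpow_add,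
        mul_assoc]
    · simp only [DihedralGroup.sr_mul_sr, ← Int.cast_sub, zpow_cast_zmod_intCast hV]
      rw [mul_assoc, ← mul_assoc _ U, conj, mul_assoc, ← _root_.zpow_add, ← mul_assoc, hU, one_mul,
        neg_add_eq_sub]

/-- Two elements satisfying the dihedral relations generate a dihedral group as soon as the
rotation has the right order and the reflection is not a rotation. -/
theorem nonempty_closure_mulEquiv_dihedralGroup {G : Type*} [Group G] {n : ℕ} {U V : G}
    (hU : U * U = 1) (hV : orderOf V = n) (hUV : U * V * (U * V) = 1)
    (hne : U ∉ Subgroup.zpowers V) :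
    Nonempty (Subgroup.closure {U, V} ≃* DihedralGroup n) := by
  have hVn : V ^ n = 1 := hV ▸ pow_orderOf_eq_one V
  let φ := dihedralLift hU hVn hUV
  have hr : ∀ m : ℤ, φ (.r m) = V ^ m := zpow_cast_zmod_intCast hVn
  have hsr : ∀ m : ℤ, φ (.sr m) = U * V ^ m := fun m =>
    congrArg (U * ·) (zpow_cast_zmod_intCast hVn m)
  have hinj : Function.Injective φ := by
    rw [injective_iff_map_eq_one]
    rintro (i | i) h <;> obtain ⟨i, rfl⟩ := ZMod.intCast_surjective i
    · rw [hr, ← orderOf_dvd_iff_zpow_eq_one, hV, ← ZMod.intCast_zmod_eq_zero_iff_dvd] at h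
      rw [h, DihedralGroup.r_zero]
    · rw [hsr] at h
      exact absurd ⟨-i, by simpa using (eq_inv_of_mul_eq_one_left h).symm⟩ hne
  have hrange : φ.range = Subgroup.closure {U, V} := by
    have hUm : U ∈ Subgroup.closure {U, V} := Subgroup.subset_closure (by simp)
    have hVm : V ∈ Subgroup.closure {U, V} := Subgroup.subset_closure (by simp)
    apply le_antisymm
    · rintro _ ⟨i | i, rfl⟩ <;> obtain ⟨i, rfl⟩ := ZMod.intCast_surjective i
      · rw [hr]
        exact zpow_mem hVm i
      · rw [hsr]
        exact mul_mem hUm (zpow_mem hVm i)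
    · rw [Subgroup.closure_le]
      rintro x (rfl | rfl)
      · exact ⟨.sr (0 : ℤ), by rw [hsr, zpow_zero, mul_one]⟩
      · exact ⟨.r (1 : ℤ), by rw [hr, zpow_one]⟩
  exact ⟨((MonoidHom.ofInjective hinj).trans (MulEquiv.subgroupCongr hrange)).symm⟩

section Matrices

variable {F : Type*} [Field F]

/-- For `t ^ 2 * (a ^ 2 + 3 * c ^ 2) = 1`, a reflection preserving the form `X² + Y² w² / 3`. -/
def reflMat (t a c w : F) : Matrix (Fin 2) (Fin 2) F :=
  t • !![a, c * w; 3 * c / w, -a]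

/-- A rotation of order six preserving the form `X² + Y² w² / 3`. -/
def rotMat (w : F) : Matrix (Fin 2) (Fin 2) F :=
  (2 : F)⁻¹ • !![1, w; -3 / w, 1]

theorem reflMat_mul_self {t a c w : F} (hw : w ≠ 0) (h : t ^ 2 * (a ^ 2 + 3 * c ^ 2) = 1) :
    reflMat t a c w * reflMat t a c w = 1 := by
  ext i j
  fin_cases i <;> fin_cases j <;> simp [reflMat, Matrix.mul_apply, Fin.sum_univ_two] <;>
    field_simp <;> ring_nf <;> linear_combination h

theorem reflMat_mul_rotMat (h2 : (2 : F) ≠ 0) {w : F} (hw : w ≠ 0) (t a c : F) :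
    reflMat t a c w * rotMat w = reflMat t ((a - 3 * c) / 2) ((a + c) / 2) w := by
  ext i j
  fin_cases i <;> fin_cases j <;> simp [reflMat, rotMat, Matrix.mul_apply, Fin.sum_univ_two] <;>
    field_simp <;> ring

theorem neg_reflMat (t a c w : F) : -reflMat t a c w = reflMat (-t) a c w := by
  simp [reflMat]

theorem reflMat_neg_neg (t a c w : F) : reflMat t (-a) (-c) w = reflMat (-t) a c w := by
  ext i j
  fin_cases i <;> fin_cases j <;> simp [reflMat]
  ring

theorem det_reflMat {t a c w : F} (hw : w ≠ 0) (h : t ^ 2 * (a ^ 2 + 3 * c ^ 2) = 1) :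
    (reflMat t a c w).det = -1 := by
  simp only [reflMat, Matrix.det_smul, Matrix.det_fin_two_of, Fintype.card_fin]
  field_simp
  linear_combination -h

theorem det_rotMat (h2 : (2 : F) ≠ 0) {w : F} (hw : w ≠ 0) : (rotMat w).det = 1 := by
  simp only [rotMat, Matrix.det_smul, Matrix.det_fin_two_of, Fintype.card_fin]
  field_simp
  ring

theorem rotMat_mul_rotMat_neg (h2 : (2 : F) ≠ 0) {w : F} (hw : w ≠ 0) :
    rotMat w * rotMat (-w) = 1 := by
  ext i j
  fin_cases i <;> fin_cases j <;> simp [rotMat, Matrix.mul_apply, Fin.sum_univ_two] <;>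
    field_simp <;> ring

theorem rotMat_pow_three (h2 : (2 : F) ≠ 0) {w : F} (hw : w ≠ 0) : rotMat w ^ 3 = -1 := by
  rw [pow_succ, pow_two]
  ext i j
  fin_cases i <;> fin_cases j <;> simp [rotMat, Matrix.mul_apply, Fin.sum_univ_two] <;>
    field_simp <;> ring

theorem orderOf_eq_six_of_val_eq_rotMat (h2 : (2 : F) ≠ 0) {w : F} (hw : w ≠ 0)
    {V : GL (Fin 2) F} (hV : (V : Matrix (Fin 2) (Fin 2) F) = rotMat w) : orderOf V = 6 := by
  have h3 : V ^ 3 = -1 := Units.ext (by simp [hV, rotMat_pow_three h2 hw])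
  have hne3 : V ^ 3 ≠ 1 := by
    rw [h3]
    intro h
    have := congrArg (fun M : GL (Fin 2) F => (M : Matrix (Fin 2) (Fin 2) F) 0 0) h
    simp at this
    exact h2 (by linear_combination -this)
  have hne2 : V ^ 2 ≠ 1 := by
    intro h
    rw [pow_succ, h, one_mul] at h3
    have := congrArg (fun M : GL (Fin 2) F => (M : Matrix (Fin 2) (Fin 2) F) 0 1) h3
    simp [hV, rotMat, h2, hw] at this
  have h6 : V ^ 6 = 1 := by
    rw [show 6 = 3 * 2 from rfl, pow_mul, h3, neg_one_sq]
  have hdvd := orderOf_dvd_of_pow_eq_one h6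
  have hle := Nat.le_of_dvd (by norm_num) hdvd
  rw [ne_eq, ← orderOf_dvd_iff_pow_eq_one] at hne2 hne3
  interval_cases orderOf V <;> simp_all

/-- A point of the conic `X² + 3Y² = u` with prescribed tripled angle differs from a given one
by a rotation of order dividing three. -/
theorem conic_eq_or_eq_or_eq (h2 : (2 : F) ≠ 0) {u a c a' c' : F}
    (h : a ^ 2 + 3 * c ^ 2 = u)
    (hcub : 4 * a' ^ 3 - 3 * u * a' = 4 * a ^ 3 - 3 * u * a)
    (hsin : c' * (4 * a' ^ 2 - u) = c * (4 * a ^ 2 - u)) (hne : c * (4 * a ^ 2 - u) ≠ 0) :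
    (a' = a ∧ c' = c) ∨ (a' = -((a - 3 * c) / 2) ∧ c' = -((a + c) / 2)) ∨
      (a' = (-a - 3 * c) / 2 ∧ c' = (a - c) / 2) := by
  have hne' : 4 * a' ^ 2 - u ≠ 0 := right_ne_zero_of_mul (hsin ▸ hne)
  have hprod : (a' - a) * ((2 * a' + a - 3 * c) * (2 * a' + a + 3 * c)) = 0 := by
    linear_combination hcub - 3 * (a' - a) * h
  rcases mul_eq_zero.1 hprod with h1 | h1
  · have ha : a' = a := sub_eq_zero.1 h1
    subst ha
    exact .inl ⟨rfl, mul_right_cancel₀ hne' hsin⟩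
  rcases mul_eq_zero.1 h1 with h1 | h1
  · have ha : a' = -((a - 3 * c) / 2) := by
      field_simp
      linear_combination h1
    refine .inr (.inl ⟨ha, mul_right_cancel₀ hne' (hsin.trans ?_)⟩)
    rw [ha, ← h]
    field_simp
    ring
  · have ha : a' = (-a - 3 * c) / 2 := by
      field_simp
      linear_combination h1
    refine .inr (.inr ⟨ha, mul_right_cancel₀ hne' (hsin.trans ?_)⟩)
    rw [ha, ← h]
    field_simp
    ring

theorem mem_closure_of_val_eq_reflMat (h2 : (2 : F) ≠ 0) {u t t' a c a' c' w : F} (hw : w ≠ 0)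
    (h : a ^ 2 + 3 * c ^ 2 = u)
    (hcub : 4 * a' ^ 3 - 3 * u * a' = 4 * a ^ 3 - 3 * u * a)
    (hsin : c' * (4 * a' ^ 2 - u) = c * (4 * a ^ 2 - u)) (hne : c * (4 * a ^ 2 - u) ≠ 0)
    (ht : t' = t ∨ t' = -t) {U V U' : GL (Fin 2) F}
    (hU : (U : Matrix (Fin 2) (Fin 2) F) = reflMat t a c w)
    (hV : (V : Matrix (Fin 2) (Fin 2) F) = rotMat w)
    (hU' : (U' : Matrix (Fin 2) (Fin 2) F) = reflMat t' a' c' w) :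
    U' ∈ Subgroup.closure {U, V} := by
  have hUm : U ∈ Subgroup.closure {U, V} := Subgroup.subset_closure (by simp)
  have hVm : V ∈ Subgroup.closure {U, V} := Subgroup.subset_closure (by simp)
  have hneg : ∀ M ∈ Subgroup.closure {U, V}, -M ∈ Subgroup.closure {U, V} := by
    intro M hM
    have h3 : V ^ 3 = -1 := Units.ext (by simp [hV, rotMat_pow_three h2 hw])
    simpa [h3] using mul_mem hM (pow_mem hVm 3)
  have key : ∃ M ∈ Subgroup.closure {U, V},
      (M : Matrix (Fin 2) (Fin 2) F) = reflMat t a' c' w := by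
    rcases conic_eq_or_eq_or_eq h2 h hcub hsin hne with ⟨rfl, rfl⟩ | ⟨ha, hc⟩ | ⟨ha, hc⟩
    · exact ⟨U, hUm, hU⟩
    · refine ⟨-(U * V), hneg _ (mul_mem hUm hVm), ?_⟩
      rw [Units.val_neg, Units.val_mul, hU, hV, reflMat_mul_rotMat h2 hw, ha, hc,
        reflMat_neg_neg, neg_reflMat]
    · refine ⟨U * V * V, mul_mem (mul_mem hUm hVm) hVm, ?_⟩
      rw [Units.val_mul, Units.val_mul, hU, hV, reflMat_mul_rotMat h2 hw,
        reflMat_mul_rotMat h2 hw, ha, hc]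
      congr 1 <;> field_simp <;> ring
  obtain ⟨M, hM, hMval⟩ := key
  rcases ht with rfl | rfl
  · rwa [show U' = M from Units.ext (hU'.trans hMval.symm)]
  · rw [show U' = -M from Units.ext (by rw [hU', Units.val_neg, hMval, neg_reflMat])]
    exact hneg M hM

end Matrices

theorem map_eq_or_eq_neg_of_sq_eq_algebraMap {k K : Type*} [Field k] [Field K] [Algebra k K]
    (σ : K ≃ₐ[k] K) {x : K} {a : k} (h : x ^ 2 = algebraMap k K a) : σ x = x ∨ σ x = -x := by
  rw [← sq_eq_sq_iff_eq_or_eq_neg, ← map_pow, h, AlgEquiv.commutes]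

/-- The matrices `U` and `V` generate a dihedral group of order twelve that is stable under all
automorphisms over the base field. -/
theorem matrices_generate_stable_dihedralGroup {k K : Type*} [Field k] [Field K] [Algebra k K]
    (hchar2 : (2 : k) ≠ 0) (hchar3 : (3 : k) ≠ 0)
    (u v : k) (hu : u ≠ 0) (hv : v ≠ 0)
    (z s : k) (hs : s ≠ 0) (hid : u ^ 3 - z ^ 2 = 3 * s ^ 2 * v) (su sv α β : K)
    (hsu : su ^ 2 = algebraMap k K u) (hsv : sv ^ 2 = algebraMap k K v)
    (hα : α ^ 3 - 3 * algebraMap k K u / 4 * α - algebraMap k K z / 4 = 0)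
    (hβ : α ^ 2 + 3 * β ^ 2 / algebraMap k K v = algebraMap k K u) :
    IsUnit (su⁻¹ • !![α, β; 3 * β / algebraMap k K v, -α]) ∧
    IsUnit ((2 : K)⁻¹ • !![1, sv; -3 / sv, 1]) ∧
    ∃ U V : GL (Fin 2) K,
      (U : Matrix (Fin 2) (Fin 2) K) = su⁻¹ • !![α, β; 3 * β / algebraMap k K v, -α] ∧
      (V : Matrix (Fin 2) (Fin 2) K) = (2 : K)⁻¹ • !![1, sv; -3 / sv, 1] ∧
      Nonempty ((Subgroup.closure {U, V} : Subgroup (GL (Fin 2) K)) ≃* DihedralGroup 6) ∧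
      ∀ σ : K ≃ₐ[k] K, ∀ M ∈ Subgroup.closure {U, V},
        Matrix.GeneralLinearGroup.map (σ : K →+* K) M ∈ Subgroup.closure {U, V} := by
  set ι := algebraMap k K
  have h2 : (2 : K) ≠ 0 := by
    simpa only [map_ofNat] using (map_ne_zero ι).2 hchar2
  have h3 : (3 : K) ≠ 0 := by
    simpa only [map_ofNat] using (map_ne_zero ι).2 hchar3
  have hu' : ι u ≠ 0 := (map_ne_zero ι).2 hu
  have hv' : ι v ≠ 0 := (map_ne_zero ι).2 hv
  have hs' : ι s ≠ 0 := (map_ne_zero ι).2 hs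
  have hid' : ι u ^ 3 - ι z ^ 2 = 3 * ι s ^ 2 * ι v := by
    simpa only [map_sub, map_pow, map_mul, map_ofNat] using congrArg ι hid
  have hsu0 : su ≠ 0 := by
    rintro rfl
    exact hu' (by rw [← hsu]; ring)
  have hsv0 : sv ≠ 0 := by
    rintro rfl
    exact hv' (by rw [← hsv]; ring)
  have h4 : (4 : K) ≠ 0 := by
    rw [show (4 : K) = 2 * 2 by norm_num]
    exact mul_ne_zero h2 h2
  have hz : 4 * α ^ 3 - 3 * ι u * α = ι z := by
    field_simp at hα
    linear_combination hα
  have hconic : α ^ 2 + 3 * (β / sv) ^ 2 = ι u := by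
    rw [← hβ, ← hsv]
    ring
  have hnorm : su⁻¹ ^ 2 * (α ^ 2 + 3 * (β / sv) ^ 2) = 1 := by
    rw [hconic, ← hsu]
    field_simp
  have hsinsq : (β * (4 * α ^ 2 - ι u)) ^ 2 = ι (s * v) ^ 2 := by
    have hβ2 : 3 * β ^ 2 = (ι u - α ^ 2) * ι v := by
      rw [← hβ]
      field_simp
      ring
    apply mul_left_cancel₀ h3
    rw [map_mul]
    linear_combination (4 * α ^ 2 - ι u) ^ 2 * hβ2 + ι v * hid' -
      ι v * (4 * α ^ 3 - 3 * ι u * α + ι z) * hz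
  obtain ⟨d, hd⟩ : ∃ d : k, β * (4 * α ^ 2 - ι u) = ι d := by
    rcases sq_eq_sq_iff_eq_or_eq_neg.1 hsinsq with h | h
    · exact ⟨s * v, h⟩
    · exact ⟨-(s * v), by rw [h, map_neg]⟩
  have hne : β / sv * (4 * α ^ 2 - ι u) ≠ 0 := by
    have : β * (4 * α ^ 2 - ι u) ≠ 0 := by
      intro h
      rw [h, map_mul] at hsinsq
      exact pow_ne_zero 2 (mul_ne_zero hs' hv') (by rw [← hsinsq]; ring)
    rw [div_mul_eq_mul_div]
    exact div_ne_zero this hsv0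
  have hrefl : ∀ t a b : K, t • !![a, b; 3 * b / ι v, -a] = reflMat t a (b / sv) sv := by
    intro t a b
    rw [reflMat, ← hsv, div_mul_cancel₀ _ hsv0]
    congr 5
    field_simp
  have hUunit : IsUnit (reflMat su⁻¹ α (β / sv) sv) := by
    rw [Matrix.isUnit_iff_isUnit_det, det_reflMat hsv0 hnorm]
    exact isUnit_one.neg
  have hVunit : IsUnit (rotMat sv) := by
    rw [Matrix.isUnit_iff_isUnit_det, det_rotMat h2 hsv0]
    exact isUnit_one
  refine ⟨(hrefl _ _ _).symm ▸ hUunit, hVunit, ?_⟩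
  obtain ⟨U, hU⟩ := hUunit
  obtain ⟨V, hV⟩ := hVunit
  have hUU : U * U = 1 := Units.ext (by
    rw [Units.val_mul, hU, reflMat_mul_self hsv0 hnorm, Units.val_one])
  have hUV : U * V * (U * V) = 1 := Units.ext (by
    rw [Units.val_mul, Units.val_mul, hU, hV, reflMat_mul_rotMat h2 hsv0,
      reflMat_mul_self hsv0, Units.val_one]
    rw [← hnorm]
    field_simp
    ring)
  have hnot : U ∉ Subgroup.zpowers V := by
    rintro ⟨m, hm⟩
    have hdetV : Matrix.GeneralLinearGroup.det V = 1 := Units.ext (by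
      simp [hV, det_rotMat h2 hsv0])
    have hdet : Matrix.GeneralLinearGroup.det U = 1 := by
      rw [← hm, map_zpow, hdetV, _root_.one_zpow]
    have := congrArg Units.val hdet
    rw [Matrix.GeneralLinearGroup.val_det_apply, hU, det_reflMat hsv0 hnorm, Units.val_one] at this
    exact h2 (by linear_combination -this)
  have hequiv := nonempty_closure_mulEquiv_dihedralGroup hUU
    (orderOf_eq_six_of_val_eq_rotMat h2 hsv0 hV) hUV hnot
  refine ⟨U, V, hU.trans (hrefl _ _ _).symm, hV, hequiv, ?_⟩
  intro σ
  let φ := Matrix.GeneralLinearGroup.map (n := Fin 2) (σ : K →+* K)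
  have hgal : ∀ M : GL (Fin 2) K,
      (φ M : Matrix (Fin 2) (Fin 2) K) = (M : Matrix (Fin 2) (Fin 2) K).map σ :=
    fun _ => rfl
  suffices Subgroup.closure {U, V} ≤
      (Subgroup.closure {U, V}).comap φ from fun M hM => this hM
  rw [Subgroup.closure_le]
  have hσ : ∀ x : k, σ (ι x) = ι x := σ.commutes
  rintro M (rfl | rfl)
  · refine mem_closure_of_val_eq_reflMat h2 hsv0 hconic (t' := (σ su)⁻¹) (a' := σ α)
      (c' := σ β / sv) ?_ ?_ hne ?_ hU hV ?_
    · have := congrArg σ hz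
      simp only [map_sub, map_pow, map_mul, map_ofNat, hσ] at this
      rw [this, hz]
    · have := congrArg σ hd
      simp only [map_sub, map_pow, map_mul, map_ofNat, hσ] at this
      rw [div_mul_eq_mul_div, div_mul_eq_mul_div, this, hd]
    · rcases map_eq_or_eq_neg_of_sq_eq_algebraMap σ hsu with h | h
      · exact .inl (by rw [h])
      · exact .inr (by rw [h, inv_neg])
    · rw [← hrefl]
      change (φ M : Matrix (Fin 2) (Fin 2) K) = _
      rw [hgal, hU, ← hrefl]
      ext i j
      fin_cases i <;> fin_cases j <;> simp [hσ, map_ofNat]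
  · have hVm : M ∈ Subgroup.closure {U, M} := Subgroup.subset_closure (by simp)
    have hval : (φ M : Matrix (Fin 2) (Fin 2) K) = rotMat (σ sv) := by
      rw [hgal, hV]
      ext i j
      fin_cases i <;> fin_cases j <;> simp [rotMat, map_ofNat]
    change φ M ∈ Subgroup.closure {U, M}
    rcases map_eq_or_eq_neg_of_sq_eq_algebraMap σ hsv with h | h
    · rwa [show φ M = M from Units.ext (by rw [hval, h, hV])]
    · have : M * φ M = 1 := Units.ext (by
        rw [Units.val_mul, hval, h, hV, rotMat_mul_rotMat_neg h2 hsv0, Units.val_one])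
      rw [← inv_eq_of_mul_eq_one_right this]
      exact inv_mem hVm

/-- Proposition 4, converse half, of Cardona–Quer.
Let `u, v ∈ k*`, `z ∈ k`, `s ∈ k*` (char k ≠ 2, 3) satisfy `u³ − z² = 3s²v`; fix square
roots `√u, √v ∈ k̄`, a root `α` of `X³ − (3u/4)X − z/4`, and `β` with `α² + 3β²/v = u`.
Then the matrices `U = (1/√u)·[[α, β],[3β/v, −α]]` and `V = (1/2)·[[1, √v],[−3/√v, 1]]`
are invertible and generate a subgroup of `GL₂(k̄)` of order 12, isomorphic to `D12`,
stable under the entrywise Galois action. -/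
theorem matrices_generate_galoisStable_D12 {k : Type*} [Field k] [PerfectField k]
    (hchar2 : (2 : k) ≠ 0) (hchar3 : (3 : k) ≠ 0)
    (u v : k) (hu : u ≠ 0) (hv : v ≠ 0)
    (z s : k) (hs : s ≠ 0) (hid : u ^ 3 - z ^ 2 = 3 * s ^ 2 * v)
    (su sv α β : AlgebraicClosure k)
    (hsu : su ^ 2 = algebraMap k (AlgebraicClosure k) u)
    (hsv : sv ^ 2 = algebraMap k (AlgebraicClosure k) v)
    (hα : α ^ 3 - 3 * algebraMap k (AlgebraicClosure k) u / 4 * α -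
      algebraMap k (AlgebraicClosure k) z / 4 = 0)
    (hβ : α ^ 2 + 3 * β ^ 2 / algebraMap k (AlgebraicClosure k) v =
      algebraMap k (AlgebraicClosure k) u) :
    IsUnit (su⁻¹ • !![α, β; 3 * β / algebraMap k (AlgebraicClosure k) v, -α]) ∧
    IsUnit ((2 : AlgebraicClosure k)⁻¹ • !![1, sv; -3 / sv, 1]) ∧
    ∃ U V : GL (Fin 2) (AlgebraicClosure k),
      (U : Matrix (Fin 2) (Fin 2) (AlgebraicClosure k)) =
        su⁻¹ • !![α, β; 3 * β / algebraMap k (AlgebraicClosure k) v, -α] ∧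
      (V : Matrix (Fin 2) (Fin 2) (AlgebraicClosure k)) =
        (2 : AlgebraicClosure k)⁻¹ • !![1, sv; -3 / sv, 1] ∧
      Nat.card (Subgroup.closure {U, V} : Subgroup (GL (Fin 2) (AlgebraicClosure k))) = 12 ∧
      Nonempty ((Subgroup.closure {U, V} : Subgroup (GL (Fin 2) (AlgebraicClosure k))) ≃*
        DihedralGroup 6) ∧
      ∀ σ : Gk k, ∀ M ∈ Subgroup.closure {U, V}, galHom k σ M ∈ Subgroup.closure {U, V} := by
  obtain ⟨hU, hV, U, V, hUval, hVval, hequiv, hstable⟩ :=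
    matrices_generate_stable_dihedralGroup hchar2 hchar3 u v hu hv z s hs hid su sv α β
      hsu hsv hα hβ
  refine ⟨hU, hV, U, V, hUval, hVval, ?_, hequiv, hstable⟩
  rw [Nat.card_congr hequiv.some.toEquiv, DihedralGroup.nat_card]

end
end

section
/- Let ρ be a G_k-group structure on D12 with associated fields K₁ = k(√u) and K₂ = k(√v) (u, v ∈ k*). Then ρ is realizable in GL₂(k̄) if and only if ℍ[k,u,−3v] ≅ M₂(k) as k-algebras. -/
open Matrix IntermediateField DihedralGroup Quaternion

noncomputable section

/-- A pair of nonzero scalars `c₁, c₂` and anticommuting matrices squaring to them identify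
the quaternion algebra with the matrix algebra. -/
theorem quaternionAlgebra_equiv_matrix_iff {F : Type*} [Field F] (h2 : (2 : F) ≠ 0) {c₁ c₂ : F}
    (hc₁ : c₁ ≠ 0) (hc₂ : c₂ ≠ 0) :
    Nonempty (ℍ[F, c₁, c₂] ≃ₐ[F] Matrix (Fin 2) (Fin 2) F) ↔
      ∃ I J : Matrix (Fin 2) (Fin 2) F, I * I = c₁ • 1 ∧ J * J = c₂ • 1 ∧ J * I = -(I * J) := by
  constructor
  · rintro ⟨f⟩
    let B := QuaternionAlgebra.Basis.self F (c₁ := c₁) (c₂ := 0) (c₃ := c₂)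
    refine ⟨f B.i, f B.j, ?_, ?_, ?_⟩
    · rw [← map_mul, B.i_mul_i]; simp
    · rw [← map_mul, B.j_mul_j]; simp
    · rw [← map_mul, ← map_mul, B.j_mul_i, B.i_mul_j]; simp
  · rintro ⟨I, J, hI, hJ, hJI⟩
    let B : QuaternionAlgebra.Basis (Matrix (Fin 2) (Fin 2) F) c₁ 0 c₂ :=
      { i := I, j := J, k := I * J
        i_mul_i := by simp [hI]
        j_mul_j := hJ
        i_mul_j := rfl
        j_mul_i := by simp [hJI] }
    have hinj : Function.Injective B.liftHom := by
      rw [injective_iff_map_eq_zero]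
      intro x hx
      have hx0 : x.re • (1 : Matrix (Fin 2) (Fin 2) F) + x.imI • I + x.imJ • J
          + x.imK • (I * J) = 0 := by
        have : B.lift x = 0 := hx
        simpa [QuaternionAlgebra.Basis.lift, Algebra.algebraMap_eq_smul_one, B] using this
      have key : ∀ a b : F, a • (1 : Matrix (Fin 2) (Fin 2) F) + b • I = 0 → a = 0 ∧ b = 0 := by
        intro a b h
        have e1 : J * (a • 1 + b • I) + (a • 1 + b • I) * J = 0 := by simp [h]
        have e2 : (2 * a * c₂) • (1 : Matrix (Fin 2) (Fin 2) F) = 0 := by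
          have : J * (J * (a • 1 + b • I) + (a • 1 + b • I) * J) = (2 * a) • (J * J) := by
            simp only [mul_add, add_mul, mul_smul_comm, smul_mul_assoc, mul_one, one_mul, hJI]
            simp only [← mul_assoc, hJI, smul_neg, neg_mul, mul_neg]
            module
          rw [e1, hJ] at this
          simpa [smul_smul] using this.symm
        have ha : a = 0 := by simpa [h2, hc₂] using e2
        subst ha
        have e3 : (b • I) * I = 0 := by simpa using congrArg (· * I) h
        rw [smul_mul_assoc, hI, smul_smul] at e3
        exact ⟨rfl, by simpa [hc₁] using e3⟩
      have hIJI : I * J * I = -(c₁ • J) := by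
        rw [mul_assoc, hJI, mul_neg, ← mul_assoc, hI]; simp
      have hIIJ : I * (I * J) = c₁ • J := by rw [← mul_assoc, hI]; simp
      have e1 : I * (x.re • 1 + x.imI • I + x.imJ • J + x.imK • (I * J)) +
          (x.re • 1 + x.imI • I + x.imJ • J + x.imK • (I * J)) * I = 0 := by simp [hx0]
      have e2 : (2 * x.imI * c₁) • (1 : Matrix (Fin 2) (Fin 2) F) + (2 * x.re) • I = 0 := by
        rw [← e1]
        simp only [mul_add, add_mul, mul_smul_comm, smul_mul_assoc, mul_one, one_mul, hJI, hI,
          hIJI, hIIJ]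
        module
      obtain ⟨r1, r2⟩ := key _ _ e2
      have hre : x.re = 0 := by simpa [h2] using r2
      have him : x.imI = 0 := by simpa [h2, hc₁] using r1
      have e3 : (x.imJ * c₂) • (1 : Matrix (Fin 2) (Fin 2) F) + (x.imK * c₂) • I = 0 := by
        have := congrArg (· * J) hx0
        simpa [hre, him, add_mul, mul_assoc, hJ, smul_smul] using this
      obtain ⟨r3, r4⟩ := key _ _ e3
      ext
      · exact hre
      · exact him
      · simpa [hc₂] using r3
      · simpa [hc₂] using r4
    refine ⟨AlgEquiv.ofBijective B.liftHom ⟨hinj, ?_⟩⟩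
    have hfr : Module.finrank F ℍ[F, c₁, c₂] =
        Module.finrank F (Matrix (Fin 2) (Fin 2) F) := by
      rw [QuaternionAlgebra.finrank_eq_four, Module.finrank_matrix]; simp
    exact (LinearMap.injective_iff_surjective_of_finrank_eq_finrank
      (f := B.liftHom.toLinearMap) hfr).1 hinj

theorem mulAut_dihedralGroup_six (α : MulAut (DihedralGroup 6)) :
    ∃ e c : ZMod 6, (e = 1 ∨ e = -1) ∧ (∀ i, α (r i) = r (e * i)) ∧
      ∀ i, α (sr i) = sr (c + e * i) := by
  have hr : ∀ i : ZMod 6, α (r i) = α (r 1) ^ i.val := fun i => by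
    rw [← map_pow, r_pow]; simp
  have hsr : ∀ i : ZMod 6, α (sr i) = α (sr 0) * α (r i) := fun i => by
    rw [← map_mul, sr_mul_r, zero_add]
  have hne : ∀ {i : ZMod 6}, i ≠ 0 → α (r i) ≠ 1 := fun {i} hi h => by
    rw [map_eq_one_iff α α.injective, one_def] at h
    exact hi (r.inj h)
  have h2 := hne (i := 2) (by decide)
  have h3 := hne (i := 3) (by decide)
  have hcomm : α (sr 0) * α (r 1) ≠ α (r 1) * α (sr 0) := by
    rw [← map_mul, ← map_mul, α.injective.ne_iff]; decide
  rw [hr] at h2 h3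
  rcases h1 : α (r 1) with e | j
  · rcases h0 : α (sr 0) with j | c
    · rw [h1, h0, r_mul_r, r_mul_r, add_comm] at hcomm
      exact absurd rfl hcomm
    · refine ⟨e, c, ?_, fun i => ?_, fun i => ?_⟩
      · rw [h1] at h2 h3
        clear hcomm h1
        revert e
        decide
      · rw [hr, h1, r_pow]; simp
      · rw [hsr, hr, h1, h0, r_pow]; simp
  · exfalso
    apply h2
    rw [h1, show (2 : ZMod 6).val = 2 from rfl, sq, sr_mul_self]

/-- If a finite-level Galois structure moves `g₀` inside the finite group `G`, there are
enough equivariant functions `G → k̄` supported on the orbit of `g₀`. -/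
theorem exists_equivariant_functions {k : Type*} [Field k] {G : Type*} [Group G] [Fintype G]
    (ρ : Gk k →* MulAut G) (hρ : IsGkGroupStructure k ρ) (g₀ : G) :
    ∃ (L : IntermediateField k (AlgebraicClosure k)) (T : L →+ (G → AlgebraicClosure k)),
      (∀ x (σ : Gk k) g, σ (T x g) = T x (ρ σ g)) ∧
      (∀ x g, (∀ σ : Gk k, ρ σ g₀ ≠ g) → T x g = 0) ∧
      ∀ w : G → AlgebraicClosure k, (∀ g, w g ≠ 0) → ∃ x, ∑ g, w g * T x g ≠ 0 := by
  classical
  obtain ⟨L, _, -, hL⟩ := hρ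
  let lift : (L →ₐ[k] AlgebraicClosure k) → Gk k := fun γ =>
    AlgEquiv.ofBijective (γ.liftNormal (AlgebraicClosure k)) (AlgHom.normal_bijective k _ _ _)
  have hlift : ∀ γ (x : L), lift γ x = γ x := fun γ x =>
    γ.liftNormal_commutes (AlgebraicClosure k) x
  have hmul : ∀ (σ : Gk k) γ, ρ (lift (σ.toAlgHom.comp γ)) = ρ σ * ρ (lift γ) := by
    intro σ γ
    rw [← map_mul, ← inv_mul_eq_one, ← map_inv, ← map_mul]
    apply hL
    intro x hx
    have : (σ * lift γ) x = lift (σ.toAlgHom.comp γ) x := by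
      rw [hlift _ ⟨x, hx⟩, AlgEquiv.mul_apply, hlift γ ⟨x, hx⟩]; rfl
    rw [AlgEquiv.mul_apply, this, ← AlgEquiv.mul_apply, inv_mul_cancel, AlgEquiv.one_apply]
  let T : L →+ (G → AlgebraicClosure k) :=
    { toFun := fun x g => ∑ γ, if ρ (lift γ) g₀ = g then γ x else 0
      map_zero' := by ext; simp
      map_add' := fun x y => by
        ext g
        simp only [Pi.add_apply, ← Finset.sum_add_distrib]
        exact Finset.sum_congr rfl fun γ _ => by split_ifs <;> simp }
  have hT : ∀ x g, T x g = ∑ γ, if ρ (lift γ) g₀ = g then γ x else 0 := fun _ _ => rfl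
  refine ⟨L, T, fun x σ g => ?_, fun x g hg => ?_, fun w hw => ?_⟩
  · let E : (L →ₐ[k] AlgebraicClosure k) ≃ (L →ₐ[k] AlgebraicClosure k) :=
      { toFun := fun γ => σ.toAlgHom.comp γ
        invFun := fun γ => σ.symm.toAlgHom.comp γ
        left_inv := fun γ => by ext; simp
        right_inv := fun γ => by ext; simp }
    rw [hT, hT, map_sum, ← Equiv.sum_comp E fun γ => if ρ (lift γ) g₀ = ρ σ g then γ x else 0]
    refine Finset.sum_congr rfl fun γ _ => ?_
    have : ρ (lift (E γ)) g₀ = ρ σ g ↔ ρ (lift γ) g₀ = g := by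
      rw [show ρ (lift (E γ)) = ρ σ * ρ (lift γ) from hmul σ γ, MulAut.mul_apply,
        (ρ σ).injective.eq_iff]
    simp only [this, apply_ite σ, map_zero]
    rfl
  · rw [hT]
    exact Finset.sum_eq_zero fun γ _ => if_neg (hg _)
  · by_contra! h
    have hli := Fintype.linearIndependent_iff.1
      (linearIndependent_toLinearMap k L (AlgebraicClosure k))
      (fun γ => w (ρ (lift γ) g₀)) (by
        ext x
        rw [LinearMap.zero_apply, ← h x]
        simp only [hT, Finset.mul_sum, mul_ite, mul_zero]
        rw [Finset.sum_comm]
        simp) L.val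
    exact hw _ hli

theorem zmod_six_cases : ∀ c : ZMod 6, c = 0 ∨ c = 1 ∨ c = 2 ∨ c = 3 ∨ c = 4 ∨ c = 5 := by
  decide

theorem DihedralGroup.sum_univ {n : ℕ} [NeZero n] {M : Type*} [AddCommMonoid M]
    (f : DihedralGroup n → M) : ∑ g, f g = ∑ i, f (r i) + ∑ i, f (sr i) := by
  rw [← Equiv.sum_comp DihedralGroup.equivSum.symm, Fintype.sum_sum_type]
  rfl

/-- The norm-one equivariant function on reflections of the dihedral group, modulo the centre. -/
theorem exists_equivariant_norm_one {k : Type*} [Field k]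
    (ρ : Gk k →* MulAut (DihedralGroup 6)) (hρ : IsGkGroupStructure k ρ) :
    ∃ s : ZMod 6 → AlgebraicClosure k, (∀ i, s (i + 3) = s i) ∧
      (∀ (σ : Gk k) i j, ρ σ (sr i) = sr j → σ (s i) = s j) ∧
      s 0 ^ 2 + s 1 ^ 2 + s 2 ^ 2 - s 0 * s 1 - s 1 * s 2 - s 0 * s 2 = 1 := by
  obtain ⟨z, hz⟩ : ∃ z : AlgebraicClosure k, z ^ 2 + z + 1 = 0 := by
    have hdeg : (Polynomial.X ^ 2 + Polynomial.X + 1 :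
        Polynomial (AlgebraicClosure k)).degree = 2 := by
      compute_degree!
    obtain ⟨z, hz⟩ := IsAlgClosed.exists_root
      (Polynomial.X ^ 2 + Polynomial.X + 1 : Polynomial (AlgebraicClosure k))
      (by rw [hdeg]; decide)
    exact ⟨z, by simpa using hz⟩
  obtain ⟨L, T, hT, hT0, hTw⟩ := exists_equivariant_functions ρ hρ (sr 0)
  have hr : ∀ x i, T x (r i) = 0 := fun x i => hT0 x _ fun σ => by
    obtain ⟨e, c, -, -, h⟩ := mulAut_dihedralGroup_six (ρ σ)
    rw [h]; simp
  let t : L → ZMod 6 → AlgebraicClosure k := fun x i => T x (sr i) + T x (sr (i + 3))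
  have htadd : ∀ x y i, t (x + y) i = t x i + t y i := fun x y i => by
    simp only [t, map_add, Pi.add_apply]; ring
  have ht3 : ∀ x i, t x (i + 3) = t x i := fun x i => by
    simp only [t, add_assoc i, show (3 + 3 : ZMod 6) = 0 from rfl, add_zero]
    exact add_comm _ _
  have htσ : ∀ x (σ : Gk k) i j, ρ σ (sr i) = sr j → σ (t x i) = t x j := by
    intro x σ i j h
    obtain ⟨e, c, he, -, hs⟩ := mulAut_dihedralGroup_six (ρ σ)
    have h3 : e * 3 = 3 := by rcases he with rfl | rfl <;> rfl
    rw [hs] at h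
    obtain rfl := sr.inj h
    simp only [t, map_add, hT, hs, mul_add, h3, add_assoc]
  have hlin : ∀ y : AlgebraicClosure k, y ^ 2 + y + 1 = 0 →
      ∃ x, t x 0 + y * t x 1 + y ^ 2 * t x 2 ≠ 0 := by
    intro y hy
    have hy0 : y ≠ 0 := by rintro rfl; simp at hy
    have hy3 : y ^ 3 = 1 := by linear_combination (y - 1) * hy
    let w : DihedralGroup 6 → AlgebraicClosure k
      | r _ => 1
      | sr i => y ^ i.val
    obtain ⟨x, hx⟩ := hTw w (by rintro (i | i) <;> simp [w, hy0])
    refine ⟨x, ?_⟩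
    convert hx using 1
    have hs : ∑ i : ZMod 6, w (sr i) * T x (sr i) =
        y ^ 0 * T x (sr 0) + y ^ 1 * T x (sr 1) + y ^ 2 * T x (sr 2) + y ^ 3 * T x (sr 3) +
          y ^ 4 * T x (sr 4) + y ^ 5 * T x (sr 5) :=
      Fin.sum_univ_six fun i : ZMod 6 => w (sr i) * T x (sr i)
    rw [DihedralGroup.sum_univ, hs]
    simp only [hr, mul_zero, Finset.sum_const_zero, t, zero_add,
      show (1 + 3 : ZMod 6) = 4 from rfl, show (2 + 3 : ZMod 6) = 5 from rfl]
    linear_combination -(T x (sr 3) + y * T x (sr 4) + y ^ 2 * T x (sr 5)) * hy3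
  obtain ⟨x₁, hx₁⟩ := hlin z hz
  obtain ⟨x₂, hx₂⟩ := hlin (z ^ 2) (by linear_combination (z ^ 2 - z + 1) * hz)
  obtain ⟨x, hxz, hxz2⟩ : ∃ x, t x 0 + z * t x 1 + z ^ 2 * t x 2 ≠ 0 ∧
      t x 0 + z ^ 2 * t x 1 + (z ^ 2) ^ 2 * t x 2 ≠ 0 := by
    by_cases h₁ : t x₁ 0 + z ^ 2 * t x₁ 1 + (z ^ 2) ^ 2 * t x₁ 2 = 0
    · by_cases h₂ : t x₂ 0 + z * t x₂ 1 + z ^ 2 * t x₂ 2 = 0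
      · refine ⟨x₁ + x₂, fun h => hx₁ ?_, fun h => hx₂ ?_⟩ <;>
          simp only [htadd] at h
        · linear_combination h - h₂
        · linear_combination h - h₁
      · exact ⟨x₂, h₂, hx₂⟩
    · exact ⟨x₁, hx₁, h₁⟩
  obtain ⟨m, hm⟩ : ∃ m, m = t x 0 ^ 2 + t x 1 ^ 2 + t x 2 ^ 2 - t x 0 * t x 1 - t x 1 * t x 2
    - t x 0 * t x 2 := ⟨_, rfl⟩
  have hm0 : m ≠ 0 := by
    convert mul_ne_zero hxz hxz2 using 1
    rw [hm]
    have hz3 : z ^ 3 = 1 := by linear_combination (z - 1) * hz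
    linear_combination (-t x 0 * t x 1 - t x 1 * t x 2 - t x 0 * t x 2) * hz
      - (t x 1 ^ 2 + t x 1 * t x 2 * z ^ 2 + t x 0 * t x 2 * z +
        t x 1 * t x 2 * z + t x 2 ^ 2 * (z ^ 3 + 1)) * hz3
  have h3 : t x 3 = t x 0 := ht3 x 0
  have h4 : t x 4 = t x 1 := ht3 x 1
  have h5 : t x 5 = t x 2 := ht3 x 2
  have hσm : ∀ σ : Gk k, σ m = m := by
    intro σ
    obtain ⟨e, c, he, -, hs⟩ := mulAut_dihedralGroup_six (ρ σ)
    have ht : ∀ i, σ (t x i) = t x (c + e * i) := fun i => htσ x σ _ _ (hs i)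
    rw [hm]
    simp only [map_sub, map_add, map_mul, map_pow, ht]
    clear_value t
    clear * - he h3 h4 h5
    rcases he with rfl | rfl <;> rcases zmod_six_cases c with rfl | rfl | rfl | rfl | rfl | rfl <;>
      reduce_mod_char <;> (try simp only [h3, h4, h5]) <;> ring
  refine ⟨fun i => (t x i ^ 2 + 2 * t x (i + 2) * t x (i + 4)) / m, fun i => ?_,
    fun σ i j hij => ?_, ?_⟩
  · simp only [add_right_comm i 3, ht3]
  · obtain ⟨e, c, he, -, hs⟩ := mulAut_dihedralGroup_six (ρ σ)
    have ht : ∀ i, σ (t x i) = t x (c + e * i) := fun i => htσ x σ _ _ (hs i)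
    rw [hs] at hij
    obtain rfl := sr.inj hij
    simp only [map_div₀, map_add, map_mul, map_pow, map_ofNat, hσm, ht, mul_add]
    rcases he with rfl | rfl
    · simp only [one_mul, add_assoc]
    · simp only [show (-1 * 2 : ZMod 6) = 4 from rfl, show (-1 * 4 : ZMod 6) = 2 from rfl,
        add_assoc]
      ring
  · simp only [zero_add, show (1 + 2 : ZMod 6) = 3 from rfl, show (1 + 4 : ZMod 6) = 5 from rfl,
      show (2 + 2 : ZMod 6) = 4 from rfl, show (2 + 4 : ZMod 6) = 0 from rfl, h3, h4, h5]
    field_simp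
    rw [hm]
    ring

/-- A square matrix of size two commuting with two noncommuting matrices is scalar. -/
theorem Matrix.eq_smul_one_of_commute {F : Type*} [Field F] {X P Q : Matrix (Fin 2) (Fin 2) F}
    (hP : X * P = P * X) (hQ : X * Q = Q * X) (hPQ : P * Q ≠ Q * P) : X = X 0 0 • 1 := by
  have e : ∀ {A B : Matrix (Fin 2) (Fin 2) F}, A * B = B * A ↔
      A 0 1 * B 1 0 = B 0 1 * A 1 0 ∧ A 0 1 * (B 1 1 - B 0 0) = B 0 1 * (A 1 1 - A 0 0) ∧
      A 1 0 * (B 1 1 - B 0 0) = B 1 0 * (A 1 1 - A 0 0) := by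
    intro A B
    rw [← Matrix.ext_iff]
    simp only [Fin.forall_fin_two, Matrix.mul_apply, Fin.sum_univ_two]
    constructor
    · rintro ⟨⟨h1, h2⟩, h3, h4⟩
      refine ⟨?_, ?_, ?_⟩
      · linear_combination h1
      · linear_combination h2
      · linear_combination -h3
    · rintro ⟨h1, h2, h3⟩
      refine ⟨⟨?_, ?_⟩, ?_, ?_⟩
      · linear_combination h1
      · linear_combination h2
      · linear_combination -h3
      · linear_combination -h1
  rw [e] at hP hQ
  rw [Ne, e] at hPQ
  obtain ⟨p1, p2, p3⟩ := hP
  obtain ⟨q1, q2, q3⟩ := hQ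
  have hX : X 0 1 = 0 ∧ X 1 0 = 0 ∧ X 1 1 - X 0 0 = 0 := by
    by_contra hne
    apply hPQ
    generalize X 1 1 - X 0 0 = x at *
    generalize P 1 1 - P 0 0 = p at *
    generalize Q 1 1 - Q 0 0 = q at *
    by_cases h1 : X 0 1 = 0
    · by_cases h2 : X 1 0 = 0
      · have h3 : x ≠ 0 := fun h => hne ⟨h1, h2, h⟩
        refine ⟨mul_left_cancel₀ h3 ?_, mul_left_cancel₀ h3 ?_, mul_left_cancel₀ h3 ?_⟩ <;> grind
      · refine ⟨mul_left_cancel₀ h2 ?_, mul_left_cancel₀ h2 ?_, mul_left_cancel₀ h2 ?_⟩ <;> grind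
    · refine ⟨mul_left_cancel₀ h1 ?_, mul_left_cancel₀ h1 ?_, mul_left_cancel₀ h1 ?_⟩ <;> grind
  obtain ⟨h1, h2, h3⟩ := hX
  ext i j
  fin_cases i <;> fin_cases j <;> simp [h1, h2, sub_eq_zero.1 h3]

/-- In a faithful two-dimensional representation of the dihedral group of order twelve, the
generating rotation has minimal polynomial `X ^ 2 - X + 1`. -/
theorem sq_eq_sub_one_of_injective {F : Type*} [Field F]
    (M : DihedralGroup 6 →* Matrix (Fin 2) (Fin 2) F) (hM : Function.Injective M) :
    M (r 1) * M (r 1) = M (r 1) - 1 := by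
  obtain ⟨P, hP⟩ : ∃ P, P = M (r 1) := ⟨_, rfl⟩
  obtain ⟨Q, hQ⟩ : ∃ Q, Q = M (sr 0) := ⟨_, rfl⟩
  have hPQ : P * Q ≠ Q * P := by
    rw [hP, hQ, ← map_mul, ← map_mul, hM.ne_iff]; decide
  obtain ⟨Z, hZ⟩ : ∃ Z, Z = M (r 3) := ⟨_, rfl⟩
  have hZs : Z = Z 0 0 • 1 := by
    refine Matrix.eq_smul_one_of_commute (P := P) (Q := Q) ?_ ?_ hPQ
    · rw [hP, hZ, ← map_mul, ← map_mul]; rfl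
    · rw [hQ, hZ, ← map_mul, ← map_mul]; rfl
  have hZ1 : Z ≠ 1 := by
    rw [hZ, ← map_one M, hM.ne_iff]; decide
  have hZZ : Z * Z = 1 := by
    rw [hZ, ← map_mul, ← map_one M]; rfl
  have hZneg : Z = -1 := by
    rw [hZs] at hZ1 hZZ ⊢
    have h00 : Z 0 0 * Z 0 0 = 1 := by
      have := congrArg (fun A : Matrix (Fin 2) (Fin 2) F => A 0 0) hZZ
      simpa using this
    rcases mul_self_eq_one_iff.1 h00 with h | h
    · exact absurd (by rw [h, one_smul]) hZ1
    · rw [h, neg_smul, one_smul]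
  have hPPP : P * P * P = -1 := by
    rw [← hZneg, hP, hZ, ← map_mul, ← map_mul]; rfl
  have hQP : Q * P = -(P * P * Q) := by
    have h : Z * (P * P * Q) = Q * P := by
      rw [hP, hQ, hZ, ← map_mul, ← map_mul, ← map_mul, ← map_mul]; rfl
    rw [← h, hZneg, neg_one_mul]
  obtain ⟨S, hS⟩ : ∃ S, S = P * P - P + 1 := ⟨_, rfl⟩
  have hSs : S = S 0 0 • 1 := by
    refine Matrix.eq_smul_one_of_commute (P := P) (Q := Q) ?_ ?_ hPQ
    · rw [hS]; noncomm_ring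
    · have hQPP : Q * (P * P) = -(P * Q) := by
        rw [← mul_assoc, hQP, neg_mul, mul_assoc (P * P), hQP]
        calc -(P * P * -(P * P * Q)) = P * P * P * P * Q := by noncomm_ring
          _ = -(P * Q) := by rw [hPPP]; noncomm_ring
      rw [hS, mul_add, mul_sub, hQPP, hQP]
      noncomm_ring
  have hPS : (P + 1) * S = 0 := by
    calc (P + 1) * S = P * P * P + 1 := by rw [hS]; noncomm_ring
      _ = 0 := by rw [hPPP]; simp
  have hS0 : S 0 0 = 0 := by
    by_contra h0
    rw [hSs, mul_smul_comm, mul_one] at hPS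
    have : P = -1 := eq_neg_of_add_eq_zero_left ((smul_eq_zero.1 hPS).resolve_left h0)
    exact hPQ (by rw [this]; simp)
  rw [hS0, zero_smul, hS] at hSs
  rw [← hP, ← sub_eq_zero, ← hSs]
  abel

theorem DihedralGroup.exists_monoidHom {n : ℕ} {H : Type*} [Group H] (p q : H) (hp : p ^ n = 1)
    (hq : q * q = 1) (hpq : p * q = q * p⁻¹) :
    ∃ f : DihedralGroup n →* H, f (r 1) = p ∧ f (sr 0) = q := by
  let F : ZMod n →+ Additive H :=
    ZMod.lift n ⟨zmultiplesHom (Additive H) (Additive.ofMul p), by simp [← ofMul_pow, hp]⟩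
  let E : ZMod n → H := fun i => (F i).toMul
  have hE : ∀ i : ℤ, E i = p ^ i := fun i => by simp [E, F]
  have hadd : ∀ i j, E (i + j) = E i * E j := fun i j => by simp [E]
  have hEq : ∀ i, E i * q = q * E (-i) := fun i => by
    obtain ⟨i, rfl⟩ := ZMod.intCast_surjective i
    rw [← Int.cast_neg, hE, hE, _root_.zpow_neg, ← _root_.inv_zpow]
    have h : SemiconjBy q p⁻¹ p := hpq.symm
    exact (h.zpow_right i).eq.symm
  refine ⟨MonoidHom.mk' (fun | r i => E i | sr i => q * E i) ?_, ?_, ?_⟩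
  · rintro (i | i) (j | j)
    · exact hadd i j
    · rw [r_mul_sr, sub_eq_neg_add]
      simp only [hadd, ← mul_assoc, hEq]
    · simp only [sr_mul_r, hadd, mul_assoc]
    · rw [sr_mul_sr, sub_eq_neg_add]
      simp only [hadd]
      rw [mul_assoc q, ← mul_assoc (E i), hEq, ← mul_assoc, ← mul_assoc, hq, one_mul]
  · simpa using hE 1
  · simpa using hE 0

theorem exists_injective_monoidHom_matrix {F : Type*} [Field F] (h2 : (2 : F) ≠ 0)
    (h3 : (3 : F) ≠ 0) {P Q : Matrix (Fin 2) (Fin 2) F} (hP : P * P = P - 1) (hQ : Q * Q = 1)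
    (hPQ : P * Q = Q * (1 - P)) :
    ∃ M : DihedralGroup 6 →* GL (Fin 2) F, Function.Injective M ∧
      (M (r 1) : Matrix (Fin 2) (Fin 2) F) = P ∧ (M (sr 0) : Matrix (Fin 2) (Fin 2) F) = Q := by
  have hP1 : P * (1 - P) = 1 := by rw [mul_sub, hP]; simp
  have hP2 : (1 - P) * P = 1 := by rw [sub_mul, hP]; simp
  have hP3 : P ^ 3 = -1 := by
    rw [pow_succ, pow_two, hP, sub_mul, hP]; simp
  let p : GL (Fin 2) F := ⟨P, 1 - P, hP1, hP2⟩
  let q : GL (Fin 2) F := ⟨Q, Q, hQ, hQ⟩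
  obtain ⟨M, hMr, hMs⟩ := DihedralGroup.exists_monoidHom (n := 6) p q
    (Units.ext (by
      rw [Units.val_pow_eq_pow_val, Units.val_one, show P ^ 6 = (P ^ 3) ^ 2 from pow_mul P 3 2, hP3]
      simp))
    (Units.ext hQ) (Units.ext hPQ)
  refine ⟨M, ?_, congrArg Units.val hMr, congrArg Units.val hMs⟩
  have hr2 : M (r 2) ≠ 1 := by
    intro h
    have h' : P * P = 1 := by
      have := congrArg Units.val (map_mul M (r 1) (r 1))
      rw [r_mul_r, show (1 + 1 : ZMod 6) = 2 from rfl, h, hMr] at this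
      exact this.symm
    have hP' : P = (2 : F) • 1 := by
      rw [two_smul, ← sub_eq_iff_eq_add, ← hP, h']
    rw [hP'] at h'
    have h4 := congrArg (fun A : Matrix (Fin 2) (Fin 2) F => A 0 0) h'
    simp only [smul_mul_smul_comm, Matrix.smul_apply, Matrix.one_apply_eq, smul_eq_mul,
      mul_one] at h4
    exact h3 (by linear_combination h4)
  have hr3 : M (r 3) ≠ 1 := by
    intro h
    have h' : P ^ 3 = 1 := by
      have := congrArg Units.val (map_pow M (r 1) 3)
      rw [r_one_pow, show ((3 : ℕ) : ZMod 6) = 3 from rfl, h, hMr] at this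
      exact this.symm
    rw [hP3] at h'
    have h4 := congrArg (fun A : Matrix (Fin 2) (Fin 2) F => A 0 0) h'
    simp only [Matrix.neg_apply, Matrix.one_apply_eq] at h4
    exact h2 (by linear_combination -h4)
  rw [injective_iff_map_eq_one]
  have key : ∀ g : DihedralGroup 6, g ≠ 1 →
      g ^ 2 = r 2 ∨ g ^ 4 = r 2 ∨ g = r 3 ∨ r 1 * g * (r 1)⁻¹ * g = r 2 := by
    decide
  intro g hg
  by_contra hne
  rcases key g hne with h | h | h | h
  · exact hr2 (by rw [← h, map_pow, hg, one_pow])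
  · exact hr2 (by rw [← h, map_pow, hg, one_pow])
  · exact hr3 (by rw [← h, hg])
  · exact hr2 (by rw [← h]; simp only [map_mul, map_inv, hg, mul_one, mul_inv_cancel])

/-- The values of a representation of the dihedral group of order twelve whose generating
rotation has minimal polynomial `X ^ 2 - X + 1`. -/
theorem monoidHom_dihedralGroup_six_values {R : Type*} [Ring R] (M : DihedralGroup 6 →* R)
    (hM : M (r 1) * M (r 1) = M (r 1) - 1) :
    M (r (-1)) = 1 - M (r 1) ∧ M (sr 2) = M (sr 1) - M (sr 0) ∧ M (sr 3) = -M (sr 0) ∧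
      M (sr 4) = -M (sr 1) ∧ M (sr 5) = M (sr 0) - M (sr 1) := by
  have h2 : M (r 2) = M (r 1) - 1 := by
    rw [← hM, ← map_mul]; rfl
  have h3 : M (r 3) = -1 := by
    rw [show (r 3 : DihedralGroup 6) = r 2 * r 1 from rfl, map_mul, h2, sub_mul, hM]
    simp
  have hs2 : M (sr 2) = M (sr 1) - M (sr 0) := by
    rw [show (sr 2 : DihedralGroup 6) = sr 0 * r 2 from rfl, map_mul, h2, mul_sub, mul_one,
      ← map_mul]
    rfl
  refine ⟨?_, hs2, ?_, ?_, ?_⟩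
  · rw [show (r (-1) : DihedralGroup 6) = r 2 * r 3 from rfl, map_mul, h2, h3]
    simp
  · rw [show (sr 3 : DihedralGroup 6) = sr 0 * r 3 from rfl, map_mul, h3]; simp
  · rw [show (sr 4 : DihedralGroup 6) = sr 1 * r 3 from rfl, map_mul, h3]; simp
  · rw [show (sr 5 : DihedralGroup 6) = sr 2 * r 3 from rfl, map_mul, h3, hs2]; simp

theorem map_sqrt_eq_or {k : Type*} [Field k] {a : k} {s : AlgebraicClosure k}
    (hs : s ^ 2 = algebraMap k (AlgebraicClosure k) a) (σ : Gk k) : σ s = s ∨ σ s = -s := by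
  rw [← sq_eq_sq_iff_eq_or_eq_neg, ← map_pow, hs, AlgEquiv.commutes]

/-- The twelve possible actions of a Galois element on the dihedral group, matched with its
action on the square roots generating the fields `K₁` and `K₂`. -/
theorem galois_action_cases {k : Type*} [Field k] {ρ : Gk k →* MulAut (DihedralGroup 6)}
    {u v : k} {su sv : AlgebraicClosure k}
    (hsu : su ^ 2 = algebraMap k (AlgebraicClosure k) u)
    (hsv : sv ^ 2 = algebraMap k (AlgebraicClosure k) v)
    (hK1 : ∀ σ : Gk k,
      (∀ g : DihedralGroup 6, ρ σ g * g⁻¹ ∈ ({1, r 2, r 4} : Set (DihedralGroup 6))) ↔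
        σ su = su)
    (hK2 : ∀ σ : Gk k, ρ σ (r 1) = r 1 ↔ σ sv = sv) (σ : Gk k) :
    ∃ e c : ZMod 6, (e = 1 ∧ σ sv = sv ∨ e = -1 ∧ σ sv = -sv) ∧
      ((c = 0 ∨ c = 2 ∨ c = 4) ∧ σ su = su ∨ (c = 1 ∨ c = 3 ∨ c = 5) ∧ σ su = -su) ∧
      (∀ i, ρ σ (r i) = r (e * i)) ∧ ∀ i, ρ σ (sr i) = sr (c + e * i) := by
  obtain ⟨e, c, he, hr, hs⟩ := mulAut_dihedralGroup_six (ρ σ)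
  refine ⟨e, c, ?_, ?_, hr, hs⟩
  · have h := hK2 σ
    rw [hr, mul_one] at h
    rcases he with rfl | rfl
    · exact Or.inl ⟨rfl, h.1 rfl⟩
    · exact Or.inr ⟨rfl, (map_sqrt_eq_or hsv σ).resolve_left fun h' => absurd (h.2 h') (by decide)⟩
  · have h : (c = 0 ∨ c = 2 ∨ c = 4) ↔ σ su = su := by
      rw [← hK1]
      constructor
      · rintro hc (i | i)
        · rw [hr]
          clear hr hs
          simp only [Set.mem_insert_iff, Set.mem_singleton_iff]
          revert e i
          decide
        · rw [hs]
          clear hr hs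
          simp only [Set.mem_insert_iff, Set.mem_singleton_iff]
          revert e i c
          decide
      · intro h
        have h0 := h (sr 0)
        rw [hs, mul_zero, add_zero] at h0
        simp only [Set.mem_insert_iff, Set.mem_singleton_iff] at h0
        clear hr hs h
        revert c
        decide
    by_cases hc : c = 0 ∨ c = 2 ∨ c = 4
    · exact Or.inl ⟨hc, h.1 hc⟩
    · refine Or.inr ⟨?_, (map_sqrt_eq_or hsu σ).resolve_left (mt h.2 hc)⟩
      clear h hr hs
      revert c
      decide

theorem Matrix.exists_map_algebraMap_eq {k : Type*} [Field k] [PerfectField k] {n : Type*}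
    [Fintype n] [DecidableEq n] (X : Matrix n n (AlgebraicClosure k))
    (hX : ∀ σ : Gk k, σ.mapMatrix X = X) :
    ∃ Y : Matrix n n k, (Algebra.ofId k (AlgebraicClosure k)).mapMatrix Y = X := by
  have h : ∀ i j, ∃ y, algebraMap k (AlgebraicClosure k) y = X i j := fun i j =>
    (InfiniteGalois.mem_bot_iff_fixed (X i j)).2 fun σ =>
      congrArg (fun A : Matrix n n (AlgebraicClosure k) => A i j) (hX σ)
  choose Y hY using h
  exact ⟨Y, Matrix.ext hY⟩

theorem AlgEquiv.mapMatrix_smul_semilinear {k K n : Type*} [Field k] [Field K] [Algebra k K]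
    [Fintype n] [DecidableEq n] (σ : K ≃ₐ[k] K) (a : K) (X : Matrix n n K) :
    σ.mapMatrix (a • X) = σ a • σ.mapMatrix X := by
  ext i j
  simp

theorem isRealizable_iff_exists_monoidHom {k : Type*} [Field k] {G : Type*} [Group G]
    (ρ : Gk k →* MulAut G) :
    IsRealizable k ρ ↔ ∃ M : G →* GL (Fin 2) (AlgebraicClosure k), Function.Injective M ∧
      ∀ (σ : Gk k) g, (M (ρ σ g) : Matrix (Fin 2) (Fin 2) (AlgebraicClosure k)) =
        σ.mapMatrix (M g : Matrix (Fin 2) (Fin 2) (AlgebraicClosure k)) := by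
  constructor
  · rintro ⟨A, -, φ, h⟩
    exact ⟨A.subtype.comp φ.toMonoidHom, A.subtype_injective.comp φ.injective,
      fun σ g => congrArg Units.val (h σ g)⟩
  · rintro ⟨M, hM, h⟩
    refine ⟨M.range, ?_, MonoidHom.ofInjective hM, fun σ g => Units.ext (h σ g)⟩
    rintro σ _ ⟨g, rfl⟩
    exact ⟨ρ σ g, Units.ext (h σ g)⟩

theorem exists_anticommuting_of_isRealizable {k : Type*} [Field k] [PerfectField k]
    (ρ : Gk k →* MulAut (DihedralGroup 6)) (hρ : IsGkGroupStructure k ρ)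
    {u v : k} {su sv : AlgebraicClosure k}
    (hsu : su ^ 2 = algebraMap k (AlgebraicClosure k) u)
    (hsv : sv ^ 2 = algebraMap k (AlgebraicClosure k) v)
    (hcases : ∀ σ : Gk k, ∃ e c : ZMod 6, (e = 1 ∧ σ sv = sv ∨ e = -1 ∧ σ sv = -sv) ∧
      ((c = 0 ∨ c = 2 ∨ c = 4) ∧ σ su = su ∨ (c = 1 ∨ c = 3 ∨ c = 5) ∧ σ su = -su) ∧
      (∀ i, ρ σ (r i) = r (e * i)) ∧ ∀ i, ρ σ (sr i) = sr (c + e * i))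
    (h : IsRealizable k ρ) :
    ∃ I J : Matrix (Fin 2) (Fin 2) k, I * I = u • 1 ∧ J * J = (-3 * v) • 1 ∧
      J * I = -(I * J) := by
  obtain ⟨s, hs3, hsσ, hs1⟩ := exists_equivariant_norm_one ρ hρ
  obtain ⟨M', hM'inj, hM'σ⟩ := (isRealizable_iff_exists_monoidHom ρ).1 h
  obtain ⟨M, hM⟩ : ∃ M, M = (Units.coeHom _).comp M' := ⟨_, rfl⟩
  have hMinj : Function.Injective M := by
    rw [hM]; exact Units.val_injective.comp hM'inj
  have hMσ : ∀ (σ : Gk k) g, σ.mapMatrix (M g) = M (ρ σ g) := by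
    intro σ g
    rw [hM]; exact (hM'σ σ g).symm
  have hP := sq_eq_sub_one_of_injective M hMinj
  obtain ⟨hr5, hv2, hv3, hv4, hv5⟩ := monoidHom_dihedralGroup_six_values M hP
  have hQQ : M (sr 0) * M (sr 0) = 1 := by rw [← map_mul, sr_mul_self, map_one]
  have hQ1 : M (sr 0) * M (sr 1) = M (r 1) := by rw [← map_mul]; rfl
  have h1Q : M (sr 1) * M (sr 0) = 1 - M (r 1) := by rw [← hr5, ← map_mul]; rfl
  have h11 : M (sr 1) * M (sr 1) = 1 := by rw [← map_mul, sr_mul_self, map_one]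
  have hPQ : M (r 1) * M (sr 0) = M (sr 0) - M (sr 1) := by rw [← hv5, ← map_mul]; rfl
  have hP1 : M (r 1) * M (sr 1) = M (sr 0) := by rw [← map_mul]; rfl
  have hQP : M (sr 0) * M (r 1) = M (sr 1) := by rw [← map_mul]; rfl
  have h1P : M (sr 1) * M (r 1) = M (sr 1) - M (sr 0) := by rw [← hv2, ← map_mul]; rfl
  obtain ⟨I', hI'⟩ : ∃ I', I' = su • ((s 0 - s 2) • M (sr 0) + (s 2 - s 1) • M (sr 1)) := ⟨_, rfl⟩
  obtain ⟨J', hJ'⟩ : ∃ J', J' = sv • ((2 : AlgebraicClosure k) • M (r 1) - 1) := ⟨_, rfl⟩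
  have h3 : s 3 = s 0 := hs3 0
  have h4 : s 4 = s 1 := hs3 1
  have h5 : s 5 = s 2 := hs3 2
  obtain ⟨I, hI⟩ := Matrix.exists_map_algebraMap_eq I' (by
    intro σ
    obtain ⟨e, c, he, hc, hr, hsr⟩ := hcases σ
    have hsσ' : ∀ i, σ (s i) = s (c + e * i) := fun i => hsσ σ _ _ (hsr i)
    simp only [hI', AlgEquiv.mapMatrix_smul_semilinear, map_add, map_sub, hMσ, hsr, hsσ']
    clear * - he hc hv2 hv3 hv4 hv5 h3 h4 h5
    rcases he with ⟨rfl, -⟩ | ⟨rfl, -⟩ <;>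
      rcases hc with ⟨rfl | rfl | rfl, hc⟩ | ⟨rfl | rfl | rfl, hc⟩ <;>
      rw [hc] <;> reduce_mod_char <;> (try simp only [hv2, hv3, hv4, hv5, h3, h4, h5]) <;> module)
  obtain ⟨J, hJ⟩ := Matrix.exists_map_algebraMap_eq J' (by
    intro σ
    obtain ⟨e, c, he, -, hr, -⟩ := hcases σ
    simp only [hJ', AlgEquiv.mapMatrix_smul_semilinear, map_sub, hMσ, hr, map_one, mul_one,
      map_ofNat]
    rcases he with ⟨rfl, he⟩ | ⟨rfl, he⟩
    · rw [he]
    · rw [he, hr5]; module)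
  have hinj : Function.Injective
      ((Algebra.ofId k (AlgebraicClosure k)).mapMatrix (m := Fin 2)) :=
    Matrix.map_injective (algebraMap k (AlgebraicClosure k)).injective
  refine ⟨I, J, hinj ?_, hinj ?_, hinj ?_⟩
  · rw [map_mul, hI, map_smul, map_one, ← algebraMap_smul (AlgebraicClosure k) u, ← hsu, hI']
    simp only [add_mul, mul_add, smul_mul_assoc, mul_smul_comm, hQQ, hQ1, h1Q, h11]
    rw [← mul_one (su ^ 2), ← hs1]
    module
  · rw [map_mul, hJ, map_smul, map_one, ← algebraMap_smul (AlgebraicClosure k) (-3 * v), map_mul,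
      ← hsv, hJ']
    simp only [sub_mul, mul_sub, smul_mul_assoc, mul_smul_comm, hP, one_mul, mul_one, map_neg,
      map_ofNat]
    module
  · rw [map_mul, map_neg, map_mul, hI, hJ, hI', hJ']
    simp only [add_mul, mul_add, sub_mul, mul_sub, smul_mul_assoc, mul_smul_comm, hPQ, hP1, hQP,
      h1P, one_mul, mul_one]
    module

theorem isRealizable_of_exists_anticommuting {k : Type*} [Field k]
    (h2 : (2 : k) ≠ 0) (h3 : (3 : k) ≠ 0)
    (ρ : Gk k →* MulAut (DihedralGroup 6)) (hρ : IsGkGroupStructure k ρ)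
    {u v : k} (hu : u ≠ 0) (hv : v ≠ 0) {su sv : AlgebraicClosure k}
    (hsu : su ^ 2 = algebraMap k (AlgebraicClosure k) u)
    (hsv : sv ^ 2 = algebraMap k (AlgebraicClosure k) v)
    (hcases : ∀ σ : Gk k, ∃ e c : ZMod 6, (e = 1 ∧ σ sv = sv ∨ e = -1 ∧ σ sv = -sv) ∧
      ((c = 0 ∨ c = 2 ∨ c = 4) ∧ σ su = su ∨ (c = 1 ∨ c = 3 ∨ c = 5) ∧ σ su = -su) ∧
      (∀ i, ρ σ (r i) = r (e * i)) ∧ ∀ i, ρ σ (sr i) = sr (c + e * i))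
    {I J : Matrix (Fin 2) (Fin 2) k} (hI : I * I = u • 1) (hJ : J * J = (-3 * v) • 1)
    (hJI : J * I = -(I * J)) :
    IsRealizable k ρ := by
  obtain ⟨s, hs3, hsσ, hs1⟩ := exists_equivariant_norm_one ρ hρ
  have h2' : (2 : AlgebraicClosure k) ≠ 0 := by
    simpa only [map_ofNat] using (map_ne_zero (algebraMap k (AlgebraicClosure k))).2 h2
  have h3' : (3 : AlgebraicClosure k) ≠ 0 := by
    simpa only [map_ofNat] using (map_ne_zero (algebraMap k (AlgebraicClosure k))).2 h3
  have hsu0 : su ≠ 0 := by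
    rintro rfl
    exact hu (by simpa using hsu.symm)
  have hsv0 : sv ≠ 0 := by
    rintro rfl
    exact hv (by simpa using hsv.symm)
  obtain ⟨f, hf⟩ : ∃ f, f = (Algebra.ofId k (AlgebraicClosure k)).mapMatrix (m := Fin 2) :=
    ⟨_, rfl⟩
  have hfσ : ∀ (σ : Gk k) (X : Matrix (Fin 2) (Fin 2) k), σ.mapMatrix (f X) = f X := by
    intro σ X
    rw [hf]
    ext i j
    exact σ.commutes _
  have hII : f I * f I = su ^ 2 • 1 := by
    rw [← map_mul, hI, map_smul, map_one, ← algebraMap_smul (AlgebraicClosure k) u, ← hsu]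
  have hJJ : f J * f J = (-3 * sv ^ 2) • 1 := by
    rw [← map_mul, hJ, map_smul, map_one, ← algebraMap_smul (AlgebraicClosure k) (-3 * v),
      map_mul, ← hsv, map_neg, map_ofNat]
  have hJI' : f J * f I = -(f I * f J) := by rw [← map_mul, hJI, map_neg, map_mul]
  obtain ⟨P, hPdef⟩ : ∃ P, P = (2⁻¹ : AlgebraicClosure k) • (1 + sv⁻¹ • f J) := ⟨_, rfl⟩
  have hP : P * P = P - 1 := by
    simp only [hPdef, add_mul, mul_add, smul_mul_assoc, mul_smul_comm, hJJ, one_mul, mul_one]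
    match_scalars <;> field_simp <;> ring
  have hPI : P * f I = f I - f I * P := by
    simp only [hPdef, add_mul, mul_add, smul_mul_assoc, mul_smul_comm, hJI', one_mul, mul_one]
    match_scalars <;> field_simp
    ring
  have hIPP : f I * P * P = f I * P - f I := by rw [mul_assoc, hP, mul_sub, mul_one]
  have hPIP : P * (f I * P) = f I := by rw [← mul_assoc, hPI, sub_mul, hIPP]; abel
  have hIIP : f I * (f I * P) = su ^ 2 • P := by rw [← mul_assoc, hII, smul_one_mul]
  have hIPI : f I * P * f I = su ^ 2 • (1 - P) := by
    rw [mul_assoc, hPI, mul_sub, hIIP, hII, smul_sub]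
  have hIPIP : f I * P * (f I * P) = su ^ 2 • 1 := by rw [mul_assoc, hPIP, hII]
  obtain ⟨Q, hQdef⟩ : ∃ Q, Q = su⁻¹ • ((s 0 - s 1) • f I + (s 1 - s 2) • (f I * P)) := ⟨_, rfl⟩
  have hQ : Q * Q = 1 := by
    simp only [hQdef, add_mul, mul_add, smul_mul_assoc, mul_smul_comm, hII, hIIP, hIPI, hIPIP]
    refine Eq.trans ?_
      ((congrArg (· • (1 : Matrix (Fin 2) (Fin 2) (AlgebraicClosure k))) hs1).trans (one_smul _ _))
    match_scalars <;> field_simp <;> ring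
  have hPQ : P * Q = Q * (1 - P) := by
    simp only [hQdef, add_mul, mul_add, mul_sub, smul_mul_assoc, mul_smul_comm, hPI, hPIP, hIPP,
      mul_one]
    module
  obtain ⟨M', hM'inj, hMr', hMs'⟩ := exists_injective_monoidHom_matrix h2' h3' hP hQ hPQ
  refine (isRealizable_iff_exists_monoidHom ρ).2 ⟨M', hM'inj, fun σ g => ?_⟩
  obtain ⟨M, hM⟩ : ∃ M, M = (Units.coeHom _).comp M' := ⟨_, rfl⟩
  have hMr : M (r 1) = P := by rw [hM]; exact hMr'
  have hMs : M (sr 0) = Q := by rw [hM]; exact hMs'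
  have hMs1 : M (sr 1) = su⁻¹ • ((s 0 - s 1) • (f I * P) + (s 1 - s 2) • (f I * P - f I)) := by
    rw [show (sr 1 : DihedralGroup 6) = sr 0 * r 1 from rfl, map_mul, hMr, hMs, hQdef,
      smul_mul_assoc, add_mul, smul_mul_assoc, smul_mul_assoc, hIPP]
  obtain ⟨hr5, hv2, hv3, hv4, hv5⟩ := monoidHom_dihedralGroup_six_values M (by rw [hMr, hP])
  have h3 : s 3 = s 0 := hs3 0
  have h4 : s 4 = s 1 := hs3 1
  have h5 : s 5 = s 2 := hs3 2
  obtain ⟨e, c, he, hc, hr, hsr⟩ := hcases σ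
  have hsσ' : ∀ i, σ (s i) = s (c + e * i) := fun i => hsσ σ _ _ (hsr i)
  have hσP : e = 1 ∧ σ.mapMatrix P = P ∨ e = -1 ∧ σ.mapMatrix P = 1 - P := by
    simp only [hPdef, AlgEquiv.mapMatrix_smul_semilinear, map_add, map_inv₀, map_ofNat, map_one,
      hfσ]
    rcases he with ⟨rfl, he⟩ | ⟨rfl, he⟩
    · exact Or.inl ⟨rfl, by rw [he]⟩
    · refine Or.inr ⟨rfl, ?_⟩
      rw [he]
      match_scalars <;> field_simp
      ring
  have hr1 : M (ρ σ (r 1)) = σ.mapMatrix (M (r 1)) := by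
    rw [hr, hMr, mul_one]
    rcases hσP with ⟨rfl, h⟩ | ⟨rfl, h⟩
    · rw [h, hMr]
    · rw [h, hr5, hMr]
  have hs0 : M (ρ σ (sr 0)) = σ.mapMatrix (M (sr 0)) := by
    rw [hQdef] at hMs
    rw [hMs]
    simp only [AlgEquiv.mapMatrix_smul_semilinear, map_add, map_sub, map_mul, map_inv₀, hfσ, hsσ',
      hsr]
    have hσIP : e = 1 ∧ f I * σ.mapMatrix P = f I * P ∨
        e = -1 ∧ f I * σ.mapMatrix P = f I - f I * P :=
      hσP.imp (fun h => ⟨h.1, by rw [h.2]⟩) fun h => ⟨h.1, by rw [h.2, mul_sub, mul_one]⟩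
    clear * - hσIP hc hMs hMs1 hv2 hv3 hv4 hv5 h3 h4 h5
    rcases hσIP with ⟨rfl, h⟩ | ⟨rfl, h⟩ <;>
      rcases hc with ⟨rfl | rfl | rfl, hc⟩ | ⟨rfl | rfl | rfl, hc⟩ <;>
      rw [h, hc] <;> reduce_mod_char <;>
      simp only [hv2, hv3, hv4, hv5, h3, h4, h5, hMs, hMs1, inv_neg] <;> module
  have hpow : ∀ i : ZMod 6, (r i : DihedralGroup 6) = r 1 ^ i.val := fun i => by
    rw [r_one_pow, ZMod.natCast_zmod_val]
  have hr' : ∀ i, M (ρ σ (r i)) = σ.mapMatrix (M (r i)) := fun i => by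
    rw [hpow, map_pow, map_pow, hr1, map_pow, map_pow]
  have hall : ∀ g, M (ρ σ g) = σ.mapMatrix (M g) := by
    rintro (i | i)
    · exact hr' i
    · rw [show (sr i : DihedralGroup 6) = sr 0 * r i by rw [sr_mul_r, zero_add], map_mul, map_mul,
        hs0, hr', map_mul, map_mul]
  rw [hM] at hall
  exact hall g

/-- Theorem 2 of Cardona–Quer.
A `G_k`-group structure `ρ` on `D12` (realized as `DihedralGroup 6`, `U = sr 0`, `V = r 1`),
with fields `K₁ = k(√u)` and `K₂ = k(√v)`, is realizable in `GL₂(k̄)` if and only if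
`ℍ[k, u, −3v] ≅ M₂(k)` as `k`-algebras.
Field equalities between fixed fields are expressed, via the Galois correspondence, as
equalities of the corresponding subgroups of `G_k`. -/
theorem realizable_D12_iff_quaternion_split {k : Type*} [Field k] [PerfectField k]
    (hchar2 : (2 : k) ≠ 0) (hchar3 : (3 : k) ≠ 0)
    (ρ : Gk k →* MulAut (DihedralGroup 6)) (hρ : IsGkGroupStructure k ρ)
    (u v : k) (hu : u ≠ 0) (hv : v ≠ 0)
    (su sv : AlgebraicClosure k)
    (hsu : su ^ 2 = algebraMap k (AlgebraicClosure k) u)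
    (hsv : sv ^ 2 = algebraMap k (AlgebraicClosure k) v)
    -- `K₁ = k(√u)`:
    (hK1 : ∀ σ : Gk k,
      (∀ g : DihedralGroup 6, ρ σ g * g⁻¹ ∈ ({1, r 2, r 4} : Set (DihedralGroup 6))) ↔
        σ su = su)
    -- `K₂ = k(√v)`:
    (hK2 : ∀ σ : Gk k, ρ σ (r 1) = r 1 ↔ σ sv = sv) :
    IsRealizable k ρ ↔ Nonempty (ℍ[k, u, -3 * v] ≃ₐ[k] Matrix (Fin 2) (Fin 2) k) := by
  rw [quaternionAlgebra_equiv_matrix_iff hchar2 hu (mul_ne_zero (neg_ne_zero.2 hchar3) hv)]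
  have hcases := galois_action_cases hsu hsv hK1 hK2
  exact ⟨exists_anticommuting_of_isRealizable ρ hρ hsu hsv hcases, fun ⟨_, _, hI, hJ, hJI⟩ =>
    isRealizable_of_exists_anticommuting hchar2 hchar3 ρ hρ hu hv hsu hsv hcases hI hJ hJI⟩

end
end

section
/- Let A₁, A₂ ≤ GL₂(k̄) be Galois-stable subgroups which are both isomorphic as abstract groups to the dihedral group D8 of order 8 (respectively, both isomorphic to the dihedral group D12 of order 12, assuming in this case also char k ≠ 3). Suppose f : A₁ → A₂ is a Galois-equivariant group isomorphism, i.e. f(σ(M)) = σ(f(M)) for all σ ∈ G_k and M ∈ A₁. Then there exists a matrix N ∈ GL₂(k) such that f(M) = N·M·N⁻¹ for all M ∈ A₁; in particular A₂ = N·A₁·N⁻¹, so A₁ and A₂ are GL₂(k)-conjugate. -/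
open Matrix

noncomputable section

/-- The base change `GL₂(k) → GL₂(k̄)`. -/
def glMap (k : Type*) [Field k] :
    GL (Fin 2) k →* GL (Fin 2) (AlgebraicClosure k) :=
  Units.map (RingHom.mapMatrix (algebraMap k (AlgebraicClosure k))).toMonoidHom

section RankTwoDihedral

variable {K : Type*} [Field K]

/-- A non-scalar involution of size two is traceless of determinant `-1`. -/
lemma trace_eq_zero_and_det_eq_neg_one_of_mul_self_eq_one
    {S : Matrix (Fin 2) (Fin 2) K} (hS : S * S = 1) (h1 : S ≠ 1) (hneg : S ≠ -1) :
    S.trace = 0 ∧ S.det = -1 := by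
  have e00 := congrFun (congrFun hS 0) 0
  have e01 := congrFun (congrFun hS 0) 1
  have e10 := congrFun (congrFun hS 1) 0
  have e11 := congrFun (congrFun hS 1) 1
  simp only [Matrix.mul_apply, Fin.sum_univ_two, Matrix.one_apply_eq, ne_eq, zero_ne_one,
    one_ne_zero, not_false_eq_true, Matrix.one_apply_ne] at e00 e01 e10 e11
  have htr : S 0 0 + S 1 1 = 0 := by
    by_contra htr
    have hb : S 0 1 = 0 := by
      apply (mul_eq_zero.mp (?_ : S 0 1 * (S 0 0 + S 1 1) = 0)).resolve_right htr
      linear_combination e01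
    have hc : S 1 0 = 0 := by
      apply (mul_eq_zero.mp (?_ : S 1 0 * (S 0 0 + S 1 1) = 0)).resolve_right htr
      linear_combination e10
    have hd : S 1 1 = S 0 0 := by
      have := (mul_eq_zero.mp (?_ : (S 0 0 - S 1 1) * (S 0 0 + S 1 1) = 0)).resolve_right htr
      · linear_combination -this
      · linear_combination e00 - e11
    have ha : (S 0 0 - 1) * (S 0 0 + 1) = 0 := by linear_combination e00 - S 0 1 * hc
    rcases mul_eq_zero.mp ha with ha | ha
    · apply h1
      ext i j
      fin_cases i <;> fin_cases j <;> simp [hb, hc, hd]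
      all_goals linear_combination ha
    · apply hneg
      ext i j
      fin_cases i <;> fin_cases j <;> simp [hb, hc, hd]
      all_goals linear_combination ha
  refine ⟨by rw [trace_fin_two, htr], ?_⟩
  rw [det_fin_two]
  linear_combination S 0 0 * htr - e00

/-- Normal form of a rotation `R` and a reflection `S` generating a dihedral group. -/
lemma exists_dihedral_normal_form (h2 : (2 : K) ≠ 0) {R S : Matrix (Fin 2) (Fin 2) K} {t : K}
    (ht : t ^ 2 ≠ 4) (htrS : S.trace = 0) (hdetS : S.det = -1) (hdetR : R.det = 1)
    (htrR : R.trace = t) (htrSR : (S * R).trace = 0) :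
    ∃ P : Matrix (Fin 2) (Fin 2) K, IsUnit P.det ∧
      R * P = P * !![0, -1; 1, t] ∧ S * P = P * !![1, t; 0, -1] := by
  rw [det_fin_two] at hdetS hdetR
  rw [trace_fin_two] at htrS htrR htrSR
  simp only [Matrix.mul_apply, Fin.sum_univ_two] at htrSR
  obtain ⟨v, w, hvw, hv, hw⟩ : ∃ v w : K, (v ≠ 0 ∨ w ≠ 0) ∧
      S 0 0 * v + S 0 1 * w = v ∧ S 1 0 * v + S 1 1 * w = w := by
    by_cases ha : S 0 0 + 1 = 0
    · refine ⟨S 0 1, S 1 1 + 1, Or.inr fun h => h2 ?_, ?_, ?_⟩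
      · linear_combination ha + h - htrS
      · linear_combination S 0 1 * htrS
      · linear_combination (S 1 1 + 1) * htrS - hdetS - htrS
    · refine ⟨S 0 0 + 1, S 1 0, Or.inl ha, ?_, ?_⟩
      · linear_combination S 0 0 * htrS - hdetS
      · linear_combination S 1 0 * htrS
  have e00 : S 0 0 * R 0 0 + S 0 1 * R 1 0 + (R 0 0 * S 0 0 + R 0 1 * S 1 0) = t * S 0 0 := by
    linear_combination htrSR - R 1 1 * htrS + S 0 0 * htrR
  have e01 : S 0 0 * R 0 1 + S 0 1 * R 1 1 + (R 0 0 * S 0 1 + R 0 1 * S 1 1) = t * S 0 1 := by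
    linear_combination R 0 1 * htrS + S 0 1 * htrR
  have e10 : S 1 0 * R 0 0 + S 1 1 * R 1 0 + (R 1 0 * S 0 0 + R 1 1 * S 1 0) = t * S 1 0 := by
    linear_combination R 1 0 * htrS + S 1 0 * htrR
  have e11 : S 1 0 * R 0 1 + S 1 1 * R 1 1 + (R 1 0 * S 0 1 + R 1 1 * S 1 1) = t * S 1 1 := by
    linear_combination htrSR - R 0 0 * htrS + S 1 1 * htrR
  have hx : S 0 0 * (R 0 0 * v + R 0 1 * w) + S 0 1 * (R 1 0 * v + R 1 1 * w) =
      t * v - (R 0 0 * v + R 0 1 * w) := by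
    linear_combination v * e00 + w * e01 - R 0 0 * hv - R 0 1 * hw + t * hv
  have hy : S 1 0 * (R 0 0 * v + R 0 1 * w) + S 1 1 * (R 1 0 * v + R 1 1 * w) =
      t * w - (R 1 0 * v + R 1 1 * w) := by
    linear_combination v * e10 + w * e11 - R 1 0 * hv - R 1 1 * hw + t * hw
  refine ⟨!![v, R 0 0 * v + R 0 1 * w; w, R 1 0 * v + R 1 1 * w], ?_, ?_, ?_⟩
  · rw [isUnit_iff_ne_zero, det_fin_two_of]
    intro hdet
    obtain ⟨l, hlv, hlw⟩ : ∃ l : K, R 0 0 * v + R 0 1 * w = l * v ∧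
        R 1 0 * v + R 1 1 * w = l * w := by
      rcases hvw with hv0 | hw0
      · refine ⟨(R 0 0 * v + R 0 1 * w) / v, by field_simp, ?_⟩
        field_simp
        linear_combination hdet
      · refine ⟨(R 1 0 * v + R 1 1 * w) / w, ?_, by field_simp⟩
        field_simp
        linear_combination -hdet
    rw [hlv, hlw] at hx hy
    have key : ∀ x : K, x ≠ 0 → (2 * l - t) * x = 0 → (l ^ 2 - t * l + 1) * x = 0 → False := by
      intro x hx0 h h'
      have h := (mul_eq_zero.mp h).resolve_right hx0
      have h' := (mul_eq_zero.mp h').resolve_right hx0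
      exact ht (by linear_combination (2 * l - t) * h - 4 * h')
    rcases hvw with hv0 | hw0
    · refine key v hv0 (by linear_combination hx - l * hv) ?_
      linear_combination (-l - R 0 0 + t) * hlv - R 0 1 * hlw +
        (R 0 0 * v + R 0 1 * w) * htrR - v * hdetR
    · refine key w hw0 (by linear_combination hy - l * hw) ?_
      linear_combination (-l - R 1 1 + t) * hlw - R 1 0 * hlv +
        (R 1 0 * v + R 1 1 * w) * htrR - w * hdetR
  · ext i j
    fin_cases i <;> fin_cases j <;> simp [Matrix.mul_apply, Fin.sum_univ_two]
    · linear_combination (R 0 0 * v + R 0 1 * w) * htrR - v * hdetR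
    · linear_combination (R 1 0 * v + R 1 1 * w) * htrR - w * hdetR
  · ext i j
    fin_cases i <;> fin_cases j <;> simp [Matrix.mul_apply, Fin.sum_univ_two]
    · linear_combination hv
    · linear_combination hx
    · linear_combination hw
    · linear_combination hy

/-- The commutant of a dihedral normal form is the scalars. -/
lemma exists_eq_smul_one_of_commute_normal_form (h2 : (2 : K) ≠ 0)
    {P R S Y : Matrix (Fin 2) (Fin 2) K} {t : K}
    (hP : IsUnit P.det) (hR : R * P = P * !![0, -1; 1, t]) (hS : S * P = P * !![1, t; 0, -1])
    (hYR : Y * R = R * Y) (hYS : Y * S = S * Y) : ∃ c : K, Y = c • 1 := by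
  have hPP := P.mul_nonsing_inv hP
  have hPP' := P.nonsing_inv_mul hP
  obtain ⟨Z, hZ⟩ : ∃ Z, Y * P = P * Z :=
    ⟨P⁻¹ * (Y * P), by rw [← mul_assoc P, hPP, one_mul]⟩
  have transfer : ∀ A B : Matrix (Fin 2) (Fin 2) K, A * P = P * B → Y * A = A * Y →
      Z * B = B * Z := by
    intro A B hA hYA
    have h : P * (Z * B) = P * (B * Z) := by
      rw [← mul_assoc, ← hZ, mul_assoc, ← hA, ← mul_assoc, hYA, mul_assoc, hZ, ← mul_assoc, hA,
        mul_assoc]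
    simpa [← mul_assoc, hPP'] using congrArg (P⁻¹ * ·) h
  have hZR := transfer _ _ hR hYR
  have hZS := transfer _ _ hS hYS
  have r00 := congrFun (congrFun hZR 0) 0
  have r01 := congrFun (congrFun hZR 0) 1
  have s10 := congrFun (congrFun hZS 1) 0
  simp [-cons_mul, Matrix.mul_apply, Fin.sum_univ_two] at r00 r01 s10
  have hc : Z 1 0 = 0 := by
    refine (mul_eq_zero.mp (?_ : 2 * Z 1 0 = 0)).resolve_left h2
    linear_combination s10
  have hb : Z 0 1 = 0 := by rw [r00, hc, neg_zero]
  have hZ1 : Z = Z 0 0 • 1 := by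
    ext i j
    fin_cases i <;> fin_cases j <;> simp [hb, hc]
    linear_combination r01 - t * hb
  refine ⟨Z 0 0, ?_⟩
  calc Y = Y * P * P⁻¹ := by rw [mul_assoc, hPP, mul_one]
    _ = Z 0 0 • 1 := by rw [hZ, hZ1]; simp [hPP]

variable {n : ℕ} {ρ : DihedralGroup n →* GL (Fin 2) K}

open DihedralGroup

lemma trace_eq_zero_and_det_eq_neg_one_of_not_commute (hρ : Function.Injective ρ)
    {g h : DihedralGroup n} (hg : g * g = 1) (hgh : g * h ≠ h * g) :
    (ρ g).val.trace = 0 ∧ (ρ g).val.det = -1 := by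
  have key : ∀ c : Matrix (Fin 2) (Fin 2) K, (∀ M, c * M = M * c) → (ρ g).val ≠ c := by
    intro c hc h'
    refine hgh (hρ (Units.ext ?_))
    rw [map_mul, map_mul, Units.val_mul, Units.val_mul, h', hc]
  refine trace_eq_zero_and_det_eq_neg_one_of_mul_self_eq_one ?_ (key 1 (by simp))
    (key (-1) (by simp))
  rw [← Units.val_mul, ← map_mul, hg, map_one, Units.val_one]

lemma sr_mul_r_one_ne (hn : (2 : ZMod n) ≠ 0) (i : ZMod n) : sr i * r 1 ≠ r 1 * sr i := by
  rw [sr_mul_r, r_mul_sr, ne_eq, sr.injEq]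
  intro h
  exact hn (by linear_combination h)

lemma det_rotation_eq_one (hρ : Function.Injective ρ) (hn : (2 : ZMod n) ≠ 0) :
    (ρ (r 1)).val.det = 1 := by
  have h0 := trace_eq_zero_and_det_eq_neg_one_of_not_commute hρ (sr_mul_self 0)
    (sr_mul_r_one_ne hn 0)
  have h1 := trace_eq_zero_and_det_eq_neg_one_of_not_commute hρ (sr_mul_self (0 + 1))
    (sr_mul_r_one_ne hn _)
  have h2 := h1.2
  rw [← sr_mul_r, map_mul, Units.val_mul, det_mul, h0.2] at h2
  linear_combination -h2

lemma rotation_pow_eq_neg_one (h2 : (2 : K) ≠ 0) (hρ : Function.Injective ρ)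
    (hn : (2 : ZMod n) ≠ 0) {m : ℕ} (hm : (m : ZMod n) ≠ 0) (hmm : (m + m : ZMod n) = 0) :
    (ρ (r 1)).val ^ m = -1 := by
  have hdet := det_rotation_eq_one hρ hn
  by_contra hneg
  have h := trace_eq_zero_and_det_eq_neg_one_of_mul_self_eq_one
    (S := (ρ (r 1)).val ^ m) ?_ ?_ hneg
  · rw [det_pow, hdet, one_pow] at h
    exact h2 (by linear_combination h.2)
  · rw [← Units.val_pow_eq_pow_val, ← map_pow, r_one_pow, ← Units.val_mul, ← map_mul, r_mul_r,
      hmm, r_zero, map_one, Units.val_one]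
  · rw [← Units.val_pow_eq_pow_val, ← map_pow, r_one_pow, ne_eq, Units.val_eq_one,
      map_eq_one_iff ρ hρ, one_def, r.injEq]
    exact hm

lemma rotation_sq (hρ : Function.Injective ρ) (hn : (2 : ZMod n) ≠ 0) :
    (ρ (r 1)).val ^ 2 = (ρ (r 1)).val.trace • (ρ (r 1)).val - 1 := by
  have hdet := det_rotation_eq_one hρ hn
  rw [det_fin_two] at hdet
  ext i j
  fin_cases i <;> fin_cases j <;>
    simp [sq, Matrix.mul_apply, Fin.sum_univ_two, trace_fin_two]
  · linear_combination -hdet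
  · ring
  · ring
  · linear_combination -hdet

lemma eq_zero_of_smul_rotation_eq_smul_one (hρ : Function.Injective ρ) (hn : (2 : ZMod n) ≠ 0)
    {a b : K} (h : a • (ρ (r 1)).val = b • 1) : a = 0 ∧ b = 0 := by
  have ha : a = 0 := by
    by_contra ha
    refine sr_mul_r_one_ne hn 0 (hρ (Units.ext ?_))
    have h' : (ρ (r 1)).val = (a⁻¹ * b) • 1 := by
      rw [mul_smul, ← h, smul_smul, inv_mul_cancel₀ ha, one_smul]
    rw [map_mul, map_mul, Units.val_mul, Units.val_mul, h']
    simp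
  refine ⟨ha, ?_⟩
  simpa [ha] using (congrFun (congrFun h 0) 0).symm

lemma trace_rotation_four {ρ : DihedralGroup 4 →* GL (Fin 2) K} (h2 : (2 : K) ≠ 0)
    (hρ : Function.Injective ρ) : (ρ (r 1)).val.trace = 0 := by
  have hn : (2 : ZMod 4) ≠ 0 := by decide
  have h := rotation_pow_eq_neg_one h2 hρ hn (m := 2) (by decide) (by decide)
  rw [rotation_sq hρ hn, sub_eq_iff_eq_add, neg_add_cancel] at h
  exact (eq_zero_of_smul_rotation_eq_smul_one (b := 0) hρ hn (by simpa using h)).1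

lemma trace_rotation_six {ρ : DihedralGroup 6 →* GL (Fin 2) K} (h2 : (2 : K) ≠ 0)
    (hρ : Function.Injective ρ) : (ρ (r 1)).val.trace = 1 := by
  have hn : (2 : ZMod 6) ≠ 0 := by decide
  have h := rotation_pow_eq_neg_one h2 hρ hn (m := 3) (by decide) (by decide)
  set t := (ρ (r 1)).val.trace with ht
  have h' : (t ^ 2 - 1) • (ρ (r 1)).val = (t - 1) • 1 := by
    rw [pow_succ, rotation_sq hρ hn, sub_mul, one_mul, smul_mul_assoc, ← sq,
      rotation_sq hρ hn, ← ht] at h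
    rw [sub_smul, sub_smul, one_smul, one_smul, sq, mul_smul]
    rw [smul_sub] at h
    rw [← sub_eq_zero] at h ⊢
    rw [← h]
    abel
  linear_combination (eq_zero_of_smul_rotation_eq_smul_one hρ hn h').2

lemma exists_normal_form_of_injective (h2 : (2 : K) ≠ 0) (hρ : Function.Injective ρ)
    (hn : (2 : ZMod n) ≠ 0) {t : K} (htr : (ρ (r 1)).val.trace = t) (ht : t ^ 2 ≠ 4) :
    ∃ P : Matrix (Fin 2) (Fin 2) K, IsUnit P.det ∧
      (ρ (r 1)).val * P = P * !![0, -1; 1, t] ∧ (ρ (sr 0)).val * P = P * !![1, t; 0, -1] := by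
  have h0 := trace_eq_zero_and_det_eq_neg_one_of_not_commute hρ (sr_mul_self 0)
    (sr_mul_r_one_ne hn 0)
  have h1 := trace_eq_zero_and_det_eq_neg_one_of_not_commute hρ (sr_mul_self (0 + 1))
    (sr_mul_r_one_ne hn _)
  refine exists_dihedral_normal_form h2 ht h0.1 h0.2 (det_rotation_eq_one hρ hn) htr ?_
  rw [← Units.val_mul, ← map_mul, sr_mul_r]
  exact h1.1

/-- Schur's lemma for faithful two-dimensional dihedral representations. -/
lemma exists_eq_smul_one_of_commute (h2 : (2 : K) ≠ 0) (hρ : Function.Injective ρ)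
    (hn : (2 : ZMod n) ≠ 0) (ht : (ρ (r 1)).val.trace ^ 2 ≠ 4)
    {Y : Matrix (Fin 2) (Fin 2) K} (hY : ∀ g, Y * (ρ g).val = (ρ g).val * Y) :
    ∃ c : K, Y = c • 1 := by
  obtain ⟨P, hP, hR, hS⟩ := exists_normal_form_of_injective h2 hρ hn rfl ht
  exact exists_eq_smul_one_of_commute_normal_form h2 hP hR hS (hY _) (hY _)

/-- Dihedral homomorphisms agreeing on the standard generators are equal. -/
lemma dihedral_hom_ext [NeZero n] {G : Type*} [Group G] {φ ψ : DihedralGroup n →* G}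
    (hr : φ (r 1) = ψ (r 1)) (hs : φ (sr 0) = ψ (sr 0)) : φ = ψ := by
  have hr' : ∀ i : ZMod n, φ (r i) = ψ (r i) := by
    intro i
    rw [← ZMod.natCast_zmod_val i, ← r_one_pow, map_pow, map_pow, hr]
  ext g
  cases g with
  | r i => exact hr' i
  | sr i => rw [← zero_add i, ← sr_mul_r, map_mul, map_mul, hr', hs]

/-- Faithful two-dimensional dihedral representations with equal rotation traces are
conjugate. -/
lemma exists_intertwiner [NeZero n] {ρ₁ ρ₂ : DihedralGroup n →* GL (Fin 2) K} (h2 : (2 : K) ≠ 0)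
    (hρ₁ : Function.Injective ρ₁) (hρ₂ : Function.Injective ρ₂)
    (hn : (2 : ZMod n) ≠ 0) (htr : (ρ₁ (r 1)).val.trace = (ρ₂ (r 1)).val.trace)
    (ht : (ρ₁ (r 1)).val.trace ^ 2 ≠ 4) :
    ∃ X : GL (Fin 2) K, ∀ g, X * ρ₁ g = ρ₂ g * X := by
  obtain ⟨P₁, hP₁, hR₁, hS₁⟩ := exists_normal_form_of_injective h2 hρ₁ hn rfl ht
  obtain ⟨P₂, hP₂, hR₂, hS₂⟩ := exists_normal_form_of_injective h2 hρ₂ hn htr.symm ht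
  lift P₁ to GL (Fin 2) K using (isUnit_iff_isUnit_det _).2 hP₁
  lift P₂ to GL (Fin 2) K using (isUnit_iff_isUnit_det _).2 hP₂
  have transfer : ∀ (A₁ A₂ : GL (Fin 2) K) (B : Matrix (Fin 2) (Fin 2) K),
      A₁.val * P₁.val = P₁.val * B → A₂.val * P₂.val = P₂.val * B →
      P₂ * P₁⁻¹ * A₁ * (P₂ * P₁⁻¹)⁻¹ = A₂ := by
    intro A₁ A₂ B h₁ h₂
    have hB₁ : (P₁⁻¹ * A₁ * P₁).val = B := by
      rw [mul_assoc, Units.val_mul, Units.val_mul, h₁, Units.inv_mul_cancel_left]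
    have hB₂ : (P₂⁻¹ * A₂ * P₂).val = B := by
      rw [mul_assoc, Units.val_mul, Units.val_mul, h₂, Units.inv_mul_cancel_left]
    have h := Units.ext (hB₁.trans hB₂.symm)
    calc P₂ * P₁⁻¹ * A₁ * (P₂ * P₁⁻¹)⁻¹ = P₂ * (P₁⁻¹ * A₁ * P₁) * P₂⁻¹ := by group
      _ = A₂ := by rw [h]; group
  refine ⟨P₂ * P₁⁻¹, fun g => ?_⟩
  have h : (MulAut.conj (P₂ * P₁⁻¹)).toMonoidHom.comp ρ₁ = ρ₂ :=
    dihedral_hom_ext (transfer _ _ _ hR₁ hR₂) (transfer _ _ _ hS₁ hS₂)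
  rw [← h]
  simp [mul_assoc]

end RankTwoDihedral

section Descent

variable {k : Type*} [Field k]

lemma galHom_val (σ : Gk k) (M : GL (Fin 2) (AlgebraicClosure k)) :
    (galHom k σ M).val = M.val.map σ := rfl

/-- Hilbert 90 for a line of intertwiners: if all the intertwiners from a Galois-stable subgroup
are proportional to an invertible one, then some invertible one is rational. -/
lemma exists_rational_intertwiner [PerfectField k]
    {A₁ A₂ : Subgroup (GL (Fin 2) (AlgebraicClosure k))}
    (hstable : ∀ σ : Gk k, ∀ M ∈ A₁, galHom k σ M ∈ A₁) (f : A₁ ≃* A₂)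
    (hequiv : ∀ (σ : Gk k) (M : A₁) (h : galHom k σ (M : GL (Fin 2) (AlgebraicClosure k)) ∈ A₁),
      ((f ⟨galHom k σ (M : GL (Fin 2) (AlgebraicClosure k)), h⟩ : A₂) :
          GL (Fin 2) (AlgebraicClosure k)) =
        galHom k σ ((f M : A₂) : GL (Fin 2) (AlgebraicClosure k)))
    (hschur : ∀ Y : Matrix (Fin 2) (Fin 2) (AlgebraicClosure k),
      (∀ M : A₁, Y * M.val.val = M.val.val * Y) → ∃ c : AlgebraicClosure k, Y = c • 1)
    (X : GL (Fin 2) (AlgebraicClosure k)) (hX : ∀ M : A₁, X * M.val = (f M).val * X) :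
    ∃ N : GL (Fin 2) k, ∀ M : A₁, glMap k N * M.val = (f M).val * glMap k N := by
  obtain ⟨i, j, hij⟩ : ∃ i j, X.val i j ≠ 0 := by
    by_contra! h
    exact X.ne_zero (Matrix.ext h)
  set Z : GL (Fin 2) (AlgebraicClosure k) := (Units.mk0 _ hij)⁻¹ • X with hZdef
  have hZval : Z.val = (X.val i j)⁻¹ • X.val := rfl
  have hZij : Z.val i j = 1 := by simp [hZval, hij]
  have hZ : ∀ M : A₁, Z.val * M.val.val = (f M).val.val * Z.val := by
    intro M
    rw [hZval, smul_mul_assoc, mul_smul_comm, ← Units.val_mul, ← Units.val_mul, hX]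
  have hfix : ∀ σ : Gk k, galHom k σ Z = Z := by
    intro σ
    have hσ : ∀ M : A₁, galHom k σ Z * M.val = (f M).val * galHom k σ Z := by
      intro M
      set M' : A₁ := ⟨galHom k σ⁻¹ M.val, hstable _ _ M.2⟩
      have hM : galHom k σ M'.val = M.val := by
        change galHom k σ (galHom k σ⁻¹ M.val) = M.val
        rw [← MulAut.mul_apply, ← map_mul, mul_inv_cancel, map_one, MulAut.one_apply]
      have hM' : (⟨galHom k σ M'.val, hstable _ _ M'.2⟩ : A₁) = M := Subtype.ext hM
      have h := hequiv σ M' (hstable _ _ M'.2)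
      rw [hM'] at h
      have hZM' : Z * M'.val = (f M').val * Z := Units.ext (hZ M')
      rw [h, ← map_mul, ← hM, ← map_mul, hZM']
    obtain ⟨c, hc⟩ := hschur (Z⁻¹ * galHom k σ Z).val fun M => by
      have h1 : Z * M.val = (f M).val * Z := Units.ext (hZ M)
      have h2 : Z⁻¹ * galHom k σ Z * M.val = M.val * (Z⁻¹ * galHom k σ Z) := by
        rw [mul_assoc, hσ, inv_mul_eq_iff_eq_mul, ← mul_assoc, ← mul_assoc, h1,
          mul_inv_cancel_right]
      rw [← Units.val_mul, h2, Units.val_mul]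
    have hc' : (galHom k σ Z).val = c • Z.val := by
      rw [← mul_inv_cancel_left Z (galHom k σ Z), Units.val_mul, hc]
      simp
    have hc1 : c = 1 := by
      have h := congrFun (congrFun hc' i) j
      rw [galHom_val, map_apply, Matrix.smul_apply, hZij, map_one] at h
      simpa using h.symm
    exact Units.ext (by rw [hc', hc1, one_smul])
  have hrange : ∀ a b, ∃ x : k, algebraMap k (AlgebraicClosure k) x = Z.val a b := by
    intro a b
    have : IsGalois k (AlgebraicClosure k) := {}
    refine (InfiniteGalois.mem_range_algebraMap_iff_fixed _).2 fun σ => ?_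
    have h : (galHom k σ Z).val = Z.val := by rw [hfix]
    exact congrFun (congrFun h a) b
  choose N hN using hrange
  have hNZ : (Matrix.of N).map (algebraMap k (AlgebraicClosure k)) = Z.val := Matrix.ext hN
  have hdet : IsUnit (Matrix.of N) := by
    rw [isUnit_iff_isUnit_det, isUnit_iff_ne_zero]
    intro h
    have hZdet : Z.val.det ≠ 0 := ((isUnit_iff_isUnit_det _).1 Z.isUnit).ne_zero
    apply hZdet
    rw [← hNZ, ← RingHom.mapMatrix_apply, ← RingHom.map_det, h, map_zero]
  obtain ⟨U, hU⟩ := hdet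
  have hUZ : glMap k U = Z := by
    ext1
    rw [← hNZ, ← hU]
    rfl
  exact ⟨U, fun M => by rw [hUZ]; exact Units.ext (hZ M)⟩

/-- A Galois-equivariant isomorphism of Galois-stable dihedral subgroups is realised by a rational
intertwiner, as soon as all their faithful representations have the same rotation trace. -/
lemma exists_rational_intertwiner_of_dihedral [PerfectField k] {n : ℕ} [NeZero n]
    (h2 : (2 : AlgebraicClosure k) ≠ 0) (hn : (2 : ZMod n) ≠ 0) {t : AlgebraicClosure k}
    (ht : t ^ 2 ≠ 4)
    (htr : ∀ ρ : DihedralGroup n →* GL (Fin 2) (AlgebraicClosure k), Function.Injective ρ →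
      (ρ (DihedralGroup.r 1)).val.trace = t)
    {A₁ A₂ : Subgroup (GL (Fin 2) (AlgebraicClosure k))}
    (hstable : ∀ σ : Gk k, ∀ M ∈ A₁, galHom k σ M ∈ A₁) (e : A₁ ≃* DihedralGroup n)
    (f : A₁ ≃* A₂)
    (hequiv : ∀ (σ : Gk k) (M : A₁) (h : galHom k σ (M : GL (Fin 2) (AlgebraicClosure k)) ∈ A₁),
      ((f ⟨galHom k σ (M : GL (Fin 2) (AlgebraicClosure k)), h⟩ : A₂) :
          GL (Fin 2) (AlgebraicClosure k)) =
        galHom k σ ((f M : A₂) : GL (Fin 2) (AlgebraicClosure k))) :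
    ∃ N : GL (Fin 2) k, ∀ M : A₁, glMap k N * M.val = (f M).val * glMap k N := by
  set ρ₁ := A₁.subtype.comp e.symm.toMonoidHom with hρ₁def
  set ρ₂ := A₂.subtype.comp (e.symm.trans f).toMonoidHom with hρ₂def
  have hρ₁ : Function.Injective ρ₁ := A₁.subtype_injective.comp e.symm.injective
  have hρ₂ : Function.Injective ρ₂ := A₂.subtype_injective.comp (e.symm.trans f).injective
  obtain ⟨X, hX⟩ := exists_intertwiner h2 hρ₁ hρ₂ hn ((htr _ hρ₁).trans (htr _ hρ₂).symm)
    (by rwa [htr _ hρ₁])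
  refine exists_rational_intertwiner hstable f hequiv (fun Y hY => ?_) X fun M => ?_
  · exact exists_eq_smul_one_of_commute h2 hρ₁ hn (by rwa [htr _ hρ₁]) fun g => hY (e.symm g)
  · simpa [hρ₁def, hρ₂def] using hX (e M)

end Descent

/-- Lemma 6 of Cardona–Quer.
Two Galois-stable subgroups `A₁, A₂ ≤ GL₂(k̄)` both abstractly isomorphic to `D8`
(respectively, both isomorphic to `D12`, assuming also char k ≠ 3) which are isomorphic
as `G_k`-groups via a Galois-equivariant isomorphism `f` are conjugate by a matrix
`N ∈ GL₂(k)`, with `f` given by conjugation by `N`. -/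
theorem galoisStable_isomorphic_subgroups_conjugate {k : Type*} [Field k] [PerfectField k]
    (hchar : (2 : k) ≠ 0)
    (A₁ A₂ : Subgroup (GL (Fin 2) (AlgebraicClosure k)))
    (hstable₁ : ∀ σ : Gk k, ∀ M ∈ A₁, galHom k σ M ∈ A₁)
    (hstable₂ : ∀ σ : Gk k, ∀ M ∈ A₂, galHom k σ M ∈ A₂)
    (hiso : (Nonempty (A₁ ≃* DihedralGroup 4) ∧ Nonempty (A₂ ≃* DihedralGroup 4)) ∨
      ((3 : k) ≠ 0 ∧ Nonempty (A₁ ≃* DihedralGroup 6) ∧ Nonempty (A₂ ≃* DihedralGroup 6)))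
    (f : A₁ ≃* A₂)
    (hequiv : ∀ (σ : Gk k) (M : A₁) (h : galHom k σ (M : GL (Fin 2) (AlgebraicClosure k)) ∈ A₁),
      ((f ⟨galHom k σ (M : GL (Fin 2) (AlgebraicClosure k)), h⟩ : A₂) :
          GL (Fin 2) (AlgebraicClosure k)) =
        galHom k σ ((f M : A₂) : GL (Fin 2) (AlgebraicClosure k))) :
    ∃ N : GL (Fin 2) k,
      (∀ M : A₁, ((f M : A₂) : GL (Fin 2) (AlgebraicClosure k)) =
        glMap k N * (M : GL (Fin 2) (AlgebraicClosure k)) * (glMap k N)⁻¹) ∧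
      Subgroup.map (MulAut.conj (glMap k N)).toMonoidHom A₁ = A₂ := by
  have h2 : (2 : AlgebraicClosure k) ≠ 0 := by
    rwa [← map_ofNat (algebraMap k (AlgebraicClosure k)) 2, map_ne_zero]
  have key : ∃ N : GL (Fin 2) k, ∀ M : A₁, glMap k N * M.val = (f M).val * glMap k N := by
    rcases hiso with ⟨⟨e⟩, -⟩ | ⟨h3, ⟨e⟩, -⟩
    · refine exists_rational_intertwiner_of_dihedral h2 (by decide) ?_
        (fun ρ hρ => trace_rotation_four h2 hρ) hstable₁ e f hequiv
      intro h
      exact mul_ne_zero h2 h2 (by linear_combination -h)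
    · refine exists_rational_intertwiner_of_dihedral h2 (by decide) ?_
        (fun ρ hρ => trace_rotation_six h2 hρ) hstable₁ e f hequiv
      have h3' : (3 : AlgebraicClosure k) ≠ 0 := by
        rwa [← map_ofNat (algebraMap k (AlgebraicClosure k)) 3, map_ne_zero]
      intro h
      exact h3' (by linear_combination -h)
  obtain ⟨N, hN⟩ := key
  have hconj : ∀ M : A₁, (f M).val = glMap k N * M.val * (glMap k N)⁻¹ := fun M => by
    rw [hN, mul_inv_cancel_right]
  refine ⟨N, hconj, ?_⟩
  ext M
  rw [Subgroup.mem_map]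
  constructor
  · rintro ⟨M, hM, rfl⟩
    have h := (f ⟨M, hM⟩).2
    rwa [hconj] at h
  · intro hM
    refine ⟨(f.symm ⟨M, hM⟩).val, (f.symm ⟨M, hM⟩).2, ?_⟩
    have h := hconj (f.symm ⟨M, hM⟩)
    rw [MulEquiv.apply_symm_apply] at h
    exact h.symm

end
end

section
/- Let A ≤ GL₂(k̄) be a Galois-stable subgroup isomorphic as an abstract group to the dihedral group D8 of order 8, with fields K, K₁ and K₂ = k(√v) (v ∈ k*). For d ∈ k*, say that P(d) holds if there exists W ∈ A with σ(W) = χ_d(σ)·W for all σ ∈ G_k. Then: (a) if K₁ ≠ k, then P(d) holds if and only if d ∈ k*² ∪ v·k*²; (b) if K₁ = k, then there exists m ∈ k* with K = k(√v, √m), and for any such m, P(d) holds if and only if d ∈ k*² ∪ v·k*² ∪ m·k*² ∪ vm·k*². (This computes the image of the connecting map δ : A'^{G_k} → H¹(G_k,{±1}) ≅ k*/k*² of Proposition 4.1 in the D8 case.) -/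
open Matrix

noncomputable section

/-- `P(d)` for a square root `sd` of `d` : there is `W ∈ A` with `σ(W) = χ_d(σ)·W` for all
`σ ∈ G_k`, where `χ_d(σ) ∈ {±1}` is defined by `σ(√d) = χ_d(σ)·√d`. -/
def Pcond (k : Type*) [Field k] (A : Subgroup (GL (Fin 2) (AlgebraicClosure k)))
    (sd : AlgebraicClosure k) : Prop :=
  ∃ W ∈ A, ∀ σ : Gk k,
    (σ sd = sd ∧ galHom k σ W = W) ∨ (σ sd = -sd ∧ galHom k σ W = -W)

namespace DeltaImage

theorem dihedral_four_square_ne_one :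
    ∀ x y : DihedralGroup 4, x * x ≠ 1 → y * y ≠ 1 → y = x ∨ y = x * x * x := by
  decide

theorem dihedral_four_exists_commutator :
    ∀ x : DihedralGroup 4, x * x ≠ 1 →
      ∃ y, x * x = x * y * x⁻¹ * y⁻¹ ∧ y ≠ 1 ∧ y ≠ x ∧ y ≠ x * x ∧ y ≠ x * x * x := by
  decide

theorem dihedral_four_generated :
    ∀ x y : DihedralGroup 4, x * x ≠ 1 →
      (y = 1 ∨ y = x ∨ y = x * x ∨ y = x * x * x) ∨
      ∀ z, (z = 1 ∨ z = x ∨ z = x * x ∨ z = x * x * x) ∨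
        (z = y ∨ z = x * y ∨ z = x * x * y ∨ z = x * x * x * y) := by
  decide

/-- An involution of determinant one in `GL₂` other than the identity is `-1`. -/
theorem eq_neg_one_of_sq_eq_one {F : Type*} [Field F] (h2 : (2 : F) ≠ 0)
    {N : GL (Fin 2) F} (hN : N * N = 1) (hdet : (N : Matrix (Fin 2) (Fin 2) F).det = 1)
    (hne : N ≠ 1) : N = -1 := by
  have h : (N : Matrix (Fin 2) (Fin 2) F) * N = 1 := by
    simpa using congrArg (fun M : GL (Fin 2) F => (M : Matrix (Fin 2) (Fin 2) F)) hN
  have e : ∀ i j, ((N : Matrix (Fin 2) (Fin 2) F) * N) i j = (1 : Matrix _ _ F) i j :=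
    fun i j => by rw [h]
  have hne' : (N : Matrix (Fin 2) (Fin 2) F) ≠ 1 := fun h1 => hne (Units.ext h1)
  apply Units.ext
  rw [Units.val_neg, Units.val_one]
  generalize (N : Matrix (Fin 2) (Fin 2) F) = M at *
  rw [det_fin_two] at hdet
  have e00 := e 0 0
  have e01 := e 0 1
  have e10 := e 1 0
  have e11 := e 1 1
  simp [Matrix.mul_apply, Fin.sum_univ_two] at e00 e01 e10 e11
  have htr : M 0 0 + M 1 1 ≠ 0 := fun ht => h2 (by linear_combination (M 0 0) * ht - e00 - hdet)
  have h01 : M 0 1 = 0 :=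
    (mul_eq_zero.mp (by linear_combination e01 : (M 0 0 + M 1 1) * M 0 1 = 0)).resolve_left htr
  have h10 : M 1 0 = 0 :=
    (mul_eq_zero.mp (by linear_combination e10 : (M 0 0 + M 1 1) * M 1 0 = 0)).resolve_left htr
  have hd : M 0 0 = M 1 1 := by
    rw [h01] at e00 hdet
    have : M 0 0 * (M 0 0 - M 1 1) = 0 := by linear_combination e00 - hdet
    rcases mul_eq_zero.mp this with h0 | h0
    · rw [h0] at e00; simp at e00
    · exact sub_eq_zero.mp h0
  have hs : (M 0 0 - 1) * (M 0 0 + 1) = 0 := by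
    rw [h01] at e00; linear_combination e00
  rcases mul_eq_zero.mp hs with h0 | h0
  · refine absurd ?_ hne'
    have h00 : M 0 0 = 1 := sub_eq_zero.mp h0
    ext i j
    fin_cases i <;> fin_cases j <;> simp [h01, h10, ← hd, h00]
  · have h00 : M 0 0 = -1 := eq_neg_of_add_eq_zero_left h0
    ext i j
    fin_cases i <;> fin_cases j <;> simp [h01, h10, ← hd, h00]

/-- Consequences of `A ≃* D₈` for a subgroup `A` of `GL₂` and an element `V` of order four. -/
theorem eq_neg_one_of_dihedral {F : Type*} [Field F] (h2 : (2 : F) ≠ 0)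
    {A : Subgroup (GL (Fin 2) F)} (f : A ≃* DihedralGroup 4) {V : GL (Fin 2) F}
    (hV : V ∈ A) (hord : orderOf V = 4) :
    V * V = -1 ∧ (∀ Y ∈ A, Y * Y ≠ 1 → Y = V ∨ Y = -V) ∧
      (∃ U ∈ A, U ≠ 1 ∧ U ≠ V ∧ U ≠ -1 ∧ U ≠ -V) ∧
      ∀ U ∈ A, (U = 1 ∨ U = V ∨ U = -1 ∨ U = -V) ∨
        ∀ M ∈ A, (M = 1 ∨ M = V ∨ M = -1 ∨ M = -V) ∨
          (M = U ∨ M = V * U ∨ M = -U ∨ M = -(V * U)) := by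
  have hVV : V * V ≠ 1 := fun h => by
    have := orderOf_dvd_of_pow_eq_one (n := 2) (by rw [sq, h] : V ^ 2 = 1)
    rw [hord] at this
    norm_num at this
  have hV4 : V * V * (V * V) = 1 := by
    have := pow_orderOf_eq_one V
    rw [hord] at this
    rw [← this]; simp only [pow_succ, pow_zero, one_mul, mul_assoc]
  have hfV : f ⟨V, hV⟩ * f ⟨V, hV⟩ ≠ 1 := by
    rw [← map_mul, Ne, map_eq_one_iff f f.injective]
    simpa [Subtype.ext_iff] using hVV
  obtain ⟨y, hy, hy1, hy2, hy3, hy4⟩ := dihedral_four_exists_commutator _ hfV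
  obtain ⟨⟨U, hU⟩, rfl⟩ := f.surjective y
  simp only [← map_mul, ← map_inv, f.injective.eq_iff, Ne, map_eq_one_iff f f.injective,
    Subtype.ext_iff, Subgroup.coe_mul, Subgroup.coe_inv, Subgroup.coe_one] at hy hy1 hy2 hy3 hy4
  have hneg : V * V = -1 := by
    refine eq_neg_one_of_sq_eq_one h2 hV4 ?_ hVV
    have := congrArg Matrix.GeneralLinearGroup.det hy
    have h1 : Matrix.GeneralLinearGroup.det (V * V) = 1 := by
      rw [this]; simp only [map_mul, map_inv]
      rw [mul_right_comm, mul_inv_cancel_right, mul_inv_cancel]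
    simpa using congrArg Units.val h1
  rw [hneg] at hy3 hy4
  simp only [neg_one_mul] at hy4
  refine ⟨hneg, fun Y hY hYY => ?_, ⟨U, hU, hy1, hy2, hy3, hy4⟩, fun U hU => ?_⟩
  · have := dihedral_four_square_ne_one _ (f ⟨Y, hY⟩) hfV
    simp only [← map_mul, f.injective.eq_iff, Ne, map_eq_one_iff f f.injective,
      Subtype.ext_iff, Subgroup.coe_mul, Subgroup.coe_one, hneg, neg_one_mul] at this
    exact this hYY
  · refine (dihedral_four_generated _ (f ⟨U, hU⟩) hfV).imp (fun h => ?_) (fun h M hM => ?_)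
    · simpa only [← map_mul, f.injective.eq_iff, map_eq_one_iff f f.injective,
        Subtype.ext_iff, Subgroup.coe_mul, Subgroup.coe_one, hneg, neg_one_mul] using h
    · simpa only [← map_mul, f.injective.eq_iff, map_eq_one_iff f f.injective,
        Subtype.ext_iff, Subgroup.coe_mul, Subgroup.coe_one, hneg, neg_mul, one_mul]
        using h (f ⟨M, hM⟩)

section Galois

variable {k : Type*} [Field k]

theorem galHom_apply (σ : Gk k) (M : GL (Fin 2) (AlgebraicClosure k)) (i j : Fin 2) :
    (galHom k σ M : Matrix (Fin 2) (Fin 2) (AlgebraicClosure k)) i j =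
      σ ((M : Matrix (Fin 2) (Fin 2) (AlgebraicClosure k)) i j) :=
  rfl

theorem galHom_neg (σ : Gk k) (M : GL (Fin 2) (AlgebraicClosure k)) :
    galHom k σ (-M) = -galHom k σ M := by
  ext i j
  simp [galHom_apply]

/-- The Galois group acts on `x` and on `W` through the same sign character. -/
def SameSign (x : AlgebraicClosure k) (W : GL (Fin 2) (AlgebraicClosure k)) : Prop :=
  ∀ σ : Gk k, (σ x = x ∧ galHom k σ W = W) ∨ (σ x = -x ∧ galHom k σ W = -W)

/-- The Galois group acts on `x` through signs. -/
def Signed (x : AlgebraicClosure k) : Prop :=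
  ∀ σ : Gk k, σ x = x ∨ σ x = -x

theorem signed_of_sq {x : AlgebraicClosure k} {a : k}
    (h : x ^ 2 = algebraMap k (AlgebraicClosure k) a) : Signed x := fun σ => by
  apply sq_eq_sq_iff_eq_or_eq_neg.mp
  rw [← map_pow, h, AlgEquiv.commutes]

theorem Signed.mul {x y : AlgebraicClosure k} (hx : Signed x) (hy : Signed y) :
    Signed (x * y) := fun σ => by
  rcases hx σ with h | h <;> rcases hy σ with h' | h' <;> simp [h, h']

theorem SameSign.signed {x : AlgebraicClosure k} {W : GL (Fin 2) (AlgebraicClosure k)}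
    (h : SameSign x W) : Signed x :=
  fun σ => (h σ).imp And.left And.left

theorem SameSign.mul {x y : AlgebraicClosure k} {W Z : GL (Fin 2) (AlgebraicClosure k)}
    (h : SameSign x W) (h' : SameSign y Z) : SameSign (x * y) (W * Z) := fun σ => by
  rcases h σ with ⟨h1, h2⟩ | ⟨h1, h2⟩ <;> rcases h' σ with ⟨h3, h4⟩ | ⟨h3, h4⟩ <;>
    simp [h1, h2, h3, h4]

theorem sameSign_algebraMap_one (c : k) :
    SameSign (algebraMap k (AlgebraicClosure k) c) 1 := fun σ => by
  simp

theorem SameSign.algebraMap_mul {x : AlgebraicClosure k}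
    {W : GL (Fin 2) (AlgebraicClosure k)} (h : SameSign x W) (c : k) :
    SameSign (algebraMap k (AlgebraicClosure k) c * x) W := by
  simpa using (sameSign_algebraMap_one c).mul h

theorem two_ne_zero_closure (h2 : (2 : k) ≠ 0) : (2 : AlgebraicClosure k) ≠ 0 := by
  rw [← map_ofNat (algebraMap k (AlgebraicClosure k)) 2]
  exact (map_ne_zero _).mpr h2

theorem ne_neg_self (h2 : (2 : k) ≠ 0) {x : AlgebraicClosure k} (hx : x ≠ 0) : x ≠ -x := by
  have h2' : (2 : AlgebraicClosure k) ≠ 0 := two_ne_zero_closure h2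
  intro h
  exact mul_ne_zero h2' hx (by linear_combination h)

theorem gl_exists_entry_ne_zero (W : GL (Fin 2) (AlgebraicClosure k)) :
    ∃ i j, (W : Matrix (Fin 2) (Fin 2) (AlgebraicClosure k)) i j ≠ 0 := by
  by_contra! h
  exact W.ne_zero (Matrix.ext h)

theorem gl_ne_neg_self (h2 : (2 : k) ≠ 0) (W : GL (Fin 2) (AlgebraicClosure k)) : W ≠ -W := by
  obtain ⟨i, j, hij⟩ := gl_exists_entry_ne_zero W
  intro h
  apply ne_neg_self h2 hij
  simpa using congrArg
    (fun M : GL (Fin 2) (AlgebraicClosure k) => (M : Matrix (Fin 2) (Fin 2) (AlgebraicClosure k)) i j) h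

theorem SameSign.fixed_iff (h2 : (2 : k) ≠ 0) {x : AlgebraicClosure k} (hx : x ≠ 0)
    {W : GL (Fin 2) (AlgebraicClosure k)} (h : SameSign x W) (σ : Gk k) :
    galHom k σ W = W ↔ σ x = x := by
  rcases h σ with ⟨h1, h3⟩ | ⟨h1, h3⟩
  · simp [h1, h3]
  · rw [h1, h3]
    exact iff_of_false (gl_ne_neg_self h2 W).symm (ne_neg_self h2 hx).symm

theorem exists_sameSign {W : GL (Fin 2) (AlgebraicClosure k)}
    (h : ∀ σ, galHom k σ W = W ∨ galHom k σ W = -W) : ∃ x ≠ 0, SameSign x W := by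
  obtain ⟨i, j, hij⟩ := gl_exists_entry_ne_zero W
  refine ⟨_, hij, fun σ => (h σ).imp (fun h' => ⟨?_, h'⟩) (fun h' => ⟨?_, h'⟩)⟩
  · rw [← galHom_apply, h']
  · rw [← galHom_apply, h']; simp

theorem sameSign_of_fixed_iff {x : AlgebraicClosure k} (hx : Signed x)
    {W : GL (Fin 2) (AlgebraicClosure k)}
    (h : ∀ σ, galHom k σ W = W ∨ galHom k σ W = -W)
    (hiff : ∀ σ, galHom k σ W = W ↔ σ x = x) : SameSign x W := fun σ => by
  by_cases hσ : σ x = x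
  · exact .inl ⟨hσ, (hiff σ).mpr hσ⟩
  · exact .inr ⟨(hx σ).resolve_left hσ, (h σ).resolve_left (mt (hiff σ).mp hσ)⟩

variable [PerfectField k]

theorem exists_algebraMap_eq_of_fixed {x : AlgebraicClosure k} (h : ∀ σ : Gk k, σ x = x) :
    ∃ c : k, x = algebraMap k (AlgebraicClosure k) c := by
  have : IsGalois k (AlgebraicClosure k) := {}
  obtain ⟨c, hc⟩ := (InfiniteGalois.mem_range_algebraMap_iff_fixed x).mpr h
  exact ⟨c, hc.symm⟩

theorem Signed.exists_sq {x : AlgebraicClosure k} (h : Signed x) :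
    ∃ c : k, x ^ 2 = algebraMap k (AlgebraicClosure k) c :=
  exists_algebraMap_eq_of_fixed fun σ => by
    rcases h σ with h' | h' <;> simp [h']

theorem Signed.eq_of_same_sign {x z : AlgebraicClosure k} (hx0 : x ≠ 0)
    (h : ∀ σ : Gk k, (σ x = x ∧ σ z = z) ∨ (σ x = -x ∧ σ z = -z)) :
    ∃ c : k, z = algebraMap k (AlgebraicClosure k) c * x := by
  obtain ⟨c, hc⟩ := exists_algebraMap_eq_of_fixed (x := z / x) fun σ => by
    rcases h σ with ⟨h1, h3⟩ | ⟨h1, h3⟩ <;> simp [h1, h3]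
  exact ⟨c, by rw [← hc, div_mul_cancel₀ _ hx0]⟩

/-- Kummer theory for one quadratic character. -/
theorem Signed.mem_span_one {x z : AlgebraicClosure k} (hx0 : x ≠ 0) (hx : Signed x)
    (hz : Signed z) (h : ∀ σ : Gk k, σ x = x → σ z = z) :
    ∃ c : k, z = algebraMap k (AlgebraicClosure k) c ∨
      z = algebraMap k (AlgebraicClosure k) c * x := by
  by_cases hall : ∀ σ : Gk k, σ z = z
  · exact (exists_algebraMap_eq_of_fixed hall).imp fun _ => .inl
  push Not at hall
  obtain ⟨τ, hτ⟩ := hall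
  have hτx : τ x = -x := (hx τ).resolve_left (mt (h τ) hτ)
  have hτz : τ z = -z := (hz τ).resolve_left hτ
  refine (Signed.eq_of_same_sign hx0 fun σ => ?_).imp fun _ => .inr
  rcases hx σ with hσ | hσ
  · exact .inl ⟨hσ, h σ hσ⟩
  · refine .inr ⟨hσ, ?_⟩
    have := h (σ * τ) (by simp [hτx, hσ])
    rw [AlgEquiv.mul_apply, hτz, map_neg] at this
    rw [← this, neg_neg, this]

/-- Kummer theory for two quadratic characters. -/
theorem Signed.mem_span_two {x y z : AlgebraicClosure k} (hx0 : x ≠ 0) (hy0 : y ≠ 0)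
    (hx : Signed x) (hy : Signed y) (hz : Signed z)
    (h : ∀ σ : Gk k, σ x = x → σ y = y → σ z = z) :
    ∃ c : k, z = algebraMap k (AlgebraicClosure k) c ∨
      z = algebraMap k (AlgebraicClosure k) c * x ∨
      z = algebraMap k (AlgebraicClosure k) c * y ∨
      z = algebraMap k (AlgebraicClosure k) c * (x * y) := by
  by_cases hall : ∀ σ : Gk k, σ x = x → σ z = z
  · obtain ⟨c, hc | hc⟩ := Signed.mem_span_one hx0 hx hz hall
    · exact ⟨c, .inl hc⟩
    · exact ⟨c, .inr (.inl hc)⟩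
  push Not at hall
  obtain ⟨τ, hτx, hτ⟩ := hall
  have hτz : τ z = -z := (hz τ).resolve_left hτ
  have hτy : τ y = -y := (hy τ).resolve_left (mt (h τ hτx) hτ)
  obtain ⟨b, hb⟩ := hy.exists_sq
  have hb0 : algebraMap k (AlgebraicClosure k) b ≠ 0 := hb ▸ pow_ne_zero 2 hy0
  have key : ∀ σ : Gk k, σ x = x → σ (z * y) = z * y := fun σ hσ => by
    rcases hy σ with h1 | h1
    · rw [map_mul, h1, h σ hσ h1]
    · have h3 := h (σ * τ) (by simp [hσ, hτx]) (by simp [hτy, h1])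
      rw [AlgEquiv.mul_apply, hτz, map_neg] at h3
      rw [map_mul, h1, mul_neg, ← neg_mul, h3]
  obtain ⟨c, hc | hc⟩ := Signed.mem_span_one hx0 hx (hz.mul hy) key
  · refine ⟨c / b, .inr (.inr (.inl ?_))⟩
    rw [map_div₀, div_mul_eq_mul_div, eq_div_iff hb0, ← hb]
    linear_combination y * hc
  · refine ⟨c / b, .inr (.inr (.inr ?_))⟩
    rw [map_div₀, div_mul_eq_mul_div, eq_div_iff hb0, ← hb]
    linear_combination y * hc

end Galois

theorem exists_eq_mul_of_sq {k : Type*} [Field k] {x z : AlgebraicClosure k} {a d c : k}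
    (hx : x ^ 2 = algebraMap k (AlgebraicClosure k) a)
    (hz : z ^ 2 = algebraMap k (AlgebraicClosure k) d) (h : d = a * c ^ 2) :
    ∃ e : k, z = algebraMap k (AlgebraicClosure k) e * x := by
  have : z ^ 2 = (algebraMap k (AlgebraicClosure k) c * x) ^ 2 := by
    rw [hz, h, mul_pow, hx, map_mul, map_pow, mul_comm]
  rcases sq_eq_sq_iff_eq_or_eq_neg.mp this with h | h
  · exact ⟨c, h⟩
  · exact ⟨-c, by simp [h]⟩

theorem exists_sq_of_eq_mul {k : Type*} [Field k] {x z : AlgebraicClosure k} {a d c : k}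
    (hd : d ≠ 0)
    (hx : x ^ 2 = algebraMap k (AlgebraicClosure k) a)
    (hz : z ^ 2 = algebraMap k (AlgebraicClosure k) d)
    (h : z = algebraMap k (AlgebraicClosure k) c * x) : c ≠ 0 ∧ d = a * c ^ 2 := by
  have : d = a * c ^ 2 := by
    apply (algebraMap k (AlgebraicClosure k)).injective
    rw [← hz, h, mul_pow, hx, map_mul, map_pow, mul_comm]
  refine ⟨?_, this⟩
  rintro rfl
  simp_all

end DeltaImage

/-- the image of the connecting map `δ`, `D8` case; Proposition 7 of
Cardona–Quer.  Let `A ≤ GL₂(k̄)` be Galois-stable, abstractly isomorphic to `D8`, with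
`K₂ = k(√v)`.  (a) If `K₁ ≠ k` then `P(d)` holds iff `d ∈ k*² ∪ v·k*²`.
(b) If `K₁ = k` then `K = k(√v, √m)` for some `m ∈ k*`, and for any such `m`,
`P(d)` holds iff `d ∈ k*² ∪ v·k*² ∪ m·k*² ∪ vm·k*²`.
Field equalities between fixed fields are expressed, via the Galois correspondence, as
equalities of the corresponding subgroups of `G_k`. -/
theorem delta_image_D8 {k : Type*} [Field k] [PerfectField k]
    (hchar : (2 : k) ≠ 0)
    (A : Subgroup (GL (Fin 2) (AlgebraicClosure k)))
    (hstable : ∀ σ : Gk k, ∀ M ∈ A, galHom k σ M ∈ A)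
    (hD8 : Nonempty (A ≃* DihedralGroup 4))
    (V : GL (Fin 2) (AlgebraicClosure k)) (hVA : V ∈ A) (hVord : orderOf V = 4)
    (v : k) (hv : v ≠ 0)
    (sv : AlgebraicClosure k)
    (hsv : sv ^ 2 = algebraMap k (AlgebraicClosure k) v)
    -- `K₂ = k(√v)`:
    (hK2 : ∀ σ : Gk k, galHom k σ V = V ↔ σ sv = sv) :
    -- (a) the case `K₁ ≠ k`:
    ((¬ ∀ σ : Gk k, ∀ M ∈ A, galHom k σ M * M⁻¹ ∈
        ({1, -1} : Set (GL (Fin 2) (AlgebraicClosure k)))) →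
      ∀ d : k, d ≠ 0 → ∀ sd : AlgebraicClosure k,
        sd ^ 2 = algebraMap k (AlgebraicClosure k) d →
        (Pcond k A sd ↔ ∃ c : k, c ≠ 0 ∧ (d = c ^ 2 ∨ d = v * c ^ 2))) ∧
    -- (b) the case `K₁ = k`:
    ((∀ σ : Gk k, ∀ M ∈ A, galHom k σ M * M⁻¹ ∈
        ({1, -1} : Set (GL (Fin 2) (AlgebraicClosure k)))) →
      -- there is `m ∈ k*` with `K = k(√v, √m)`:
      (∃ (m : k) (sm : AlgebraicClosure k), m ≠ 0 ∧
        sm ^ 2 = algebraMap k (AlgebraicClosure k) m ∧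
        (∀ σ : Gk k, (∀ M ∈ A, galHom k σ M = M) ↔ (σ sv = sv ∧ σ sm = sm))) ∧
      -- and for any such `m`:
      ∀ (m : k) (sm : AlgebraicClosure k), m ≠ 0 →
        sm ^ 2 = algebraMap k (AlgebraicClosure k) m →
        (∀ σ : Gk k, (∀ M ∈ A, galHom k σ M = M) ↔ (σ sv = sv ∧ σ sm = sm)) →
        ∀ d : k, d ≠ 0 → ∀ sd : AlgebraicClosure k,
          sd ^ 2 = algebraMap k (AlgebraicClosure k) d →
          (Pcond k A sd ↔
            ∃ c : k, c ≠ 0 ∧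
              (d = c ^ 2 ∨ d = v * c ^ 2 ∨ d = m * c ^ 2 ∨ d = v * m * c ^ 2))) := by
  obtain ⟨f⟩ := hD8
  have h2 := DeltaImage.two_ne_zero_closure hchar
  obtain ⟨hneg, hsq, ⟨U, hUA, hU1, hU2, hU3, hU4⟩, hgen⟩ :=
    DeltaImage.eq_neg_one_of_dihedral h2 f hVA hVord
  have hne {a : k} {x : AlgebraicClosure k} (ha : a ≠ 0)
      (hx : x ^ 2 = algebraMap k (AlgebraicClosure k) a) : x ≠ 0 := by
    rintro rfl
    exact ha (by simpa using hx.symm)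
  have hVs : ∀ σ, galHom k σ V = V ∨ galHom k σ V = -V := fun σ => by
    refine hsq _ (hstable σ V hVA) fun h => ?_
    rw [← map_mul, map_eq_one_iff _ (galHom k σ).injective, hneg] at h
    exact DeltaImage.gl_ne_neg_self hchar 1 h.symm
  have hsv0 : sv ≠ 0 := hne hv hsv
  have hVsv : DeltaImage.SameSign sv V :=
    DeltaImage.sameSign_of_fixed_iff (DeltaImage.signed_of_sq hsv) hVs hK2
  have hone : DeltaImage.SameSign (1 : AlgebraicClosure k) 1 := fun σ => by simp
  have hone2 : (1 : AlgebraicClosure k) ^ 2 = algebraMap k (AlgebraicClosure k) 1 := by simp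
  have hsign (σ : Gk k) (M : GL (Fin 2) (AlgebraicClosure k)) :
      galHom k σ M * M⁻¹ ∈ ({1, -1} : Set (GL (Fin 2) (AlgebraicClosure k))) ↔
        galHom k σ M = M ∨ galHom k σ M = -M := by
    rw [Set.mem_insert_iff, Set.mem_singleton_iff, mul_inv_eq_iff_eq_mul, mul_inv_eq_iff_eq_mul,
      one_mul, neg_one_mul]
  simp only [hsign]
  constructor
  · intro hK1 d hd sd hsd
    constructor
    · rintro ⟨W, hWA, hW⟩
      have hsigned : DeltaImage.Signed sd := DeltaImage.SameSign.signed hW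
      rcases hgen W hWA with hW' | hW'
      · have hfix (σ : Gk k) (hσ : σ sv = sv) : σ sd = sd := by
          have hσV := (hK2 σ).mpr hσ
          refine (DeltaImage.SameSign.fixed_iff hchar (hne hd hsd) hW σ).mp ?_
          rcases hW' with rfl | rfl | rfl | rfl <;> simp [DeltaImage.galHom_neg, hσV]
        obtain ⟨c, hc | hc⟩ :=
          DeltaImage.Signed.mem_span_one hsv0 hVsv.signed hsigned hfix
        · have := DeltaImage.exists_sq_of_eq_mul hd hone2 hsd (by rw [hc, mul_one])
          exact ⟨c, this.1, .inl (by rw [this.2, one_mul])⟩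
        · have := DeltaImage.exists_sq_of_eq_mul hd hsv hsd hc
          exact ⟨c, this.1, .inr this.2⟩
      · refine absurd (fun σ M hM => ?_) hK1
        have hWσ : galHom k σ W = W ∨ galHom k σ W = -W := (hW σ).imp And.right And.right
        rcases hW' M hM with (rfl | rfl | rfl | rfl) | (rfl | rfl | rfl | rfl) <;>
          rcases hVs σ with h | h <;> rcases hWσ with h' | h' <;>
          simp [DeltaImage.galHom_neg, h, h']
    · rintro ⟨c, -, h | h⟩
      · obtain ⟨e, rfl⟩ := DeltaImage.exists_eq_mul_of_sq hone2 hsd (by rw [h, one_mul])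
        exact ⟨1, A.one_mem, hone.algebraMap_mul e⟩
      · obtain ⟨e, rfl⟩ := DeltaImage.exists_eq_mul_of_sq hsv hsd h
        exact ⟨V, hVA, hVsv.algebraMap_mul e⟩
  · intro hK1
    obtain ⟨u, hu0, hUu⟩ := DeltaImage.exists_sameSign (fun σ => hK1 σ U hUA)
    have hUV := (hgen U hUA).resolve_left (by simp [hU1, hU2, hU3, hU4])
    have hfixA (σ : Gk k) : (∀ M ∈ A, galHom k σ M = M) ↔ (σ sv = sv ∧ σ u = u) := by
      rw [← hVsv.fixed_iff hchar hsv0, ← hUu.fixed_iff hchar hu0]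
      refine ⟨fun h => ⟨h V hVA, h U hUA⟩, fun ⟨h, h'⟩ M hM => ?_⟩
      rcases hUV M hM with (rfl | rfl | rfl | rfl) | (rfl | rfl | rfl | rfl) <;>
        simp [DeltaImage.galHom_neg, h, h']
    refine ⟨?_, ?_⟩
    · obtain ⟨m, hm⟩ := hUu.signed.exists_sq
      refine ⟨m, u, ?_, hm, hfixA⟩
      rintro rfl
      exact hu0 (by simpa using hm)
    · intro m sm hm hsm hfix d hd sd hsd
      have hsm0 := hne hm hsm
      have hsms := DeltaImage.signed_of_sq hsm
      have hvm : (sv * sm) ^ 2 = algebraMap k (AlgebraicClosure k) (v * m) := by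
        rw [mul_pow, hsv, hsm, map_mul]
      constructor
      · rintro ⟨W, hWA, hW⟩
        obtain ⟨c, hc | hc | hc | hc⟩ := DeltaImage.Signed.mem_span_two hsv0 hsm0
          hVsv.signed hsms (DeltaImage.SameSign.signed hW) fun σ h h' =>
            (DeltaImage.SameSign.fixed_iff hchar (hne hd hsd) hW σ).mp
              ((hfix σ).mpr ⟨h, h'⟩ W hWA)
        · have := DeltaImage.exists_sq_of_eq_mul hd hone2 hsd (by rw [hc, mul_one])
          exact ⟨c, this.1, .inl (by rw [this.2, one_mul])⟩
        · have := DeltaImage.exists_sq_of_eq_mul hd hsv hsd hc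
          exact ⟨c, this.1, .inr (.inl this.2)⟩
        · have := DeltaImage.exists_sq_of_eq_mul hd hsm hsd hc
          exact ⟨c, this.1, .inr (.inr (.inl this.2))⟩
        · have := DeltaImage.exists_sq_of_eq_mul hd hvm hsd hc
          exact ⟨c, this.1, .inr (.inr (.inr this.2))⟩
      · rintro ⟨c, -, h⟩
        have hsd_fix (σ : Gk k) (h1 : σ sv = sv) (h2 : σ u = u) : σ sd = sd := by
          have h3 : σ sm = sm := ((hfix σ).mp ((hfixA σ).mpr ⟨h1, h2⟩)).2
          rcases h with h | h | h | h
          · obtain ⟨e, rfl⟩ := DeltaImage.exists_eq_mul_of_sq hone2 hsd (by rw [h, one_mul])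
            simp
          · obtain ⟨e, rfl⟩ := DeltaImage.exists_eq_mul_of_sq hsv hsd h
            simp [h1]
          · obtain ⟨e, rfl⟩ := DeltaImage.exists_eq_mul_of_sq hsm hsd h
            simp [h3]
          · obtain ⟨e, rfl⟩ := DeltaImage.exists_eq_mul_of_sq hvm hsd h
            simp [h1, h3]
        obtain ⟨e, rfl | rfl | rfl | rfl⟩ := DeltaImage.Signed.mem_span_two hsv0 hu0
          hVsv.signed hUu.signed (DeltaImage.signed_of_sq hsd) hsd_fix
        · exact ⟨1, A.one_mem, DeltaImage.sameSign_algebraMap_one e⟩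
        · exact ⟨V, hVA, hVsv.algebraMap_mul e⟩
        · exact ⟨U, hUA, hUu.algebraMap_mul e⟩
        · exact ⟨V * U, A.mul_mem hVA hUA, (hVsv.mul hUu).algebraMap_mul e⟩

end
end
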